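/- Let A be a self-dual object in a braided monoidal 2-category with duals. Then a unitary 2-morphism W_A : i_A ⇒ i_A R_{A,A} is a writhing for A if and only if it satisfies the equation W̄_A = (i_A i_{R_{A,A}})·(W*_A R*_{A,A}), where W̄_A : i_A ⇒ i_A R*_{A,A} is defined by W̄_A = γ · (W_A^{†*})^ · δ with γ = i_A(T_A†⊗A) and δ = [i_A(H*_{A,A}⊗A)(e_A⊗A⊗A)]·[i_A(i_A⊗A⊗A)(H̄†*_{A,A}⊗A)]·[⊗_{i_A R*_{A,A}, i_A}(A⊗e_A⊗A)]·[i_A R*_{A,A}(A⊗T_A†*)]. -/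

import Mathlib

/-! ## Strict 2-categories, presented globularly with totalized operations.
Equations are imposed only when the relevant composability conditions hold. -/

/-- A (strict) 2-category: objects, 1-morphisms, 2-morphisms with vertical and
horizontal composition, identities, unit and associativity laws, and the
exchange identity.  Composition is written diagrammatically: `comp f g = fg`. -/
structure TwoCat where
  Obj : Type
  Mor : Type
  Cell : Type
  src₁ : Mor → Obj
  tgt₁ : Mor → Obj
  src₂ : Cell → Mor
  tgt₂ : Cell → Mor
  id₁ : Obj → Mor
  id₂ : Mor → Cell
  comp : Mor → Mor → Mor
  vcomp : Cell → Cell → Cell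
  hcomp : Cell → Cell → Cell
  id₁_src : ∀ A, src₁ (id₁ A) = A
  id₁_tgt : ∀ A, tgt₁ (id₁ A) = A
  id₂_src : ∀ f, src₂ (id₂ f) = f
  id₂_tgt : ∀ f, tgt₂ (id₂ f) = f
  cell_src_src : ∀ α, src₁ (src₂ α) = src₁ (tgt₂ α)
  cell_tgt_tgt : ∀ α, tgt₁ (src₂ α) = tgt₁ (tgt₂ α)
  comp_src : ∀ f g, tgt₁ f = src₁ g → src₁ (comp f g) = src₁ f
  comp_tgt : ∀ f g, tgt₁ f = src₁ g → tgt₁ (comp f g) = tgt₁ g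
  vcomp_src : ∀ α β, tgt₂ α = src₂ β → src₂ (vcomp α β) = src₂ α
  vcomp_tgt : ∀ α β, tgt₂ α = src₂ β → tgt₂ (vcomp α β) = tgt₂ β
  hcomp_src : ∀ α β, tgt₁ (src₂ α) = src₁ (src₂ β) →
    src₂ (hcomp α β) = comp (src₂ α) (src₂ β)
  hcomp_tgt : ∀ α β, tgt₁ (src₂ α) = src₁ (src₂ β) →
    tgt₂ (hcomp α β) = comp (tgt₂ α) (tgt₂ β)
  comp_id_left : ∀ f, comp (id₁ (src₁ f)) f = f
  comp_id_right : ∀ f, comp f (id₁ (tgt₁ f)) = f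
  comp_assoc : ∀ f g h, tgt₁ f = src₁ g → tgt₁ g = src₁ h →
    comp (comp f g) h = comp f (comp g h)
  vcomp_id_left : ∀ α, vcomp (id₂ (src₂ α)) α = α
  vcomp_id_right : ∀ α, vcomp α (id₂ (tgt₂ α)) = α
  vcomp_assoc : ∀ α β γ, tgt₂ α = src₂ β → tgt₂ β = src₂ γ →
    vcomp (vcomp α β) γ = vcomp α (vcomp β γ)
  hcomp_id₂ : ∀ f g, tgt₁ f = src₁ g → hcomp (id₂ f) (id₂ g) = id₂ (comp f g)
  hcomp_id_left : ∀ α, hcomp (id₂ (id₁ (src₁ (src₂ α)))) α = α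
  hcomp_id_right : ∀ α, hcomp α (id₂ (id₁ (tgt₁ (src₂ α)))) = α
  hcomp_assoc : ∀ α β γ, tgt₁ (src₂ α) = src₁ (src₂ β) → tgt₁ (src₂ β) = src₁ (src₂ γ) →
    hcomp (hcomp α β) γ = hcomp α (hcomp β γ)
  exchange : ∀ α β γ δ, tgt₂ α = src₂ β → tgt₂ γ = src₂ δ →
    tgt₁ (src₂ α) = src₁ (src₂ γ) →
    hcomp (vcomp α β) (vcomp γ δ) = vcomp (hcomp α γ) (hcomp β δ)

namespace TwoCat

/-- `β` is a (vertical) inverse of the 2-morphism `α`. -/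
def InvPair (C : TwoCat) (α β : C.Cell) : Prop :=
  C.src₂ β = C.tgt₂ α ∧ C.tgt₂ β = C.src₂ α ∧
  C.vcomp α β = C.id₂ (C.src₂ α) ∧ C.vcomp β α = C.id₂ (C.tgt₂ α)

/-- The 2-morphism `α` is invertible (a 2-isomorphism). -/
def Invertible2 (C : TwoCat) (α : C.Cell) : Prop := ∃ β, C.InvPair α β

/-- The 1-morphisms `f` and `g` are 2-isomorphic. -/
def Iso2 (C : TwoCat) (f g : C.Mor) : Prop :=
  ∃ α, C.src₂ α = f ∧ C.tgt₂ α = g ∧ C.Invertible2 α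

/-- The 1-morphism `f` is an equivalence. -/
def IsEquiv₁ (C : TwoCat) (f : C.Mor) : Prop :=
  ∃ g, C.src₁ g = C.tgt₁ f ∧ C.tgt₁ g = C.src₁ f ∧
    C.Iso2 (C.comp f g) (C.id₁ (C.src₁ f)) ∧ C.Iso2 (C.comp g f) (C.id₁ (C.tgt₁ f))

end TwoCat
/-! ## Semistrict monoidal 2-categories (Kapranov–Voevodsky), as in HDA1
Lemma 4: conditions (i)–(viii). -/

structure MonTwoCat extends TwoCat where
  unit : Obj
  tOO : Obj → Obj → Obj
  tOM : Obj → Mor → Mor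
  tMO : Mor → Obj → Mor
  tOC : Obj → Cell → Cell
  tCO : Cell → Obj → Cell
  tensorator : Mor → Mor → Cell
  tensoratorInv : Mor → Mor → Cell
  -- source/target specifications
  tOM_src : ∀ A f, src₁ (tOM A f) = tOO A (src₁ f)
  tOM_tgt : ∀ A f, tgt₁ (tOM A f) = tOO A (tgt₁ f)
  tMO_src : ∀ f A, src₁ (tMO f A) = tOO (src₁ f) A
  tMO_tgt : ∀ f A, tgt₁ (tMO f A) = tOO (tgt₁ f) A
  tOC_src : ∀ A α, src₂ (tOC A α) = tOM A (src₂ α)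
  tOC_tgt : ∀ A α, tgt₂ (tOC A α) = tOM A (tgt₂ α)
  tCO_src : ∀ α A, src₂ (tCO α A) = tMO (src₂ α) A
  tCO_tgt : ∀ α A, tgt₂ (tCO α A) = tMO (tgt₂ α) A
  tensorator_src : ∀ f g, src₂ (tensorator f g) = comp (tOM (src₁ f) g) (tMO f (tgt₁ g))
  tensorator_tgt : ∀ f g, tgt₂ (tensorator f g) = comp (tMO f (src₁ g)) (tOM (tgt₁ f) g)
  tensorator_inv : ∀ f g,
    src₂ (tensoratorInv f g) = tgt₂ (tensorator f g) ∧
    tgt₂ (tensoratorInv f g) = src₂ (tensorator f g) ∧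
    vcomp (tensorator f g) (tensoratorInv f g) = id₂ (src₂ (tensorator f g)) ∧
    vcomp (tensoratorInv f g) (tensorator f g) = id₂ (tgt₂ (tensorator f g))
  -- (i) for any object A, `A ⊗ -` and `- ⊗ A` are 2-functors
  tOM_id : ∀ A B, tOM A (id₁ B) = id₁ (tOO A B)
  tMO_id : ∀ A B, tMO (id₁ A) B = id₁ (tOO A B)
  tOC_id : ∀ A f, tOC A (id₂ f) = id₂ (tOM A f)
  tCO_id : ∀ f A, tCO (id₂ f) A = id₂ (tMO f A)
  tOM_comp : ∀ A f g, tgt₁ f = src₁ g → tOM A (comp f g) = comp (tOM A f) (tOM A g)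
  tMO_comp : ∀ f g A, tgt₁ f = src₁ g → tMO (comp f g) A = comp (tMO f A) (tMO g A)
  tOC_vcomp : ∀ A α β, tgt₂ α = src₂ β → tOC A (vcomp α β) = vcomp (tOC A α) (tOC A β)
  tCO_vcomp : ∀ α β A, tgt₂ α = src₂ β → tCO (vcomp α β) A = vcomp (tCO α A) (tCO β A)
  tOC_hcomp : ∀ A α β, tgt₁ (src₂ α) = src₁ (src₂ β) →
    tOC A (hcomp α β) = hcomp (tOC A α) (tOC A β)
  tCO_hcomp : ∀ α β A, tgt₁ (src₂ α) = src₁ (src₂ β) →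
    tCO (hcomp α β) A = hcomp (tCO α A) (tCO β A)
  -- (ii) the unit object
  tOO_unit_left : ∀ A, tOO unit A = A
  tOO_unit_right : ∀ A, tOO A unit = A
  tOM_unit : ∀ f, tOM unit f = f
  tMO_unit : ∀ f, tMO f unit = f
  tOC_unit : ∀ α, tOC unit α = α
  tCO_unit : ∀ α, tCO α unit = α
  -- (iii) strict associativity of tensoring by objects
  tOO_assoc : ∀ A B D, tOO A (tOO B D) = tOO (tOO A B) D
  tOM_assoc : ∀ A B f, tOM A (tOM B f) = tOM (tOO A B) f
  tOMO_assoc : ∀ A f B, tOM A (tMO f B) = tMO (tOM A f) B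
  tMO_assoc : ∀ f A B, tMO f (tOO A B) = tMO (tMO f A) B
  tOC_assoc : ∀ A B α, tOC A (tOC B α) = tOC (tOO A B) α
  tOCO_assoc : ∀ A α B, tOC A (tCO α B) = tCO (tOC A α) B
  tCO_assoc : ∀ α A B, tCO α (tOO A B) = tCO (tCO α A) B
  -- (iv) the tensorator and tensoring by objects
  tens_OM : ∀ A g h, tensorator (tOM A g) h = tOC A (tensorator g h)
  tens_MO_OM : ∀ f B h, tensorator (tMO f B) h = tensorator f (tOM B h)
  tens_MO : ∀ f g D, tensorator f (tMO g D) = tCO (tensorator f g) D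
  -- (v) the tensorator on identities
  tens_id_left : ∀ A g, tensorator (id₁ A) g = id₂ (tOM A g)
  tens_id_right : ∀ f B, tensorator f (id₁ B) = id₂ (tMO f B)
  -- (vi) naturality of the tensorator in its second argument
  tens_nat_right : ∀ f β,
    vcomp (hcomp (tOC (src₁ f) β) (id₂ (tMO f (tgt₁ (src₂ β))))) (tensorator f (tgt₂ β))
    = vcomp (tensorator f (src₂ β)) (hcomp (id₂ (tMO f (src₁ (src₂ β)))) (tOC (tgt₁ f) β))
  -- (vii) naturality of the tensorator in its first argument
  tens_nat_left : ∀ α h,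
    vcomp (hcomp (id₂ (tOM (src₁ (src₂ α)) h)) (tCO α (tgt₁ h))) (tensorator (tgt₂ α) h)
    = vcomp (tensorator (src₂ α) h) (hcomp (tCO α (src₁ h)) (id₂ (tOM (tgt₁ (src₂ α)) h)))
  -- (viii) the tensorator and composition
  tens_comp_right : ∀ f g g', tgt₁ g = src₁ g' →
    tensorator f (comp g g')
    = vcomp (hcomp (id₂ (tOM (src₁ f) g)) (tensorator f g'))
        (hcomp (tensorator f g) (id₂ (tOM (tgt₁ f) g')))
  tens_comp_left : ∀ f f' g, tgt₁ f = src₁ f' →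
    tensorator (comp f f') g
    = vcomp (hcomp (tensorator f g) (id₂ (tMO f' (tgt₁ g))))
        (hcomp (id₂ (tMO f (src₁ g))) (tensorator f' g))
/-! ## Monoidal 2-categories with duals (HDA IV, Definition 6). -/

/-- The duality *data* on a semistrict monoidal 2-category: duals of objects,
1-morphisms and 2-morphisms, units, counits and triangulators, with their
source/target specifications. -/
structure DualsData extends MonTwoCat where
  dObj : Obj → Obj
  dMor : Mor → Mor
  dCell : Cell → Cell
  iObj : Obj → Mor
  eObj : Obj → Mor
  iCell : Mor → Cell
  eCell : Mor → Cell
  tri : Obj → Cell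
  dMor_src : ∀ f, src₁ (dMor f) = tgt₁ f
  dMor_tgt : ∀ f, tgt₁ (dMor f) = src₁ f
  dCell_src : ∀ α, src₂ (dCell α) = tgt₂ α
  dCell_tgt : ∀ α, tgt₂ (dCell α) = src₂ α
  iObj_src : ∀ A, src₁ (iObj A) = unit
  iObj_tgt : ∀ A, tgt₁ (iObj A) = tOO A (dObj A)
  eObj_src : ∀ A, src₁ (eObj A) = tOO (dObj A) A
  eObj_tgt : ∀ A, tgt₁ (eObj A) = unit
  iCell_src : ∀ f, src₂ (iCell f) = id₁ (src₁ f)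
  iCell_tgt : ∀ f, tgt₂ (iCell f) = comp f (dMor f)
  eCell_src : ∀ f, src₂ (eCell f) = comp (dMor f) f
  eCell_tgt : ∀ f, tgt₂ (eCell f) = id₁ (tgt₁ f)
  tri_src : ∀ A, src₂ (tri A) = comp (tMO (iObj A) A) (tOM A (eObj A))
  tri_tgt : ∀ A, tgt₂ (tri A) = id₁ A

namespace DualsData

/-- A 2-morphism is unitary if it is invertible with inverse its dual. -/
def Unitary (C : DualsData) (α : C.Cell) : Prop :=
  C.vcomp α (C.dCell α) = C.id₂ (C.src₂ α) ∧ C.vcomp (C.dCell α) α = C.id₂ (C.tgt₂ α)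

/-- The adjoint `α† = (g* i_f) ⋅ (g* α f*) ⋅ (e_g f*)` of a 2-morphism `α : f ⇒ g`. -/
def adj (C : DualsData) (α : C.Cell) : C.Cell :=
  C.vcomp (C.vcomp
    (C.hcomp (C.id₂ (C.dMor (C.tgt₂ α))) (C.iCell (C.src₂ α)))
    (C.hcomp (C.hcomp (C.id₂ (C.dMor (C.tgt₂ α))) α) (C.id₂ (C.dMor (C.src₂ α)))))
    (C.hcomp (C.eCell (C.tgt₂ α)) (C.id₂ (C.dMor (C.src₂ α))))

end DualsData

/-- The thirteen conditions in the definition of a monoidal 2-category with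
duals (HDA IV, Definition 6). -/
structure DualsLaws (C : DualsData) : Prop where
  -- 1. `X** = X`
  dObj_invol : ∀ A, C.dObj (C.dObj A) = A
  dMor_invol : ∀ f, C.dMor (C.dMor f) = f
  dCell_invol : ∀ α, C.dCell (C.dCell α) = α
  -- 2. `1_X* = 1_X`
  dMor_id : ∀ A, C.dMor (C.id₁ A) = C.id₁ A
  dCell_id : ∀ f, C.dCell (C.id₂ f) = C.id₂ f
  -- 3. behaviour of duals under composition and tensoring
  dCell_vcomp : ∀ α β, C.tgt₂ α = C.src₂ β →
    C.dCell (C.vcomp α β) = C.vcomp (C.dCell β) (C.dCell α)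
  dCell_hcomp : ∀ α β, C.tgt₁ (C.src₂ α) = C.src₁ (C.src₂ β) →
    C.dCell (C.hcomp α β) = C.hcomp (C.dCell α) (C.dCell β)
  dMor_comp : ∀ f g, C.tgt₁ f = C.src₁ g →
    C.dMor (C.comp f g) = C.comp (C.dMor g) (C.dMor f)
  dCell_tOC : ∀ A α, C.dCell (C.tOC A α) = C.tOC A (C.dCell α)
  dCell_tCO : ∀ α A, C.dCell (C.tCO α A) = C.tCO (C.dCell α) A
  dMor_tOM : ∀ A f, C.dMor (C.tOM A f) = C.tOM A (C.dMor f)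
  dMor_tMO : ∀ f A, C.dMor (C.tMO f A) = C.tMO (C.dMor f) A
  dObj_tOO : ∀ A B, C.dObj (C.tOO A B) = C.tOO (C.dObj B) (C.dObj A)
  -- 4. the tensorator is unitary
  tensorator_unitary : ∀ f g, C.Unitary (C.tensorator f g)
  -- 5. `i_{X*} = e_X*` and `e_{X*} = i_X*`
  iObj_dual : ∀ A, C.iObj (C.dObj A) = C.dMor (C.eObj A)
  eObj_dual : ∀ A, C.eObj (C.dObj A) = C.dMor (C.iObj A)
  iCell_dual : ∀ f, C.iCell (C.dMor f) = C.dCell (C.eCell f)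
  eCell_dual : ∀ f, C.eCell (C.dMor f) = C.dCell (C.iCell f)
  -- 6. the triangulator is unitary
  tri_unitary : ∀ A, C.Unitary (C.tri A)
  -- 7. `T_I = 1_{1_I}`
  tri_unit : C.tri C.unit = C.id₂ (C.id₁ C.unit)
  -- 8. units, counits and triangulators of tensor products
  iObj_tensor : ∀ A B, C.iObj (C.tOO A B)
    = C.comp (C.iObj A) (C.tOM A (C.tMO (C.iObj B) (C.dObj A)))
  eObj_tensor : ∀ A B, C.eObj (C.tOO A B)
    = C.comp (C.tOM (C.dObj B) (C.tMO (C.eObj A) B)) (C.eObj B)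
  tri_tensor : ∀ A B, C.tri (C.tOO A B) =
    C.vcomp (C.hcomp (C.id₂ (C.tMO (C.iObj A) (C.tOO A B)))
        (C.hcomp (C.tOC A (C.tCO (C.tensoratorInv (C.iObj B) (C.eObj A)) B))
          (C.id₂ (C.tOM (C.tOO A B) (C.eObj B)))))
      (C.hcomp (C.tCO (C.tri A) B) (C.tOC A (C.tri B)))
  -- 9. units and counits of tensor products with objects
  iCell_tOM : ∀ A f, C.iCell (C.tOM A f) = C.tOC A (C.iCell f)
  iCell_tMO : ∀ f A, C.iCell (C.tMO f A) = C.tCO (C.iCell f) A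
  eCell_tOM : ∀ A f, C.eCell (C.tOM A f) = C.tOC A (C.eCell f)
  eCell_tMO : ∀ f A, C.eCell (C.tMO f A) = C.tCO (C.eCell f) A
  -- 10. units and counits of composites
  iCell_comp : ∀ f g, C.tgt₁ f = C.src₁ g → C.iCell (C.comp f g)
    = C.vcomp (C.iCell f) (C.hcomp (C.hcomp (C.id₂ f) (C.iCell g)) (C.id₂ (C.dMor f)))
  eCell_comp : ∀ f g, C.tgt₁ f = C.src₁ g → C.eCell (C.comp f g)
    = C.vcomp (C.hcomp (C.hcomp (C.id₂ (C.dMor g)) (C.eCell f)) (C.id₂ g)) (C.eCell g)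
  -- 11. the triangle identities
  triangle₁ : ∀ f,
    C.vcomp (C.hcomp (C.iCell f) (C.id₂ f)) (C.hcomp (C.id₂ f) (C.eCell f)) = C.id₂ f
  triangle₂ : ∀ f,
    C.vcomp (C.hcomp (C.id₂ (C.dMor f)) (C.iCell f))
      (C.hcomp (C.eCell f) (C.id₂ (C.dMor f))) = C.id₂ (C.dMor f)
  -- 12. `α†* = α*†`
  adj_star : ∀ α, C.dCell (C.adj α) = C.adj (C.dCell α)
  -- 13. the swallowtail coherence law
  swallowtail : ∀ A,
    C.vcomp (C.vcomp
      (C.hcomp (C.id₂ (C.iObj A)) (C.tOC A (C.adj (C.tri (C.dObj A)))))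
      (C.hcomp (C.tensoratorInv (C.iObj A) (C.iObj A))
        (C.id₂ (C.tOM A (C.tMO (C.eObj A) (C.dObj A))))))
      (C.hcomp (C.id₂ (C.iObj A)) (C.tCO (C.tri A) (C.dObj A)))
    = C.id₂ (C.iObj A)
/-! ## Braided monoidal 2-categories with duals. -/

/-- Data of a braided monoidal 2-category with duals. -/
structure BMWDData extends DualsData where
  braid : Obj → Obj → Mor
  braidMorL : Mor → Obj → Cell
  braidMorR : Obj → Mor → Cell
  braidMorLInv : Mor → Obj → Cell
  braidMorRInv : Obj → Mor → Cell
  Rt1 : Obj → Obj → Obj → Cell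
  Rt2 : Obj → Obj → Obj → Cell
  Rt1Inv : Obj → Obj → Obj → Cell
  Rt2Inv : Obj → Obj → Obj → Cell

/-- The axioms of a semistrict braided monoidal 2-category with duals:
the monoidal duality axioms, the braided axioms of HDA1/Crans, and the
requirement that the braiding be unitary (HDA IV, Definition 7). -/
structure IsBMWD (C : BMWDData) : Prop where
  duals : DualsLaws C.toDualsData
  -- source/target specifications for the braiding
  braid_src : ∀ A B, C.src₁ (C.braid A B) = C.tOO A B
  braid_tgt : ∀ A B, C.tgt₁ (C.braid A B) = C.tOO B A
  braidMorL_src : ∀ f B, C.src₂ (C.braidMorL f B) = C.comp (C.tMO f B) (C.braid (C.tgt₁ f) B)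
  braidMorL_tgt : ∀ f B, C.tgt₂ (C.braidMorL f B) = C.comp (C.braid (C.src₁ f) B) (C.tOM B f)
  braidMorR_src : ∀ A g, C.src₂ (C.braidMorR A g) = C.comp (C.tOM A g) (C.braid A (C.tgt₁ g))
  braidMorR_tgt : ∀ A g, C.tgt₂ (C.braidMorR A g) = C.comp (C.braid A (C.src₁ g)) (C.tMO g A)
  Rt1_src : ∀ A B D, C.src₂ (C.Rt1 A B D)
    = C.comp (C.tMO (C.braid A B) D) (C.tOM B (C.braid A D))
  Rt1_tgt : ∀ A B D, C.tgt₂ (C.Rt1 A B D) = C.braid A (C.tOO B D)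
  Rt2_src : ∀ A B D, C.src₂ (C.Rt2 A B D)
    = C.comp (C.tOM A (C.braid B D)) (C.tMO (C.braid A D) B)
  Rt2_tgt : ∀ A B D, C.tgt₂ (C.Rt2 A B D) = C.braid (C.tOO A B) D
  -- the designated inverses really are inverses (so all braiding 2-morphisms
  -- are 2-isomorphisms)
  braidMorL_inv : ∀ f B, TwoCat.InvPair C.toTwoCat (C.braidMorL f B) (C.braidMorLInv f B)
  braidMorR_inv : ∀ A g, TwoCat.InvPair C.toTwoCat (C.braidMorR A g) (C.braidMorRInv A g)
  Rt1_inv : ∀ A B D, TwoCat.InvPair C.toTwoCat (C.Rt1 A B D) (C.Rt1Inv A B D)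
  Rt2_inv : ∀ A B D, TwoCat.InvPair C.toTwoCat (C.Rt2 A B D) (C.Rt2Inv A B D)
  -- the braiding is an equivalence
  braid_equiv : ∀ A B, TwoCat.IsEquiv₁ C.toTwoCat (C.braid A B)
  -- (→ ⊗ →)
  arrow_arrow : ∀ f g,
    C.vcomp (C.vcomp
      (C.hcomp (C.id₂ (C.tMO f (C.src₁ g))) (C.braidMorR (C.tgt₁ f) g))
      (C.hcomp (C.braidMorL f (C.src₁ g)) (C.id₂ (C.tMO g (C.tgt₁ f)))))
      (C.hcomp (C.id₂ (C.braid (C.src₁ f) (C.src₁ g))) (C.tensorator g f))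
    = C.vcomp (C.vcomp
      (C.hcomp (C.tensoratorInv f g) (C.id₂ (C.braid (C.tgt₁ f) (C.tgt₁ g))))
      (C.hcomp (C.id₂ (C.tOM (C.src₁ f) g)) (C.braidMorL f (C.tgt₁ g))))
      (C.hcomp (C.braidMorR (C.src₁ f) g) (C.id₂ (C.tOM (C.tgt₁ g) f)))
  -- (• ⊗ ⇓)
  dot_cell : ∀ α B,
    C.vcomp (C.braidMorL (C.src₂ α) B)
      (C.hcomp (C.id₂ (C.braid (C.src₁ (C.src₂ α)) B)) (C.tOC B α))
    = C.vcomp (C.hcomp (C.tCO α B) (C.id₂ (C.braid (C.tgt₁ (C.src₂ α)) B)))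
      (C.braidMorL (C.tgt₂ α) B)
  -- (⇓ ⊗ •)
  cell_dot : ∀ A β,
    C.vcomp (C.braidMorR A (C.src₂ β))
      (C.hcomp (C.id₂ (C.braid A (C.src₁ (C.src₂ β)))) (C.tCO β A))
    = C.vcomp (C.hcomp (C.tOC A β) (C.id₂ (C.braid A (C.tgt₁ (C.src₂ β)))))
      (C.braidMorR A (C.tgt₂ β))
  -- (→→ ⊗ •)
  arrows_dot : ∀ f f' B, C.tgt₁ f = C.src₁ f' →
    C.vcomp (C.hcomp (C.id₂ (C.tMO f B)) (C.braidMorL f' B))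
      (C.hcomp (C.braidMorL f B) (C.id₂ (C.tOM B f')))
    = C.braidMorL (C.comp f f') B
  -- (• ⊗ →→)
  dot_arrows : ∀ A g g', C.tgt₁ g = C.src₁ g' →
    C.vcomp (C.hcomp (C.id₂ (C.tOM A g)) (C.braidMorR A g'))
      (C.hcomp (C.braidMorR A g) (C.id₂ (C.tMO g' A)))
    = C.braidMorR A (C.comp g g')
  -- (• ⊗ (• ⊗ →))
  dot_dot_arrow : ∀ A B f,
    C.vcomp (C.hcomp (C.id₂ (C.tOM (C.tOO A B) f)) (C.Rt1 A B (C.tgt₁ f)))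
      (C.braidMorR A (C.tOM B f))
    = C.vcomp (C.vcomp
      (C.hcomp (C.tensorator (C.braid A B) f) (C.id₂ (C.tOM B (C.braid A (C.tgt₁ f)))))
      (C.hcomp (C.id₂ (C.tMO (C.braid A B) (C.src₁ f))) (C.tOC B (C.braidMorR A f))))
      (C.hcomp (C.Rt1 A B (C.src₁ f)) (C.id₂ (C.tMO (C.tOM B f) A)))
  -- ((• ⊗ •) ⊗ →)
  dots_arrow : ∀ A B f,
    C.vcomp (C.hcomp (C.id₂ (C.tOM (C.tOO A B) f)) (C.Rt2 A B (C.tgt₁ f)))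
      (C.braidMorR (C.tOO A B) f)
    = C.vcomp (C.vcomp
      (C.hcomp (C.tOC A (C.braidMorR B f)) (C.id₂ (C.tMO (C.braid A (C.tgt₁ f)) B)))
      (C.hcomp (C.id₂ (C.tOM A (C.braid B (C.src₁ f)))) (C.tCO (C.braidMorR A f) B)))
      (C.Rt2 A B (C.src₁ f))
  -- (→ ⊗ (• ⊗ •))
  arrow_dots1 : ∀ f B D,
    C.vcomp (C.hcomp (C.id₂ (C.tMO f (C.tOO B D))) (C.Rt1 (C.tgt₁ f) B D))
      (C.braidMorL f (C.tOO B D))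
    = C.vcomp (C.vcomp
      (C.hcomp (C.tCO (C.braidMorL f B) D) (C.id₂ (C.tOM B (C.braid (C.tgt₁ f) D))))
      (C.hcomp (C.id₂ (C.tMO (C.braid (C.src₁ f) B) D)) (C.tOC B (C.braidMorL f D))))
      (C.hcomp (C.Rt1 (C.src₁ f) B D) (C.id₂ (C.tOM (C.tOO B D) f)))
  -- ((→ ⊗ •) ⊗ •)
  arrow_dots2 : ∀ f B D,
    C.vcomp (C.hcomp (C.id₂ (C.tMO f (C.tOO B D))) (C.Rt2 (C.tgt₁ f) B D))
      (C.braidMorL (C.tMO f B) D)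
    = C.vcomp (C.vcomp
      (C.hcomp (C.tensoratorInv f (C.braid B D)) (C.id₂ (C.tMO (C.braid (C.tgt₁ f) D) B)))
      (C.hcomp (C.id₂ (C.tOM (C.src₁ f) (C.braid B D))) (C.tCO (C.braidMorL f D) B)))
      (C.hcomp (C.Rt2 (C.src₁ f) B D) (C.id₂ (C.tMO (C.tOM D f) B)))
  -- ((• ⊗ →) ⊗ •)
  dot_arrow_dot2 : ∀ A f D,
    C.vcomp (C.hcomp (C.id₂ (C.tOM A (C.tMO f D))) (C.Rt2 A (C.tgt₁ f) D))
      (C.braidMorL (C.tOM A f) D)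
    = C.vcomp (C.vcomp
      (C.hcomp (C.tOC A (C.braidMorL f D)) (C.id₂ (C.tMO (C.braid A D) (C.tgt₁ f))))
      (C.hcomp (C.id₂ (C.tOM A (C.braid (C.src₁ f) D))) (C.tensorator (C.braid A D) f)))
      (C.hcomp (C.Rt2 A (C.src₁ f) D) (C.id₂ (C.tOM (C.tOO D A) f)))
  -- (• ⊗ (→ ⊗ •))
  dot_arrow_dot1 : ∀ A f D,
    C.vcomp (C.hcomp (C.id₂ (C.tOM A (C.tMO f D))) (C.Rt1 A (C.tgt₁ f) D))
      (C.braidMorR A (C.tMO f D))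
    = C.vcomp (C.vcomp
      (C.hcomp (C.tCO (C.braidMorR A f) D) (C.id₂ (C.tOM (C.tgt₁ f) (C.braid A D))))
      (C.hcomp (C.id₂ (C.tMO (C.braid A (C.src₁ f)) D)) (C.tensoratorInv f (C.braid A D))))
      (C.hcomp (C.Rt1 A (C.src₁ f) D) (C.id₂ (C.tMO (C.tMO f D) A)))
  -- (• ⊗ (• ⊗ • ⊗ •))
  dot_three : ∀ A B D E,
    C.vcomp (C.hcomp (C.id₂ (C.tMO (C.braid A B) (C.tOO D E))) (C.tOC B (C.Rt1 A D E)))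
      (C.Rt1 A B (C.tOO D E))
    = C.vcomp (C.hcomp (C.tCO (C.Rt1 A B D) E) (C.id₂ (C.tOM (C.tOO B D) (C.braid A E))))
      (C.Rt1 A (C.tOO B D) E)
  -- ((• ⊗ • ⊗ •) ⊗ •)
  three_dot : ∀ A B D E,
    C.vcomp (C.hcomp (C.tOC A (C.Rt2 B D E)) (C.id₂ (C.tMO (C.braid A E) (C.tOO B D))))
      (C.Rt2 A (C.tOO B D) E)
    = C.vcomp (C.hcomp (C.id₂ (C.tOM (C.tOO A B) (C.braid D E))) (C.tCO (C.Rt2 A B E) D))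
      (C.Rt2 (C.tOO A B) D E)
  -- ((• ⊗ •) ⊗ (• ⊗ •))
  dots_dots : ∀ A B D E,
    C.vcomp (C.vcomp
      (C.hcomp (C.id₂ (C.tOM A (C.tMO (C.braid B D) E)))
        (C.hcomp (C.tensorator (C.braid A D) (C.braid B E))
          (C.id₂ (C.tOM D (C.tMO (C.braid A E) B)))))
      (C.hcomp (C.tCO (C.Rt2 A B D) E) (C.tOC D (C.Rt2 A B E))))
      (C.Rt1 (C.tOO A B) D E)
    = C.vcomp (C.hcomp (C.tOC A (C.Rt1 B D E)) (C.tCO (C.Rt1 A D E) B))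
      (C.Rt2 A B (C.tOO D E))
  -- S⁺_{A,B,C} = S⁻_{A,B,C}
  s_plus_minus : ∀ A B D,
    C.vcomp (C.vcomp
      (C.hcomp (C.Rt1Inv A B D) (C.id₂ (C.tMO (C.braid B D) A)))
      (C.braidMorRInv A (C.braid B D)))
      (C.hcomp (C.id₂ (C.tOM A (C.braid B D))) (C.Rt1 A B D))
    = C.vcomp (C.vcomp
      (C.hcomp (C.id₂ (C.tMO (C.braid A B) D)) (C.Rt2 A B D))
      (C.braidMorL (C.braid A B) D))
      (C.hcomp (C.Rt2Inv A B D) (C.id₂ (C.tOM D (C.braid A B))))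
  -- Crans's unit conditions
  braid_unit_left : ∀ A, C.braid C.unit A = C.id₁ A
  braid_unit_right : ∀ A, C.braid A C.unit = C.id₁ A
  braidMorL_unit : ∀ f, C.braidMorL f C.unit = C.id₂ (C.src₂ (C.braidMorL f C.unit))
  braidMorR_unit : ∀ g, C.braidMorR C.unit g = C.id₂ (C.src₂ (C.braidMorR C.unit g))
  Rt1_unit₁ : ∀ B D, C.Rt1 C.unit B D = C.id₂ (C.src₂ (C.Rt1 C.unit B D))
  Rt1_unit₂ : ∀ A D, C.Rt1 A C.unit D = C.id₂ (C.src₂ (C.Rt1 A C.unit D))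
  Rt1_unit₃ : ∀ A B, C.Rt1 A B C.unit = C.id₂ (C.src₂ (C.Rt1 A B C.unit))
  Rt2_unit₁ : ∀ B D, C.Rt2 C.unit B D = C.id₂ (C.src₂ (C.Rt2 C.unit B D))
  Rt2_unit₂ : ∀ A D, C.Rt2 A C.unit D = C.id₂ (C.src₂ (C.Rt2 A C.unit D))
  Rt2_unit₃ : ∀ A B, C.Rt2 A B C.unit = C.id₂ (C.src₂ (C.Rt2 A B C.unit))
  -- unitarity of the braiding (Definition 7 of HDA IV)
  iR_unitary : ∀ A B, DualsData.Unitary C.toDualsData (C.iCell (C.braid A B))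
  eR_unitary : ∀ A B, DualsData.Unitary C.toDualsData (C.eCell (C.braid A B))
  braidMorL_unitary : ∀ f B, DualsData.Unitary C.toDualsData (C.braidMorL f B)
  braidMorR_unitary : ∀ A g, DualsData.Unitary C.toDualsData (C.braidMorR A g)
  Rt1_unitary : ∀ A B D, DualsData.Unitary C.toDualsData (C.Rt1 A B D)
  Rt2_unitary : ∀ A B D, DualsData.Unitary C.toDualsData (C.Rt2 A B D)
namespace BMWDData

/-- The adjoint `α†` in a braided monoidal 2-category with duals. -/
def adjC (C : BMWDData) (α : C.Cell) : C.Cell := DualsData.adj C.toDualsData α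

/-- The 2-morphism
`H_{X,Y} : (i_X ⊗ Y)(X ⊗ R_{X*,Y}) ⇒ (Y ⊗ i_X)(R*_{X,Y} ⊗ X*)`
("a double point arc crossing a fold line"). -/
def Hcell (C : BMWDData) (X Y : C.Obj) : C.Cell :=
  C.vcomp (C.vcomp
    (C.hcomp (C.id₂ (C.tMO (C.iObj X) Y))
      (C.hcomp (C.id₂ (C.tOM X (C.braid (C.dObj X) Y)))
        (C.tCO (C.iCell (C.braid X Y)) (C.dObj X))))
    (C.hcomp (C.id₂ (C.tMO (C.iObj X) Y))
      (C.hcomp (C.Rt2 X (C.dObj X) Y)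
        (C.id₂ (C.tMO (C.dMor (C.braid X Y)) (C.dObj X))))))
    (C.hcomp (C.braidMorL (C.iObj X) Y)
      (C.id₂ (C.tMO (C.dMor (C.braid X Y)) (C.dObj X))))

/-- The 2-morphism
`H̄_{X,Y} : (i_X ⊗ Y)(X ⊗ R*_{Y,X*}) ⇒ (Y ⊗ i_X)(R_{Y,X} ⊗ X*)`. -/
def HbarCell (C : BMWDData) (X Y : C.Obj) : C.Cell :=
  C.vcomp (C.vcomp
    (C.hcomp (C.id₂ (C.tMO (C.iObj X) Y))
      (C.hcomp (C.id₂ (C.tOM X (C.dMor (C.braid Y (C.dObj X)))))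
        (C.tCO (C.iCell (C.dMor (C.braid Y X))) (C.dObj X))))
    (C.hcomp (C.id₂ (C.tMO (C.iObj X) Y))
      (C.hcomp (C.dCell (C.adjC (C.Rt1 Y X (C.dObj X))))
        (C.id₂ (C.tMO (C.braid Y X) (C.dObj X))))))
    (C.hcomp (C.adjC (C.braidMorR Y (C.dMor (C.iObj X))))
      (C.id₂ (C.tMO (C.braid Y X) (C.dObj X))))

/-- The coherence law satisfied by a writhing `W_A : i_A ⇒ i_A R_{A,A}` on a
self-dual object `A` ("a branch point passing through a cusp"). -/
def WritheEq (C : BMWDData) (A : C.Obj) (W : C.Cell) : Prop :=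
  C.vcomp (C.vcomp
    (C.adjC (C.tri A))
    (C.hcomp (C.tOC A W) (C.id₂ (C.tMO (C.eObj A) A))))
    (C.hcomp (C.id₂ (C.tOM A (C.iObj A))) (C.dCell (C.adjC (C.HbarCell A A))))
  = C.vcomp (C.vcomp (C.vcomp
    (C.dCell (C.tri A))
    (C.hcomp (C.id₂ (C.tMO (C.iObj A) A))
      (C.tOC A (C.hcomp (C.iCell (C.braid A A)) (C.id₂ (C.eObj A))))))
    (C.hcomp (C.id₂ (C.tMO (C.iObj A) A))
      (C.tOC A (C.hcomp (C.id₂ (C.braid A A)) (C.adjC W)))))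
    (C.hcomp (C.Hcell A A) (C.id₂ (C.tOM A (C.eObj A))))

/-- A writhing on a self-dual object: a unitary 2-morphism
`W_A : i_A ⇒ i_A R_{A,A}` satisfying the writhing coherence law.  A self-dual
object equipped with a writhing is an *unframed self-dual object*. -/
def IsWrithing (C : BMWDData) (A : C.Obj) (W : C.Cell) : Prop :=
  C.src₂ W = C.iObj A ∧ C.tgt₂ W = C.comp (C.iObj A) (C.braid A A) ∧
  DualsData.Unitary C.toDualsData W ∧ C.WritheEq A W

end BMWDData
namespace BMWDData

/-- The object-level transpose `α̂ = (Y*⊗i_X)(Y*⊗α⊗X*)(e_Y⊗X*)` of a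
2-morphism `α : f ⇒ g` between 1-morphisms `f, g : X → Y`. -/
def hatCell (C : BMWDData) (α : C.Cell) : C.Cell :=
  C.hcomp (C.id₂ (C.tOM (C.dObj (C.tgt₁ (C.src₂ α))) (C.iObj (C.src₁ (C.src₂ α)))))
    (C.hcomp (C.tOC (C.dObj (C.tgt₁ (C.src₂ α))) (C.tCO α (C.dObj (C.src₁ (C.src₂ α)))))
      (C.id₂ (C.tMO (C.eObj (C.tgt₁ (C.src₂ α))) (C.dObj (C.src₁ (C.src₂ α))))))

/-- The 2-morphism `W̄_A = γ ⋅ (Ŵ_A^{†*}) ⋅ δ : i_A ⇒ i_A R*_{A,A}`, formed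
from a 2-morphism `W_A : i_A ⇒ i_A R_{A,A}` on a self-dual object `A` using
all three levels of duality, with the padding
`γ = i_A (T_A† ⊗ A)` and
`δ = [i_A(H*_{A,A}⊗A)(e_A⊗A⊗A)] ⋅ [i_A(i_A⊗A⊗A)(H̄†*_{A,A}⊗A)] ⋅
     [⊗_{i_A R*_{A,A}, i_A}(A⊗e_A⊗A)] ⋅ [i_A R*_{A,A}(A⊗T_A†*)]`. -/
def Wbar (C : BMWDData) (A : C.Obj) (W : C.Cell) : C.Cell :=
  C.vcomp (C.vcomp
    -- γ = i_A (T_A† ⊗ A)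
    (C.hcomp (C.id₂ (C.iObj A)) (C.tCO (C.adjC (C.tri A)) A))
    -- the transpose of W reversed at all three levels
    (C.hatCell (C.dCell (C.adjC W))))
    -- δ
    (C.vcomp (C.vcomp (C.vcomp
      (C.hcomp (C.id₂ (C.iObj A))
        (C.hcomp (C.tCO (C.dCell (C.Hcell A A)) A)
          (C.id₂ (C.tMO (C.tMO (C.eObj A) A) A))))
      (C.hcomp (C.id₂ (C.iObj A))
        (C.hcomp (C.id₂ (C.tMO (C.tMO (C.iObj A) A) A))
          (C.tCO (C.dCell (C.adjC (C.HbarCell A A))) A))))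
      (C.hcomp (C.tensorator (C.comp (C.iObj A) (C.dMor (C.braid A A))) (C.iObj A))
        (C.id₂ (C.tMO (C.tOM A (C.eObj A)) A))))
      (C.hcomp (C.id₂ (C.comp (C.iObj A) (C.dMor (C.braid A A))))
        (C.tOC A (C.dCell (C.adjC (C.tri A))))))

end BMWDData

/-! ## Planar diagrams on powers of one object -/

namespace Diagram

/-- Generating 1-morphisms between powers of a self-dual object `A`: the unit, the counit, the
braiding `R_{A,A}` and its dual, `R_{A,AA}`, `R_{A,AAA}`, `R_{AA,A}` and `R_{AAA,A}`. -/
inductive Gen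
  | cup | cap | cross | uncross | over₂ | over₃ | under₂ | under₃
  deriving DecidableEq

/-- Number of input strands. -/
def Gen.din : Gen → ℕ
  | .cup => 0
  | .cap | .cross | .uncross => 2
  | .over₂ | .under₂ => 3
  | .over₃ | .under₃ => 4

/-- Number of output strands. -/
def Gen.dout : Gen → ℕ
  | .cap => 0
  | .cup | .cross | .uncross => 2
  | .over₂ | .under₂ => 3
  | .over₃ | .under₃ => 4

/-- A letter `(g, p)` is the generator `g` with `p` strands on its left. -/
abbrev Word := List (Gen × ℕ)

/-- The number of strands after a word that starts on `n` strands. -/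
def wd : ℕ → Word → ℕ
  | n, [] => n
  | n, l :: w => wd (n - l.1.din + l.1.dout) w

/-- Whether a word can start on `n` strands. -/
def okW : ℕ → Word → Bool
  | _, [] => true
  | n, l :: w => Nat.ble (l.2 + l.1.din) n && okW (n - l.1.din + l.1.dout) w

/-- Add `k` strands on the left. -/
def sh (k : ℕ) (w : Word) : Word := w.map fun l => (l.1, k + l.2)

theorem wd_append (n : ℕ) (u v : Word) : wd n (u ++ v) = wd (wd n u) v := by
  induction u generalizing n with
  | nil => rfl
  | cons l u ih => simp [wd, ih]

theorem okW_append (n : ℕ) (u v : Word) : okW n (u ++ v) = (okW n u && okW (wd n u) v) := by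
  induction u generalizing n with
  | nil => rfl
  | cons l u ih => simp [okW, wd, ih, Bool.and_assoc]

theorem sh_append (k : ℕ) (u v : Word) : sh k (u ++ v) = sh k u ++ sh k v := by simp [sh]

theorem sh_sh (k l : ℕ) (u : Word) : sh k (sh l u) = sh (k + l) u := by
  simp [sh, Function.comp_def, Nat.add_assoc]

theorem sh_length (k : ℕ) (u : Word) : (sh k u).length = u.length := by simp [sh]

theorem okW_sh {n : ℕ} {u : Word} (h : okW n u = true) (k q : ℕ) :
    okW (k + n + q) (sh k u) = true ∧ wd (k + n + q) (sh k u) = k + wd n u + q := by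
  induction u generalizing n with
  | nil => simp [okW, wd, sh]
  | cons l u ih =>
    simp only [okW, Bool.and_eq_true, Nat.ble_eq] at h
    have := ih h.2
    have e : k + n + q - l.1.din + l.1.dout = k + (n - l.1.din + l.1.dout) + q := by omega
    simp only [sh, List.map_cons, okW, wd, Bool.and_eq_true, Nat.ble_eq] at this ⊢
    rw [e]
    exact ⟨⟨by omega, this.1⟩, this.2⟩

section Sem

variable (M : MonTwoCat)

/-- Powers of an object. -/
def pw (A : M.Obj) : ℕ → M.Obj
  | 0 => M.unit
  | n + 1 => M.tOO A (pw A n)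

theorem pw_add (A : M.Obj) (m n : ℕ) : M.tOO (pw M A m) (pw M A n) = pw M A (m + n) := by
  induction m with
  | zero => simp [pw, M.tOO_unit_left]
  | succ m ih => rw [Nat.succ_add, pw, pw, ← M.tOO_assoc, ih]

/-- Whiskering a 2-morphism by 1-morphisms on both sides. -/
def wk (f : M.Mor) (α : M.Cell) (g : M.Mor) : M.Cell :=
  M.hcomp (M.id₂ f) (M.hcomp α (M.id₂ g))

/-- `α` can be whiskered by `f` and `g`. -/
def Fits (f : M.Mor) (α : M.Cell) (g : M.Mor) : Prop :=
  M.tgt₁ f = M.src₁ (M.src₂ α) ∧ M.tgt₁ (M.src₂ α) = M.src₁ g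

variable {M}

theorem wk_src {f : M.Mor} {α : M.Cell} {g : M.Mor} (h : Fits M f α g) :
    M.src₂ (wk M f α g) = M.comp f (M.comp (M.src₂ α) g) := by
  have h1 : M.src₂ (M.hcomp α (M.id₂ g)) = M.comp (M.src₂ α) g := by
    rw [M.hcomp_src] <;> simp [M.id₂_src, h.2]
  rw [wk, M.hcomp_src, h1, M.id₂_src]
  rw [h1, M.id₂_src, M.comp_src _ _ h.2, h.1]

theorem wk_tgt {f : M.Mor} {α : M.Cell} {g : M.Mor} (h : Fits M f α g) :
    M.tgt₂ (wk M f α g) = M.comp f (M.comp (M.tgt₂ α) g) := by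
  have h1 : M.src₂ (M.hcomp α (M.id₂ g)) = M.comp (M.src₂ α) g := by
    rw [M.hcomp_src] <;> simp [M.id₂_src, h.2]
  have h2 : M.tgt₂ (M.hcomp α (M.id₂ g)) = M.comp (M.tgt₂ α) g := by
    rw [M.hcomp_tgt] <;> simp [M.id₂_src, M.id₂_tgt, h.2]
  rw [wk, M.hcomp_tgt, h2, M.id₂_tgt]
  rw [h1, M.id₂_src, M.comp_src _ _ h.2, h.1]

theorem wk_id {f g h : M.Mor} (h1 : M.tgt₁ f = M.src₁ g) (h2 : M.tgt₁ g = M.src₁ h) :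
    wk M f (M.id₂ g) h = M.id₂ (M.comp f (M.comp g h)) := by
  rw [wk, M.hcomp_id₂ _ _ h2, M.hcomp_id₂]
  rw [M.comp_src _ _ h2, h1]

theorem wk_vcomp {f : M.Mor} {α β : M.Cell} {g : M.Mor} (h : Fits M f α g)
    (e : M.tgt₂ α = M.src₂ β) :
    wk M f (M.vcomp α β) g = M.vcomp (wk M f α g) (wk M f β g) := by
  have hβ : M.tgt₁ (M.src₂ β) = M.src₁ g := by rw [← e, ← M.cell_tgt_tgt, h.2]
  have v : ∀ k, M.vcomp (M.id₂ k) (M.id₂ k) = M.id₂ k := fun k => by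
    simpa [M.id₂_src] using M.vcomp_id_left (M.id₂ k)
  unfold wk
  rw [← M.exchange, v, ← M.exchange, v]
  · exact e
  · simp [M.id₂_src, M.id₂_tgt]
  · simp [M.id₂_src, h.2]
  · simp [M.id₂_src, M.id₂_tgt]
  · rw [M.hcomp_src, M.hcomp_tgt] <;> simp [M.id₂_src, M.id₂_tgt, h.2, hβ, e]
  · rw [M.hcomp_src] <;> simp [M.id₂_src, h.2]
    rw [M.comp_src _ _ h.2, h.1]

theorem wk_wk {f f' : M.Mor} {α : M.Cell} {g g' : M.Mor} (h : Fits M f' α g')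
    (hf : M.tgt₁ f = M.src₁ f') (hg : M.tgt₁ g' = M.src₁ g) :
    wk M f (wk M f' α g') g = wk M (M.comp f f') α (M.comp g' g) := by
  have h1 : M.src₂ (M.hcomp α (M.id₂ g')) = M.comp (M.src₂ α) g' := by
    rw [M.hcomp_src] <;> simp [M.id₂_src, h.2]
  have h3 : M.src₂ (M.hcomp α (M.id₂ (M.comp g' g))) = M.comp (M.src₂ α) (M.comp g' g) := by
    rw [M.hcomp_src] <;> simp [M.id₂_src, h.2, M.comp_src _ _ hg]
  unfold wk
  rw [← M.hcomp_id₂ _ _ hf, ← M.hcomp_id₂ _ _ hg, M.hcomp_assoc (M.id₂ f) (M.id₂ f'),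
    M.hcomp_assoc (M.id₂ f'), M.hcomp_assoc α]
  · simp [M.id₂_src, h.2]
  · simp [M.id₂_src, hg]
  · simp [M.id₂_src, h1, M.comp_src _ _ h.2, h.1]
  · simp [M.id₂_src, h1, M.comp_tgt _ _ h.2, hg]
  · simp [M.id₂_src, hf]
  · rw [M.hcomp_id₂ _ _ hg, h3, M.comp_src, M.id₂_src, h.1]
    rw [M.comp_src _ _ hg, h.2]

/-- Two disjoint 2-morphisms can be performed in either order. -/
theorem wk_interchange {f g h : M.Mor} {α β : M.Cell} (hα : Fits M f α g) (hβ : Fits M g β h) :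
    M.vcomp (wk M f α (M.comp g (M.comp (M.src₂ β) h)))
      (wk M (M.comp f (M.comp (M.tgt₂ α) g)) β h)
    = M.vcomp (wk M (M.comp f (M.comp (M.src₂ α) g)) β h)
      (wk M f α (M.comp g (M.comp (M.tgt₂ β) h))) := by
  have hα' : M.tgt₁ (M.tgt₂ α) = M.src₁ g := by rw [← M.cell_tgt_tgt, hα.2]
  have hα'' : M.tgt₁ f = M.src₁ (M.tgt₂ α) := by rw [← M.cell_src_src, hα.1]
  have hs : M.src₂ (M.hcomp β (M.id₂ h)) = M.comp (M.src₂ β) h := by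
    rw [M.hcomp_src] <;> simp [M.id₂_src, hβ.2]
  have s : M.src₂ (wk M g β h) = M.comp g (M.comp (M.src₂ β) h) := wk_src hβ
  have t : M.tgt₂ (wk M g β h) = M.comp g (M.comp (M.tgt₂ β) h) := wk_tgt hβ
  have s1 : M.src₁ (M.comp g (M.comp (M.src₂ β) h)) = M.src₁ g := by
    rw [M.comp_src]; rw [M.comp_src _ _ hβ.2, hβ.1]
  have t1 : M.src₁ (M.comp g (M.comp (M.tgt₂ β) h)) = M.src₁ g := by
    rw [← t, ← M.cell_src_src, s, s1]
  have key : ∀ k, M.tgt₁ k = M.src₁ g → M.tgt₁ f = M.src₁ k →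
      wk M (M.comp f (M.comp k g)) β h
        = M.hcomp (M.id₂ f) (M.hcomp (M.id₂ k) (wk M g β h)) := by
    intro k hk hfk
    rw [← M.hcomp_assoc, M.hcomp_id₂ _ _ hfk]
    · have := wk_wk (f := M.comp f k) (f' := g) (α := β) (g' := h) (g := M.id₁ (M.tgt₁ h)) hβ
        (by rw [M.comp_tgt _ _ hfk, hk]) (by simp [M.id₁_src])
      rw [M.comp_id_right, ← M.comp_assoc _ _ _ hfk hk] at *
      rw [← this, wk]
      congr 1
      have := M.hcomp_id_right (wk M g β h)
      rw [s, M.comp_tgt, M.comp_tgt _ _ hβ.2] at this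
      · exact this
      · rw [M.comp_src _ _ hβ.2, hβ.1]
    · simp [M.id₂_src, hfk]
    · rw [M.id₂_src, s, s1, hk]
  rw [key _ hα' hα'', key _ hα.2 hα.1]
  unfold wk at s t ⊢
  have v : ∀ k, M.vcomp (M.id₂ k) (M.id₂ k) = M.id₂ k := fun k => by
    simpa [M.id₂_src] using M.vcomp_id_left (M.id₂ k)
  have o1 : M.tgt₁ (M.src₂ α) = M.src₁ (M.comp g (M.comp (M.src₂ β) h)) := by rw [s1, hα.2]
  have o2 : M.tgt₁ (M.src₂ α) = M.src₁ (M.comp g (M.comp (M.tgt₂ β) h)) := by rw [t1, hα.2]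
  have o3 : M.tgt₁ (M.tgt₂ α) = M.src₁ (M.comp g (M.comp (M.src₂ β) h)) := by rw [s1, hα']
  rw [← M.exchange, ← M.exchange, v, ← M.exchange, ← M.exchange, v]
  · rw [M.vcomp_id_right]
    conv_lhs => rw [← s, M.vcomp_id_left]
    conv_rhs => rw [← t, M.vcomp_id_right, M.vcomp_id_left]
  · simp [M.id₂_tgt]
  · rw [t, M.id₂_src]
  · simp [M.id₂_src, s, hα.2, s1]
  · simp [M.id₂_src, M.id₂_tgt]
  · rw [M.hcomp_tgt, M.hcomp_src, t] <;> simp [M.id₂_src, M.id₂_tgt, s, s1, t1, hα.2]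
  · rw [M.hcomp_src _ _ (by simp [M.id₂_src, s, o1])]
    simp [M.id₂_src, s, M.comp_src _ _ o1, hα.1]
  · simp [M.id₂_src]
  · rw [M.id₂_tgt, s]
  · simp [M.id₂_src, o1]
  · simp [M.id₂_src, M.id₂_tgt]
  · rw [M.hcomp_tgt, M.hcomp_src, s] <;> simp [M.id₂_src, M.id₂_tgt, s, o1, o3]
  · rw [M.hcomp_src _ _ (by simp [M.id₂_src, o1])]
    simp [M.id₂_src, M.comp_src _ _ o1, hα.1]

/-! ### Tensoring with powers on both sides -/

variable (A : M.Obj)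

/-- `A^k ⊗ f ⊗ A^q`. -/
def tM (k q : ℕ) (f : M.Mor) : M.Mor := M.tOM (pw M A k) (M.tMO f (pw M A q))

/-- `A^k ⊗ α ⊗ A^q`. -/
def tC (k q : ℕ) (α : M.Cell) : M.Cell := M.tOC (pw M A k) (M.tCO α (pw M A q))

theorem tC_src (k q : ℕ) (α : M.Cell) : M.src₂ (tC A k q α) = tM A k q (M.src₂ α) := by
  rw [tC, M.tOC_src, M.tCO_src, tM]

theorem tC_tgt (k q : ℕ) (α : M.Cell) : M.tgt₂ (tC A k q α) = tM A k q (M.tgt₂ α) := by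
  rw [tC, M.tOC_tgt, M.tCO_tgt, tM]

theorem tM_src (k q : ℕ) (f : M.Mor) :
    M.src₁ (tM A k q f) = M.tOO (pw M A k) (M.tOO (M.src₁ f) (pw M A q)) := by
  rw [tM, M.tOM_src, M.tMO_src]

theorem tM_tgt (k q : ℕ) (f : M.Mor) :
    M.tgt₁ (tM A k q f) = M.tOO (pw M A k) (M.tOO (M.tgt₁ f) (pw M A q)) := by
  rw [tM, M.tOM_tgt, M.tMO_tgt]

theorem tM_comp (k q : ℕ) {f g : M.Mor} (h : M.tgt₁ f = M.src₁ g) :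
    tM A k q (M.comp f g) = M.comp (tM A k q f) (tM A k q g) := by
  rw [tM, M.tMO_comp _ _ _ h, M.tOM_comp, tM, tM]
  rw [M.tMO_src, M.tMO_tgt, h]

theorem tC_id (k q : ℕ) (f : M.Mor) : tC A k q (M.id₂ f) = M.id₂ (tM A k q f) := by
  rw [tC, M.tCO_id, M.tOC_id, tM]

theorem tC_vcomp (k q : ℕ) {α β : M.Cell} (h : M.tgt₂ α = M.src₂ β) :
    tC A k q (M.vcomp α β) = M.vcomp (tC A k q α) (tC A k q β) := by
  rw [tC, M.tCO_vcomp _ _ _ h, M.tOC_vcomp, tC, tC]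
  rw [M.tCO_src, M.tCO_tgt, h]

theorem tC_hcomp (k q : ℕ) {α β : M.Cell} (h : M.tgt₁ (M.src₂ α) = M.src₁ (M.src₂ β)) :
    tC A k q (M.hcomp α β) = M.hcomp (tC A k q α) (tC A k q β) := by
  rw [tC, M.tCO_hcomp _ _ _ h, M.tOC_hcomp, tC, tC]
  rw [M.tCO_src, M.tCO_src, M.tMO_src, M.tMO_tgt, h]

theorem tM_id (k n q : ℕ) :
    tM A k q (M.id₁ (pw M A n)) = M.id₁ (pw M A (k + n + q)) := by
  rw [tM, M.tMO_id, M.tOM_id, pw_add, pw_add, Nat.add_assoc]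

theorem tM_tM (k q k' q' : ℕ) (f : M.Mor) :
    tM A k q (tM A k' q' f) = tM A (k + k') (q' + q) f := by
  simp only [tM]
  rw [← M.tOMO_assoc, M.tOM_assoc, ← M.tMO_assoc, pw_add, pw_add]

theorem tC_tC (k q k' q' : ℕ) (α : M.Cell) :
    tC A k q (tC A k' q' α) = tC A (k + k') (q' + q) α := by
  simp only [tC]
  rw [← M.tOCO_assoc, M.tOC_assoc, ← M.tCO_assoc, pw_add, pw_add]

theorem tM_zero (f : M.Mor) : tM A 0 0 f = f := by
  rw [tM, pw, M.tMO_unit, M.tOM_unit]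

theorem tC_zero (α : M.Cell) : tC A 0 0 α = α := by
  rw [tC, pw, M.tCO_unit, M.tOC_unit]

theorem tC_wk (k q : ℕ) {f : M.Mor} {α : M.Cell} {g : M.Mor} (h : Fits M f α g) :
    tC A k q (wk M f α g) = wk M (tM A k q f) (tC A k q α) (tM A k q g) := by
  have h1 : M.tgt₁ (M.src₂ α) = M.src₁ (M.src₂ (M.id₂ g)) := by rw [M.id₂_src, h.2]
  rw [wk, tC_hcomp, tC_hcomp _ _ _ h1, tC_id, tC_id, wk]
  rw [M.hcomp_src _ _ h1, M.id₂_src, M.id₂_src, M.comp_src _ _ h.2, h.1]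

/-! ### Words as 1-morphisms -/

variable (gm : Gen → M.Mor)

/-- The 1-morphism denoted by a word. -/
def wmor : ℕ → Word → M.Mor
  | n, [] => M.id₁ (pw M A n)
  | n, l :: w => M.comp (tM A l.2 (n - (l.2 + l.1.din)) (gm l.1)) (wmor (n - l.1.din + l.1.dout) w)

/-- The generators have the right sources and targets. -/
def GoodGen : Prop :=
  ∀ g, M.src₁ (gm g) = pw M A g.din ∧ M.tgt₁ (gm g) = pw M A g.dout

variable {A gm}

theorem lmor_src (hg : GoodGen A gm) {n : ℕ} {l : Gen × ℕ} (h : l.2 + l.1.din ≤ n) :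
    M.src₁ (tM A l.2 (n - (l.2 + l.1.din)) (gm l.1)) = pw M A n := by
  rw [tM_src, (hg _).1, pw_add, pw_add]
  congr 1
  omega

theorem lmor_tgt (hg : GoodGen A gm) {n : ℕ} {l : Gen × ℕ} (h : l.2 + l.1.din ≤ n) :
    M.tgt₁ (tM A l.2 (n - (l.2 + l.1.din)) (gm l.1)) = pw M A (n - l.1.din + l.1.dout) := by
  rw [tM_tgt, (hg _).2, pw_add, pw_add]
  congr 1
  omega

theorem wmor_src_tgt (hg : GoodGen A gm) {n : ℕ} {w : Word} (h : okW n w = true) :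
    M.src₁ (wmor A gm n w) = pw M A n ∧ M.tgt₁ (wmor A gm n w) = pw M A (wd n w) := by
  induction w generalizing n with
  | nil => simp [wmor, wd, M.id₁_src, M.id₁_tgt]
  | cons l w ih =>
    simp only [okW, Bool.and_eq_true, Nat.ble_eq] at h
    have e := ih h.2
    have c := lmor_tgt hg h.1
    rw [← e.1] at c
    rw [wmor, M.comp_src _ _ c, M.comp_tgt _ _ c, lmor_src hg h.1, e.2, wd]
    exact ⟨rfl, rfl⟩

theorem wmor_append (hg : GoodGen A gm) {n : ℕ} {u v : Word} (h : okW n (u ++ v) = true) :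
    wmor A gm n (u ++ v) = M.comp (wmor A gm n u) (wmor A gm (wd n u) v) := by
  rw [okW_append, Bool.and_eq_true] at h
  induction u generalizing n with
  | nil =>
    have := M.comp_id_left (wmor A gm n v)
    rw [(wmor_src_tgt hg (n := n) h.2).1] at this
    exact this.symm
  | cons l u ih =>
    have h1 := h.1
    simp only [okW, Bool.and_eq_true, Nat.ble_eq] at h1
    rw [List.cons_append, wmor, ih ⟨h1.2, h.2⟩, wmor, M.comp_assoc, wd]
    · rw [lmor_tgt hg h1.1, (wmor_src_tgt hg h1.2).1]
    · rw [(wmor_src_tgt hg h1.2).2, (wmor_src_tgt hg h.2).1, wd]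

theorem wmor_sh (hg : GoodGen A gm) {n : ℕ} {u : Word} (h : okW n u = true) (k q : ℕ) :
    wmor A gm (k + n + q) (sh k u) = tM A k q (wmor A gm n u) := by
  induction u generalizing n with
  | nil => exact (tM_id A k n q).symm
  | cons l u ih =>
    simp only [okW, Bool.and_eq_true, Nat.ble_eq] at h
    have e : k + n + q - l.1.din + l.1.dout = k + (n - l.1.din + l.1.dout) + q := by omega
    have e' : k + n + q - (k + l.2 + l.1.din) = n - (l.2 + l.1.din) + q := by omega
    rw [wmor, tM_comp, tM_tM, ← ih h.2]
    · simp only [sh, List.map_cons, wmor]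
      rw [e, e']
    · rw [lmor_tgt hg h.1, (wmor_src_tgt hg h.2).1]

end Sem

end Diagram

namespace Diagram

/-- Names of the 2-morphisms from which diagrams are built. -/
inductive Name
  -- structural 2-morphisms
  | tri | triAdj | unitCup | counitCup | unitCross | counitCross | writhe
  | tens (x y : Gen) (gap : ℕ)
  -- braiding 2-morphisms
  | hex₁ | hex₂ | natCap | natCup
  | hex₁l | hex₁r | hex₂l | hex₂r | natCapL | natCapR | natCupL | natCupR
  -- derived 2-morphisms
  | saddleCap | saddleCup | nu | foldUp | foldUpAdj | foldDown | foldDownAdj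
  | corner₁ | corner₂ | corner₃ | corner₄ | bendA | bendB
  deriving DecidableEq

open Gen Name in
/-- Width of the source of a named 2-morphism. -/
def Name.bw : Name → ℕ
  | unitCup => 0
  | tri | triAdj | natCup | saddleCup | foldUp | foldUpAdj | corner₁ | corner₄ => 1
  | counitCup | unitCross | counitCross | natCupL | natCupR | nu | bendA | bendB => 2
  | writhe => 0
  | hex₁ | hex₂ | natCap | saddleCap | foldDown | foldDownAdj | corner₂ | corner₃ => 3
  | hex₁l | hex₁r | hex₂l | hex₂r | natCapL | natCapR => 4
  | tens x y gap => x.din + gap + y.din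

open Gen Name in
/-- Source of a named 2-morphism. -/
def Name.dom : Name → Word
  | tri => [(cup, 0), (cap, 1)]
  | triAdj => []
  | unitCup => []
  | counitCup => [(cap, 0), (cup, 0)]
  | unitCross => []
  | counitCross => [(uncross, 0), (cross, 0)]
  | writhe => [(cup, 0)]
  | tens x y gap => [(y, x.din + gap), (x, 0)]
  | hex₁ => [(cross, 0), (cross, 1)]
  | hex₂ => [(cross, 1), (cross, 0)]
  | natCap => [(cap, 1)]
  | natCup => [(cup, 0), (under₂, 0)]
  | hex₁l => [(cross, 0), (over₂, 1)]
  | hex₁r => [(over₂, 0), (cross, 2)]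
  | hex₂l => [(under₂, 1), (cross, 0)]
  | hex₂r => [(cross, 2), (under₂, 0)]
  | natCapL => [(cap, 1), (cross, 0)]
  | natCapR => [(cap, 2), (cross, 0)]
  | natCupL => [(cup, 0), (under₃, 0)]
  | natCupR => [(cup, 1), (under₃, 0)]
  | saddleCap => [(cap, 1)]
  | saddleCup => [(cup, 1)]
  | nu => [(cap, 0), (cup, 0)]
  | foldDown => [(cross, 1), (cap, 0)]
  | foldDownAdj => [(uncross, 1), (cap, 0)]
  | foldUp => [(cup, 0), (cross, 1)]
  | foldUpAdj => [(cup, 0), (uncross, 1)]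
  | corner₁ => [(cup, 1)]
  | corner₂ => [(cap, 0)]
  | corner₃ => [(cap, 1)]
  | corner₄ => [(cup, 0)]
  | bendA | bendB => []

open Gen Name in
/-- Target of a named 2-morphism. -/
def Name.cod : Name → Word
  | tri => []
  | triAdj => [(cup, 1), (cap, 0)]
  | unitCup => [(cup, 0), (cap, 0)]
  | counitCup => []
  | unitCross => [(cross, 0), (uncross, 0)]
  | counitCross => []
  | writhe => [(cup, 0), (cross, 0)]
  | tens x y gap => [(x, 0), (y, x.dout + gap)]
  | hex₁ => [(over₂, 0)]
  | hex₂ => [(under₂, 0)]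
  | natCap => [(over₂, 0), (cap, 0)]
  | natCup => [(cup, 1)]
  | hex₁l | hex₁r => [(over₃, 0)]
  | hex₂l | hex₂r => [(under₃, 0)]
  | natCapL => [(over₃, 0), (cap, 0)]
  | natCapR => [(over₃, 0), (cap, 1)]
  | natCupL => [(cross, 0), (cup, 1)]
  | natCupR => [(cross, 0), (cup, 2)]
  | saddleCap => [(cap, 0)]
  | saddleCup => [(cup, 0)]
  | nu => [(uncross, 0)]
  | foldDown => [(uncross, 0), (cap, 1)]
  | foldDownAdj => [(cross, 0), (cap, 1)]
  | foldUp => [(cup, 1), (uncross, 0)]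
  | foldUpAdj => [(cup, 1), (cross, 0)]
  | corner₁ => [(cup, 1), (cross, 0)]
  | corner₂ => [(cross, 1), (cap, 0)]
  | corner₃ => [(cross, 0), (cap, 1)]
  | corner₄ => [(cup, 0), (cross, 1)]
  | bendA | bendB => [(cross, 0)]

theorem Name.ok (x : Name) :
    okW x.bw x.dom = true ∧ okW x.bw x.cod = true ∧ wd x.bw x.dom = wd x.bw x.cod := by
  cases x <;> try decide
  case tens x y gap =>
    simp only [Name.bw, Name.dom, Name.cod, okW, wd, Bool.and_eq_true, Nat.ble_eq, and_true]
    omega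

/-- A step applies a named 2-morphism (or, if `star`, its dual) at letter index `j`
with `k` strands on its left. -/
structure Step where
  x : Name
  star : Bool
  j : ℕ
  k : ℕ
  deriving DecidableEq

namespace Step

def dom (s : Step) : Word := if s.star then s.x.cod else s.x.dom
def cod (s : Step) : Word := if s.star then s.x.dom else s.x.cod

theorem ok (s : Step) : okW s.x.bw s.dom = true ∧ okW s.x.bw s.cod = true ∧
    wd s.x.bw s.dom = wd s.x.bw s.cod := by
  have := s.x.ok
  unfold dom cod
  split <;> simp [this]

/-- The word after a step. -/
def app (w : Word) (s : Step) : Word :=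
  w.take s.j ++ (sh s.k s.cod ++ w.drop (s.j + s.dom.length))

/-- Whether a step can be performed on a word. -/
def fits (n : ℕ) (w : Word) (s : Step) : Bool :=
  decide (w = w.take s.j ++ (sh s.k s.dom ++ w.drop (s.j + s.dom.length))) &&
    (Nat.ble s.j w.length && Nat.ble (s.k + s.x.bw) (wd n (w.take s.j)))

end Step

abbrev Path := List Step

/-- The final word of a path. -/
def run : Word → Path → Word
  | w, [] => w
  | w, s :: P => run (s.app w) P

/-- Whether a path can be performed on a word. -/
def okP (n : ℕ) : Word → Path → Bool
  | _, [] => true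
  | w, s :: P => s.fits n w && okP n (s.app w) P

theorem run_append (w : Word) (P Q : Path) : run w (P ++ Q) = run (run w P) Q := by
  induction P generalizing w with
  | nil => rfl
  | cons s P ih => simp [run, ih]

theorem okP_append (n : ℕ) (w : Word) (P Q : Path) :
    okP n w (P ++ Q) = (okP n w P && okP n (run w P) Q) := by
  induction P generalizing w with
  | nil => rfl
  | cons s P ih => simp [run, okP, ih, Bool.and_assoc]

/-- Decomposition of a word on which a step can be performed. -/
theorem Step.fits_iff {n : ℕ} {w : Word} {s : Step} (h : s.fits n w = true)
    (hw : okW n w = true) :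
    ∃ p r q, w = p ++ (sh s.k s.dom ++ r) ∧ s.app w = p ++ (sh s.k s.cod ++ r) ∧ p.length = s.j ∧
      wd n p = s.k + s.x.bw + q ∧ okW n p = true ∧
      okW (s.k + wd s.x.bw s.dom + q) r = true := by
  simp only [fits, Bool.and_eq_true, decide_eq_true_eq, Nat.ble_eq] at h
  obtain ⟨h1, h2, h3⟩ := h
  obtain ⟨q, hq⟩ := Nat.exists_eq_add_of_le h3
  refine ⟨w.take s.j, w.drop (s.j + s.dom.length), q, h1, rfl, by simp [h2], hq, ?_⟩
  rw [h1, okW_append, okW_append, Bool.and_eq_true, Bool.and_eq_true, hq,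
    (okW_sh s.ok.1 s.k q).2] at hw
  exact ⟨hw.1, hw.2.2⟩

theorem Step.fits_mk (s : Step) {n q : ℕ} {p r : Word} (hp : p.length = s.j)
    (hq : wd n p = s.k + s.x.bw + q) :
    s.fits n (p ++ (sh s.k s.dom ++ r)) = true ∧
      s.app (p ++ (sh s.k s.dom ++ r)) = p ++ (sh s.k s.cod ++ r) := by
  have e : (p ++ (sh s.k s.dom ++ r)).drop (s.j + s.dom.length) = r := by
    rw [← hp, ← List.drop_drop, List.drop_left, ← sh_length s.k s.dom, List.drop_left]
  have e' : (p ++ (sh s.k s.dom ++ r)).take s.j = p := by rw [← hp, List.take_left]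
  constructor
  · simp only [fits, e, e', Bool.and_eq_true, decide_eq_true_eq, Nat.ble_eq, true_and]
    refine ⟨?_, by omega⟩
    rw [List.length_append]
    omega
  · rw [app, e, e']

theorem Step.okW_app {n : ℕ} {w : Word} {s : Step} (h : s.fits n w = true)
    (hw : okW n w = true) : okW n (s.app w) = true ∧ wd n (s.app w) = wd n w := by
  obtain ⟨p, r, q, h1, h2, -, hq, hp, hr⟩ := s.fits_iff h hw
  have a := okW_sh s.ok.1 s.k q
  have b := okW_sh s.ok.2.1 s.k q
  rw [h2, congrArg (wd n) h1, okW_append, okW_append, wd_append, wd_append, wd_append, wd_append,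
    hq, a.2, b.2, hp, b.1, ← s.ok.2.2, hr]
  simp

theorem okW_run {n : ℕ} {w : Word} {P : Path} (h : okP n w P = true) (hw : okW n w = true) :
    okW n (run w P) = true ∧ wd n (run w P) = wd n w := by
  induction P generalizing w with
  | nil => exact ⟨hw, rfl⟩
  | cons s P ih =>
    simp only [okP, Bool.and_eq_true] at h
    have a := s.okW_app h.1 hw
    have b := ih h.2 a.1
    exact ⟨b.1, b.2.trans a.2⟩

section Sem

variable {C : DualsData} {A : C.Obj} {gm : Gen → C.Mor} (cm : Name → C.Cell)

/-- The 2-morphism applied by a step. -/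
def Step.cell (s : Step) : C.Cell := if s.star then C.dCell (cm s.x) else cm s.x

variable (A gm) in
/-- The 2-morphism denoted by a step on a word. -/
def Step.ev (n : ℕ) (w : Word) (s : Step) : C.Cell :=
  wk C.toMonTwoCat (wmor A gm n (w.take s.j))
    (tC A s.k (wd n (w.take s.j) - (s.k + s.x.bw)) (s.cell cm))
    (wmor A gm (wd n (w.take s.j) - s.x.bw + wd s.x.bw s.dom) (w.drop (s.j + s.dom.length)))

variable (A gm) in
/-- The 2-morphism denoted by a path. -/
def eval (n : ℕ) : Word → Path → C.Cell
  | w, [] => C.id₂ (wmor A gm n w)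
  | w, s :: P => C.vcomp (s.ev A gm cm n w) (eval n (s.app w) P)

variable (A gm) in
/-- The named 2-morphism has the right source and target. -/
def GoodAt (x : Name) : Prop :=
  C.src₂ (cm x) = wmor A gm x.bw x.dom ∧ C.tgt₂ (cm x) = wmor A gm x.bw x.cod

variable {cm}

theorem Step.cell_src_tgt {s : Step} (h : GoodAt A gm cm s.x) :
    C.src₂ (s.cell cm) = wmor A gm s.x.bw s.dom ∧
      C.tgt₂ (s.cell cm) = wmor A gm s.x.bw s.cod := by
  unfold Step.cell Step.dom Step.cod
  split
  · rw [C.dCell_src, C.dCell_tgt]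
    exact h.symm
  · exact h

variable (cm) in
theorem Step.ev_mk (s : Step) {n q : ℕ} {p r : Word} (hp : p.length = s.j)
    (hq : wd n p = s.k + s.x.bw + q) :
    s.ev A gm cm n (p ++ (sh s.k s.dom ++ r)) = wk C.toMonTwoCat (wmor A gm n p)
      (tC A s.k q (s.cell cm)) (wmor A gm (s.k + wd s.x.bw s.dom + q) r) := by
  have e : (p ++ (sh s.k s.dom ++ r)).drop (s.j + s.dom.length) = r := by
    rw [← hp, ← List.drop_drop, List.drop_left, ← sh_length s.k s.dom, List.drop_left]
  have e' : (p ++ (sh s.k s.dom ++ r)).take s.j = p := by rw [← hp, List.take_left]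
  have e2 : wd n p - (s.k + s.x.bw) = q := by omega
  have e3 : wd n p - s.x.bw + wd s.x.bw s.dom = s.k + wd s.x.bw s.dom + q := by omega
  rw [Step.ev, e, e', e2, e3]

section

variable (hg : GoodGen (M := C.toMonTwoCat) A gm)
include hg

/-- A cell between words fits between words. -/
theorem fits_words {n k b q : ℕ} {p u r : Word} {α : C.Cell}
    (hα : C.src₂ α = wmor A gm b u) (hu : okW b u = true)
    (hp : okW n p = true) (hq : wd n p = k + b + q) (hr : okW (k + wd b u + q) r = true) :
    Fits C.toMonTwoCat (wmor A gm n p) (tC A k q α) (wmor A gm (k + wd b u + q) r) := by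
  have a := okW_sh hu k q
  have e := wmor_src_tgt hg a.1
  rw [Fits, tC_src, hα, ← wmor_sh hg hu, e.1, e.2, (wmor_src_tgt hg hp).2,
    (wmor_src_tgt hg hr).1, hq, a.2]
  exact ⟨rfl, rfl⟩

theorem wmor_three {n k b q : ℕ} {p u r : Word} (hu : okW b u = true)
    (hp : okW n p = true) (hq : wd n p = k + b + q) (hr : okW (k + wd b u + q) r = true) :
    C.comp (wmor A gm n p) (C.comp (tM A k q (wmor A gm b u)) (wmor A gm (k + wd b u + q) r))
      = wmor A gm n (p ++ (sh k u ++ r)) := by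
  have a := okW_sh hu k q
  rw [wmor_append hg, wmor_append hg, hq, a.2, wmor_sh hg hu]
  · rw [hq, okW_append, a.1, a.2, hr]; rfl
  · rw [okW_append, hp, hq, okW_append, a.1, a.2, hr]; rfl

theorem Step.ev_src_tgt {n : ℕ} {w : Word} {s : Step} (h : s.fits n w = true)
    (hw : okW n w = true) (hs : GoodAt A gm cm s.x) :
    C.src₂ (s.ev A gm cm n w) = wmor A gm n w ∧
      C.tgt₂ (s.ev A gm cm n w) = wmor A gm n (s.app w) := by
  obtain ⟨p, r, q, h1, h2, hj, hq, hp, hr⟩ := s.fits_iff h hw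
  have c := s.cell_src_tgt hs
  rw [h2, h1, s.ev_mk cm hj hq]
  have f := fits_words hg c.1 s.ok.1 hp hq hr
  rw [wk_src f, wk_tgt f, tC_src, tC_tgt, c.1, c.2, wmor_three hg s.ok.1 hp hq hr]
  refine ⟨rfl, ?_⟩
  rw [s.ok.2.2] at hr ⊢
  exact wmor_three hg s.ok.2.1 hp hq hr

theorem eval_src_tgt {n : ℕ} {w : Word} {P : Path} (h : okP n w P = true)
    (hw : okW n w = true) (hP : ∀ s ∈ P, GoodAt A gm cm s.x) :
    C.src₂ (eval A gm cm n w P) = wmor A gm n w ∧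
      C.tgt₂ (eval A gm cm n w P) = wmor A gm n (run w P) := by
  induction P generalizing w with
  | nil => exact ⟨C.id₂_src _, C.id₂_tgt _⟩
  | cons s P ih =>
    simp only [okP, Bool.and_eq_true] at h
    have a := s.ev_src_tgt hg h.1 hw (hP s (by simp))
    have b := ih h.2 (s.okW_app h.1 hw).1 (fun t ht => hP t (by simp [ht]))
    have c := a.2.trans b.1.symm
    rw [eval, C.vcomp_src _ _ c, C.vcomp_tgt _ _ c]
    exact ⟨a.1, b.2⟩

theorem eval_append {n : ℕ} {w : Word} {P Q : Path} (h : okP n w (P ++ Q) = true)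
    (hw : okW n w = true) (hP : ∀ s ∈ P ++ Q, GoodAt A gm cm s.x) :
    eval A gm cm n w (P ++ Q)
      = C.vcomp (eval A gm cm n w P) (eval A gm cm n (run w P) Q) := by
  induction P generalizing w with
  | nil =>
    have := C.vcomp_id_left (eval A gm cm n w Q)
    rw [(eval_src_tgt hg (P := Q) h hw hP).1] at this
    exact this.symm
  | cons s P ih =>
    rw [List.cons_append, okP, Bool.and_eq_true] at h
    have a := s.ev_src_tgt hg h.1 hw (hP s (by simp))
    have w' := (s.okW_app h.1 hw).1
    have h2 := h.2
    rw [okP_append, Bool.and_eq_true] at h2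
    have b := eval_src_tgt hg h2.1 w' (fun t ht => hP t (by simp [ht]))
    have c := eval_src_tgt hg h2.2 (okW_run h2.1 w').1 (fun t ht => hP t (by simp [ht]))
    rw [List.cons_append, eval, ih h.2 w' (fun t ht => hP t (by simp_all)), eval, run,
      C.vcomp_assoc]
    · rw [a.2, b.1]
    · rw [b.2, c.1]

end

end Sem

end Diagram

namespace Diagram

/-- Shift a path by `j` letters and `k` strands. -/
def shP (j k : ℕ) (P : Path) : Path := P.map fun s => ⟨s.x, s.star, j + s.j, k + s.k⟩

/-- An interpretation of all generators and named 2-morphisms with the right boundaries. -/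
structure Model (C : DualsData) where
  A : C.Obj
  gm : Gen → C.Mor
  cm : Name → C.Cell
  hg : GoodGen (M := C.toMonTwoCat) A gm
  hcm : ∀ x, GoodAt A gm cm x

namespace Model

variable {C : DualsData} (m : Model C)

/-- The 1-morphism of a word. -/
abbrev mor (n : ℕ) (w : Word) : C.Mor := wmor (M := C.toMonTwoCat) m.A m.gm n w

/-- The 2-morphism of a path. -/
abbrev ev (n : ℕ) (w : Word) (P : Path) : C.Cell := eval m.A m.gm m.cm n w P

theorem ev_src_tgt {n : ℕ} {w : Word} {P : Path} (h : okP n w P = true)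
    (hw : okW n w = true) :
    C.src₂ (m.ev n w P) = m.mor n w ∧ C.tgt₂ (m.ev n w P) = m.mor n (run w P) :=
  eval_src_tgt m.hg h hw fun _ _ => m.hcm _

theorem ev_append {n : ℕ} {w : Word} {P Q : Path} (h : okP n w (P ++ Q) = true)
    (hw : okW n w = true) :
    m.ev n w (P ++ Q) = C.vcomp (m.ev n w P) (m.ev n (run w P) Q) :=
  eval_append m.hg h hw fun _ _ => m.hcm _

/-- Paths can be performed inside a larger diagram. -/
theorem ev_lift {n b k q : ℕ} {p u r : Word} {X : Path} (hu : okW b u = true)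
    (hX : okP b u X = true) (hp : okW n p = true) (hq : wd n p = k + b + q)
    (hr : okW (k + wd b u + q) r = true) :
    okP n (p ++ (sh k u ++ r)) (shP p.length k X) = true ∧
    run (p ++ (sh k u ++ r)) (shP p.length k X) = p ++ (sh k (run u X) ++ r) ∧
    m.ev n (p ++ (sh k u ++ r)) (shP p.length k X)
      = wk C.toMonTwoCat (m.mor n p) (tC m.A k q (m.ev b u X))
          (m.mor (k + wd b u + q) r) := by
  induction X generalizing u with
  | nil =>
    refine ⟨rfl, rfl, ?_⟩
    have f := fits_words m.hg (k := k) (q := q) (α := C.id₂ (m.mor b u)) (C.id₂_src _)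
      hu hp hq hr
    rw [Fits, tC_src, C.id₂_src] at f
    simp only [ev, eval, shP, List.map_nil]
    rw [tC_id, wk_id f.1 f.2, wmor_three m.hg hu hp hq hr]
  | cons s X ih =>
    simp only [okP, Bool.and_eq_true] at hX
    obtain ⟨p', r', q', h1, h2, hj, hq', hp', hr'⟩ := s.fits_iff hX.1 hu
    have hu' := s.okW_app hX.1 hu
    rw [← hu'.2] at hr
    obtain ⟨i1, i2, i3⟩ := ih hu'.1 hX.2 hr
    have w' := okW_sh hp' k q
    let s' : Step := ⟨s.x, s.star, p.length + s.j, k + s.k⟩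
    have e : p ++ (sh k u ++ r) = (p ++ sh k p') ++ (sh s'.k s'.dom ++ (sh k r' ++ r)) := by
      rw [h1, sh_append, sh_append, sh_sh]
      simp [s', Step.dom]
    have e' : p ++ (sh k (s.app u) ++ r)
        = (p ++ sh k p') ++ (sh s'.k s'.cod ++ (sh k r' ++ r)) := by
      rw [h2, sh_append, sh_append, sh_sh]
      simp [s', Step.cod]
    have hj' : (p ++ sh k p').length = s'.j := by
      simp [s', List.length_append, sh_length, hj]
    have hq'' : wd n (p ++ sh k p') = s'.k + s'.x.bw + (q' + q) := by
      rw [wd_append, hq, w'.2, hq']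
      simp only [s']
      omega
    have f := s'.fits_mk (r := sh k r' ++ r) hj' hq''
    have g := s'.ev_mk (A := m.A) (gm := m.gm) m.cm (r := sh k r' ++ r) hj' hq''
    rw [← e, ← e'] at f
    have hs : shP p.length k (s :: X) = s' :: shP p.length k X := rfl
    rw [hs, okP, f.1, f.2, i1, run, f.2, i2]
    refine ⟨rfl, rfl, ?_⟩
    rw [ev, eval, f.2]
    change C.vcomp _ (m.ev _ _ _) = wk _ _ (tC m.A k q (C.vcomp _ (m.ev _ _ _))) _
    have t := s.ev_src_tgt m.hg hX.1 hu (m.hcm s.x)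
    have t' := m.ev_src_tgt hX.2 hu'.1
    have hr0 := hr
    rw [hu'.2] at hr0
    rw [i3, tC_vcomp _ _ _ (t.2.trans t'.1.symm),
      wk_vcomp (fits_words m.hg t.1 hu hp hq hr0)]
    · rw [hu'.2]
      congr 1
      rw [e, g]
      have sev := s.ev_mk (A := m.A) (gm := m.gm) m.cm (r := r') hj hq'
      rw [← h1] at sev
      rw [sev]
      have c := s.cell_src_tgt (m.hcm s.x)
      have F := fits_words m.hg c.1 s.ok.1 hp' hq' hr'
      have F' := fits_words m.hg (C.id₂_src (m.mor b u)) hu hp hq hr0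
      rw [tC_wk _ _ _ F, tC_tC, wk_wk]
      · rw [← wmor_sh m.hg hp', ← wmor_sh m.hg hr']
        have e1 : wd b u = wd (s.k + wd s.x.bw s.dom + q') r' := by
          rw [h1, wd_append, wd_append, hq', (okW_sh s.ok.1 s.k q').2]
        have o1 := okW_sh hr' k q
        have e2 : k + (s.k + wd s.x.bw s.dom + q') + q
          = s'.k + wd s'.x.bw s.dom + (q' + q) := by simp only [s']; omega
        have hc : s'.cell m.cm = s.cell m.cm := rfl
        have hd : s'.dom = s.dom := rfl
        rw [hc, hd, wmor_append m.hg, wmor_append m.hg]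
        · rw [hq, e1, ← o1.2, e2]
        · rw [← e2, okW_append, o1.1, o1.2, ← e1, hr0]; rfl
        · rw [okW_append, hp, hq, w'.1]; rfl
      · rw [Fits, ← tC_tC, tC_src, tM_tgt, tM_src, tM_tgt, tM_src, F.1, F.2]
        exact ⟨rfl, rfl⟩
      · rw [← wmor_sh m.hg hp', (wmor_src_tgt m.hg w'.1).1, (wmor_src_tgt m.hg hp).2, hq]
      · have o1 := okW_sh hr' k q
        rw [← wmor_sh m.hg hr', (wmor_src_tgt m.hg o1.1).2, (wmor_src_tgt m.hg hr0).1, o1.2]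
        congr 2
        rw [h1, wd_append, wd_append, hq', (okW_sh s.ok.1 s.k q').2]
    · rw [tC_src, tC_tgt, t.2, t'.1]

/-- Two steps in disjoint places can be performed in either order. -/
theorem ev_interchange {n q₁ q₂ : ℕ} {s₁ s₂ : Step} {p g r : Word} (hp : okW n p = true)
    (hq₁ : wd n p = s₁.k + s₁.x.bw + q₁)
    (hg : okW (s₁.k + wd s₁.x.bw s₁.dom + q₁) g = true)
    (hq₂ : wd (s₁.k + wd s₁.x.bw s₁.dom + q₁) g = s₂.k + s₂.x.bw + q₂)
    (hr : okW (s₂.k + wd s₂.x.bw s₂.dom + q₂) r = true)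
    (hj₁ : p.length = s₁.j) (hj₂ : (p ++ (sh s₁.k s₁.cod ++ g)).length = s₂.j) (j : ℕ)
    (hj : (p ++ (sh s₁.k s₁.dom ++ g)).length = j) :
    let w := p ++ (sh s₁.k s₁.dom ++ (g ++ (sh s₂.k s₂.dom ++ r)))
    let P := [s₁, s₂]
    let Q := [⟨s₂.x, s₂.star, j, s₂.k⟩, s₁]
    okP n w P = true ∧ okP n w Q = true ∧ run w P = run w Q ∧ m.ev n w P = m.ev n w Q := by
  intro w P Q
  let s₃ : Step := ⟨s₂.x, s₂.star, j, s₂.k⟩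
  have D : s₃.dom = s₂.dom := rfl
  have D' : s₃.cod = s₂.cod := rfl
  have K : s₃.k = s₂.k := rfl
  have X : s₃.x = s₂.x := rfl
  have hc₁ : okW (s₁.k + wd s₁.x.bw s₁.cod + q₁) g = true := by rw [← s₁.ok.2.2, hg]
  have hc₂ : okW (s₂.k + wd s₂.x.bw s₂.cod + q₂) r = true := by rw [← s₂.ok.2.2, hr]
  have a₁ := okW_sh s₁.ok.1 s₁.k q₁
  have b₁ := okW_sh s₁.ok.2.1 s₁.k q₁
  have W₁ : wd n (p ++ (sh s₁.k s₁.cod ++ g)) = s₂.k + s₂.x.bw + q₂ := by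
    rw [wd_append, wd_append, hq₁, b₁.2, ← s₁.ok.2.2, hq₂]
  have W₂ : wd n (p ++ (sh s₁.k s₁.dom ++ g)) = s₃.k + s₃.x.bw + q₂ := by
    rw [wd_append, wd_append, hq₁, a₁.2, hq₂]
  have f₁ := s₁.fits_mk (r := g ++ (sh s₂.k s₂.dom ++ r)) hj₁ hq₁
  have f₂ := s₂.fits_mk (r := r) hj₂ W₁
  have f₃ := s₃.fits_mk (r := r) hj W₂
  have f₄ := s₁.fits_mk (r := g ++ (sh s₂.k s₂.cod ++ r)) hj₁ hq₁
  have g₁ := s₁.ev_mk (A := m.A) (gm := m.gm) m.cm (r := g ++ (sh s₂.k s₂.dom ++ r)) hj₁ hq₁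
  have g₂ := s₂.ev_mk (A := m.A) (gm := m.gm) m.cm (r := r) hj₂ W₁
  have g₃ := s₃.ev_mk (A := m.A) (gm := m.gm) m.cm (r := r) hj W₂
  have g₄ := s₁.ev_mk (A := m.A) (gm := m.gm) m.cm (r := g ++ (sh s₂.k s₂.cod ++ r)) hj₁ hq₁
  rw [D, K] at f₃
  rw [D'] at f₃
  simp only [List.append_assoc] at f₂ f₃ g₂
  have c₁ := s₁.cell_src_tgt (m.hcm s₁.x)
  have c₂ := s₂.cell_src_tgt (m.hcm s₂.x)
  have F₁ := fits_words m.hg c₁.1 s₁.ok.1 hp hq₁ hg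
  have F₂ := fits_words m.hg c₂.1 s₂.ok.1 hg hq₂ hr
  have I := wk_interchange F₁ F₂
  rw [tC_src, tC_src, tC_tgt, tC_tgt, c₁.1, c₁.2, c₂.1, c₂.2, wmor_three m.hg s₂.ok.1 hg hq₂ hr,
    wmor_three m.hg s₁.ok.1 hp hq₁ hg] at I
  have I₁ := wmor_three m.hg s₁.ok.2.1 hp hq₁ hc₁
  have I₂ := wmor_three m.hg s₂.ok.2.1 hg hq₂ hc₂
  rw [← s₁.ok.2.2] at I₁
  rw [← s₂.ok.2.2] at I₂
  rw [I₁, I₂] at I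
  have hw : okW n w = true := by
    simp only [w, okW_append, hp, hq₁, a₁.1, a₁.2, hg, hq₂, (okW_sh s₂.ok.1 s₂.k q₂).1,
      (okW_sh s₂.ok.1 s₂.k q₂).2, hr, Bool.and_self]
  have oP : okP n w P = true := by
    simp only [P, w, okP, f₁.1, f₁.2, f₂.1, Bool.and_self]
  have oQ : okP n w Q = true := by
    simp only [Q, w, okP]
    change (s₃.fits n _ && (s₁.fits n (s₃.app _) && _)) = true
    rw [f₃.1, f₃.2, f₄.1]
    rfl
  refine ⟨oP, oQ, ?_, ?_⟩
  · simp only [run, P, Q, w, f₁.2, f₂.2]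
    change _ = s₁.app (s₃.app _)
    rw [f₃.2, f₄.2]
  · have two : ∀ s t : Step, okP n w [s, t] = true →
        m.ev n w [s, t] = C.vcomp (s.ev m.A m.gm m.cm n w) (t.ev m.A m.gm m.cm n (s.app w)) := by
      intro s t h
      simp only [okP, Bool.and_eq_true] at h
      have o := s.okW_app h.1 hw
      have := C.vcomp_id_right (t.ev m.A m.gm m.cm n (s.app w))
      rw [(t.ev_src_tgt m.hg h.2.1 o.1 (m.hcm _)).2] at this
      simp only [ev, eval]
      rw [this]
    rw [two _ _ oP, two _ _ oQ]
    simp only [w]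
    rw [f₁.2, g₁, g₂, I]
    congr 1
    · change _ = s₃.ev _ _ _ _ _
      rw [D, K] at g₃
      simp only [List.append_assoc] at g₃
      rw [g₃]
      rfl
    · change _ = s₁.ev _ _ _ _ (s₃.app _)
      rw [f₃.2, g₄]

end Model

end Diagram

namespace Diagram

/-- An equation between two paths starting at the word `u` on `n` strands. -/
structure Rel where
  n : ℕ
  u : Word
  X : Path
  Y : Path

/-- A rewriting move on paths: exchange the `i`-th step with the next one (which happens to its
right or to its left), or use one of the known equations, forwards or backwards, after `pos`
steps, shifted by `j` letters and `k` strands. -/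
inductive Move
  | right (i : ℕ)
  | left (i : ℕ)
  | fwd (r pos j k : ℕ)
  | bwd (r pos j k : ℕ)

/-- Exchange the first two steps of a path. -/
def swapHead (toRight : Bool) : Path → Option Path
  | s :: t :: P =>
    if toRight then
      if s.j + s.cod.length ≤ t.j then
        some (⟨t.x, t.star, t.j - s.cod.length + s.dom.length, t.k⟩ :: s :: P)
      else none
    else
      if t.j + t.dom.length ≤ s.j then
        some (t :: ⟨s.x, s.star, s.j - t.dom.length + t.cod.length, s.k⟩ :: P)
      else none
  | _ => none

/-- Replace the beginning of a path using an equation. -/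
def useHead (n : ℕ) (w : Word) (r : Rel) (j k : ℕ) (P : Path) : Option Path :=
  if w = w.take j ++ (sh k r.u ++ w.drop (j + r.u.length)) ∧ j ≤ w.length ∧
      k + r.n ≤ wd n (w.take j) ∧ P = shP j k r.X ++ P.drop r.X.length then
    some (shP j k r.Y ++ P.drop r.X.length)
  else none

/-- Apply a transformation of paths after the first `i` steps. -/
def after (f : Word → Path → Option Path) : ℕ → Word → Path → Option Path
  | 0, w, P => f w P
  | i + 1, w, s :: P => (after f i (s.app w) P).map (s :: ·)
  | _ + 1, _, [] => none

def Rel.symm (r : Rel) : Rel := ⟨r.n, r.u, r.Y, r.X⟩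

/-- Perform one move. -/
def Move.act (rels : List Rel) (n : ℕ) (w : Word) (P : Path) : Move → Option Path
  | right i => after (fun _ => swapHead true) i w P
  | left i => after (fun _ => swapHead false) i w P
  | fwd r pos j k => rels[r]?.bind fun r => after (fun w => useHead n w r j k) pos w P
  | bwd r pos j k => rels[r]?.bind fun r => after (fun w => useHead n w r.symm j k) pos w P

/-- Perform a list of moves. -/
def acts (rels : List Rel) (n : ℕ) (w : Word) : List Move → Path → Option Path
  | [], P => some P
  | a :: l, P => (a.act rels n w P).bind (acts rels n w l)

/-- Check that a list of moves turns `P` into `Q`. -/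
def checkMoves (rels : List Rel) (r : Rel) (l : List Move) : Bool :=
  okW r.n r.u && okP r.n r.u r.X && decide (acts rels r.n r.u l r.X = some r.Y)

namespace Model

variable {C : DualsData} (m : Model C)

/-- The equation is well formed and holds in the model. -/
structure Holds (r : Rel) : Prop where
  word : okW r.n r.u = true
  left : okP r.n r.u r.X = true
  right : okP r.n r.u r.Y = true
  run_eq : run r.u r.X = run r.u r.Y
  ev_eq : m.ev r.n r.u r.X = m.ev r.n r.u r.Y

variable {m}

theorem Holds.symm {r : Rel} (h : m.Holds r) : m.Holds r.symm :=
  ⟨h.word, h.right, h.left, h.run_eq.symm, h.ev_eq.symm⟩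

theorem Holds.refl {n : ℕ} {u : Word} {X : Path} (h : okW n u = true) (h' : okP n u X = true) :
    m.Holds ⟨n, u, X, X⟩ := ⟨h, h', h', rfl, rfl⟩

theorem Holds.trans {n : ℕ} {u : Word} {X Y Z : Path} (h : m.Holds ⟨n, u, X, Y⟩)
    (h' : m.Holds ⟨n, u, Y, Z⟩) : m.Holds ⟨n, u, X, Z⟩ :=
  ⟨h.word, h.left, h'.right, h.run_eq.trans h'.run_eq, h.ev_eq.trans h'.ev_eq⟩

theorem Holds.append_right {n : ℕ} {u : Word} {X Y Z : Path} (h : m.Holds ⟨n, u, X, Y⟩)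
    (hZ : okP n (run u X) Z = true) : m.Holds ⟨n, u, X ++ Z, Y ++ Z⟩ := by
  have e := h.run_eq
  have o : okP n u (X ++ Z) = true := by rw [okP_append, h.left, hZ]; rfl
  have o' : okP n u (Y ++ Z) = true := by rw [okP_append, h.right, ← e, hZ]; rfl
  refine ⟨h.word, o, o', ?_, ?_⟩
  · rw [run_append, run_append, e]
  · dsimp only
    rw [m.ev_append o h.word, m.ev_append o' h.word, h.ev_eq, e]

theorem Holds.cons {n : ℕ} {u : Word} {s : Step} {X Y : Path} (hu : okW n u = true)
    (hs : s.fits n u = true) (h : m.Holds ⟨n, s.app u, X, Y⟩) :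
    m.Holds ⟨n, u, s :: X, s :: Y⟩ := by
  refine ⟨hu, ?_, ?_, h.run_eq, ?_⟩
  · simp only [okP, hs, h.left, Bool.and_self]
  · simp only [okP, hs, h.right, Bool.and_self]
  · simp only [ev, eval]
    exact congrArg _ h.ev_eq

/-- An equation can be used inside a larger diagram. -/
theorem Holds.lift {r : Rel} (h : m.Holds r) {n k q : ℕ} {p t : Word} (hp : okW n p = true)
    (hq : wd n p = k + r.n + q) (ht : okW (k + wd r.n r.u + q) t = true) :
    m.Holds ⟨n, p ++ (sh k r.u ++ t), shP p.length k r.X, shP p.length k r.Y⟩ := by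
  have a := m.ev_lift h.word h.left hp hq ht
  have b := m.ev_lift h.word h.right hp hq ht
  refine ⟨?_, a.1, b.1, ?_, ?_⟩
  · have := okW_sh h.word k q
    rw [okW_append, okW_append, hp, hq, this.1, this.2, ht]; rfl
  · dsimp only
    rw [a.2.1, b.2.1, h.run_eq]
  · dsimp only
    rw [a.2.2, b.2.2, h.ev_eq]

theorem useHead_holds {n : ℕ} {w : Word} {r : Rel} {j k : ℕ} {P Q : Path} (h : m.Holds r)
    (hw : okW n w = true) (hP : okP n w P = true) (hQ : useHead n w r j k P = some Q) :
    m.Holds ⟨n, w, P, Q⟩ := by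
  unfold useHead at hQ
  split at hQ
  · next c =>
    obtain ⟨c1, c2, c3, c4⟩ := c
    obtain ⟨q, hq⟩ := Nat.exists_eq_add_of_le c3
    have hw' := hw
    rw [c1, okW_append, okW_append, Bool.and_eq_true, Bool.and_eq_true, hq,
      (okW_sh h.word k q).2] at hw'
    have l := h.lift hw'.1 hq hw'.2.2
    rw [← c1, List.length_take, Nat.min_eq_left c2] at l
    rw [c4, okP_append, Bool.and_eq_true] at hP
    have := l.append_right hP.2
    rw [← c4] at this
    cases hQ
    exact this
  · cases hQ

theorem swapHead_holds {n : ℕ} {w : Word} {b : Bool} {P Q : Path}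
    (hw : okW n w = true) (hP : okP n w P = true) (hQ : swapHead b P = some Q) :
    m.Holds ⟨n, w, P, Q⟩ := by
  match P, hQ with
  | s :: t :: P, hQ =>
    simp only [okP, Bool.and_eq_true] at hP
    obtain ⟨hs, ht, hP⟩ := hP
    obtain ⟨p, r, q, h1, h2, hj, hq, hp, hr⟩ := s.fits_iff hs hw
    have hw' := s.okW_app hs hw
    obtain ⟨p', r', q', h1', h2', hj', hq', hp', hr'⟩ := t.fits_iff ht hw'.1
    have suff : ∀ s' t', m.Holds ⟨n, w, [s, t], [s', t']⟩ → Q = s' :: t' :: P →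
        m.Holds ⟨n, w, s :: t :: P, Q⟩ := by
      rintro s' t' h rfl
      exact h.append_right hP
    have E : p ++ (sh s.k s.cod ++ r) = p' ++ (sh t.k t.dom ++ r') := h2.symm.trans h1'
    simp only [swapHead] at hQ
    cases b
    rotate_left
    · rw [if_pos rfl] at hQ
      split at hQ
      · next c =>
        rw [← List.append_assoc, List.append_eq_append_iff] at E
        have key : ∃ g, p' = p ++ (sh s.k s.cod ++ g) ∧ r = g ++ (sh t.k t.dom ++ r') := by
          rcases E with ⟨g, e1, e2⟩ | ⟨g, e1, e2⟩
          · exact ⟨g, by rw [e1, List.append_assoc], e2⟩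
          · have := congrArg List.length e1
            rw [List.length_append, List.length_append, sh_length] at this
            have g0 : g = [] := List.eq_nil_of_length_eq_zero (by omega)
            subst g0
            exact ⟨[], by simpa using e1.symm, by simpa using e2.symm⟩
        obtain ⟨g, rfl, rfl⟩ := key
        rw [okW_append, Bool.and_eq_true] at hr
        have a := okW_sh s.ok.2.1 s.k q
        rw [wd_append, wd_append, hq, a.2, ← s.ok.2.2] at hq'
        rw [← hj'] at hQ
        have I := m.ev_interchange (s₁ := s) (s₂ := t) hp hq hr.1 hq' hr' hj hj' _ rfl
        rw [← h1] at I
        refine suff _ _ ⟨hw, I.1, I.2.1, I.2.2.1, I.2.2.2⟩ ?_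
        cases hQ
        simp [List.length_append, sh_length]
        omega
      · cases hQ
    · rw [if_neg Bool.false_ne_true] at hQ
      split at hQ
      · next c =>
        rw [← List.append_assoc p', List.append_eq_append_iff] at E
        have key : ∃ g, p = p' ++ (sh t.k t.dom ++ g) ∧ r' = g ++ (sh s.k s.cod ++ r) := by
          rcases E with ⟨g, e1, e2⟩ | ⟨g, e1, e2⟩
          · have := congrArg List.length e1
            rw [List.length_append, List.length_append, sh_length] at this
            have g0 : g = [] := List.eq_nil_of_length_eq_zero (by omega)
            subst g0
            exact ⟨[], by simpa using e1.symm, by simpa using e2.symm⟩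
          · exact ⟨g, by rw [e1, List.append_assoc], e2⟩
        obtain ⟨g, rfl, rfl⟩ := key
        have a := okW_sh t.ok.1 t.k q'
        rw [wd_append, wd_append, hq', a.2, t.ok.2.2] at hq
        rw [okW_append, okW_append, Bool.and_eq_true, Bool.and_eq_true, hq', a.2,
          t.ok.2.2] at hp
        let s' : Step := ⟨s.x, s.star, (p' ++ (sh t.k t.cod ++ g)).length, s.k⟩
        have I := m.ev_interchange (s₁ := t) (s₂ := s') hp' hq' (by rw [t.ok.2.2]; exact hp.2.2)
          (by rw [t.ok.2.2]; exact hq) hr hj' rfl s.j hj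
        have es : (⟨s'.x, s'.star, s.j, s'.k⟩ : Step) = s := rfl
        have eh : p' ++ (sh t.k t.dom ++ (g ++ (sh s'.k s'.dom ++ r))) = w := by
          rw [h1]
          simp [s', Step.dom]
        rw [es, eh] at I
        refine suff _ _ ⟨hw, I.2.1, I.1, I.2.2.1.symm, I.2.2.2.symm⟩ ?_
        cases hQ
        simp [s', List.length_append, sh_length] at hj ⊢
        omega
      · cases hQ

theorem after_holds {n : ℕ} {f : Word → Path → Option Path}
    (hf : ∀ w P Q, okW n w = true → okP n w P = true → f w P = some Q → m.Holds ⟨n, w, P, Q⟩)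
    {i : ℕ} {w : Word} {P Q : Path} (hw : okW n w = true) (hP : okP n w P = true)
    (hQ : after f i w P = some Q) : m.Holds ⟨n, w, P, Q⟩ := by
  induction i generalizing w P Q with
  | zero => exact hf _ _ _ hw hP hQ
  | succ i ih =>
    cases P with
    | nil => cases hQ
    | cons s P =>
      simp only [okP, Bool.and_eq_true] at hP
      rw [after, Option.map_eq_some_iff] at hQ
      obtain ⟨Q, hQ, rfl⟩ := hQ
      exact (ih (s.okW_app hP.1 hw).1 hP.2 hQ).cons hw hP.1

theorem act_holds {rels : List Rel} (hr : ∀ r ∈ rels, m.Holds r) {n : ℕ} {w : Word} {P Q : Path}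
    {a : Move} (hw : okW n w = true) (hP : okP n w P = true)
    (hQ : a.act rels n w P = some Q) : m.Holds ⟨n, w, P, Q⟩ := by
  cases a with
  | right i => exact after_holds (fun _ _ _ => swapHead_holds) hw hP hQ
  | left i => exact after_holds (fun _ _ _ => swapHead_holds) hw hP hQ
  | fwd r pos j k =>
    simp only [Move.act, Option.bind_eq_some_iff] at hQ
    obtain ⟨r, h1, h2⟩ := hQ
    exact after_holds (fun _ _ _ => useHead_holds (hr r (List.mem_of_getElem? h1))) hw hP h2
  | bwd r pos j k =>
    simp only [Move.act, Option.bind_eq_some_iff] at hQ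
    obtain ⟨r, h1, h2⟩ := hQ
    exact after_holds (fun _ _ _ => useHead_holds (hr r (List.mem_of_getElem? h1)).symm) hw hP h2

/-- Soundness of rewriting. -/
theorem holds_of_moves {rels : List Rel} (hr : ∀ r ∈ rels, m.Holds r) {r : Rel} (l : List Move)
    (h : checkMoves rels r l = true) : m.Holds r := by
  obtain ⟨n, w, P, Q⟩ := r
  simp only [checkMoves, Bool.and_eq_true, decide_eq_true_eq] at h
  obtain ⟨⟨hw, hP⟩, h⟩ := h
  induction l generalizing P with
  | nil => cases h; exact Holds.refl hw hP
  | cons a l ih =>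
    rw [acts, Option.bind_eq_some_iff] at h
    obtain ⟨P', h1, h2⟩ := h
    have := act_holds hr hw hP h1
    exact this.trans (ih P' h2 this.right)

end Model

end Diagram

namespace Diagram

section Mor

variable {M : MonTwoCat} {A : M.Obj} {gm : Gen → M.Mor}

variable (A gm) in
/-- The word `w` on `n` strands denotes the 1-morphism `f`. -/
structure DenM (f : M.Mor) (n : ℕ) (w : Word) : Prop where
  word : okW n w = true
  eq : f = wmor A gm n w

namespace DenM

variable {f g : M.Mor} {n : ℕ} {u v : Word}

theorem id (n : ℕ) : DenM A gm (M.id₁ (pw M A n)) n [] := ⟨rfl, rfl⟩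

variable (hg : GoodGen A gm)
include hg

theorem gen (x : Gen) : DenM A gm (gm x) x.din [(x, 0)] := by
  refine ⟨by simp [okW], ?_⟩
  have h : M.tgt₁ (gm x) = pw M A (x.din - x.din + x.dout) := by rw [(hg x).2]; congr 1; omega
  simp only [wmor, zero_add, Nat.sub_self, tM_zero]
  rw [show x.dout = x.din - x.din + x.dout by omega, ← h, M.comp_id_right]

theorem src (h : DenM A gm f n u) : M.src₁ f = pw M A n := by
  rw [h.eq, (wmor_src_tgt hg h.word).1]

theorem tgt (h : DenM A gm f n u) : M.tgt₁ f = pw M A (wd n u) := by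
  rw [h.eq, (wmor_src_tgt hg h.word).2]

theorem comp (h : DenM A gm f n u) (h' : DenM A gm g (wd n u) v) :
    DenM A gm (M.comp f g) n (u ++ v) := by
  have o : okW n (u ++ v) = true := by rw [okW_append, h.word, h'.word]; rfl
  exact ⟨o, by rw [wmor_append hg o, h.eq, h'.eq]⟩

theorem tens (h : DenM A gm f n u) (k q : ℕ) : DenM A gm (tM A k q f) (k + n + q) (sh k u) :=
  ⟨(okW_sh h.word k q).1, by rw [wmor_sh hg h.word, h.eq]⟩

theorem left (h : DenM A gm f n u) (k : ℕ) : DenM A gm (M.tOM (pw M A k) f) (k + n) (sh k u) := by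
  have := h.tens hg k 0
  rwa [tM, show pw M A 0 = M.unit from rfl, M.tMO_unit] at this

theorem right (h : DenM A gm f n u) (q : ℕ) : DenM A gm (M.tMO f (pw M A q)) (n + q) u := by
  have := h.tens hg 0 q
  rwa [tM, show pw M A 0 = M.unit from rfl, M.tOM_unit, Nat.zero_add,
    show sh 0 u = u by simp [sh]] at this

end DenM

end Mor

/-- The dual of a path: perform the duals of its steps in the opposite order. -/
def revP (P : Path) : Path := (P.map fun s => ⟨s.x, !s.star, s.j, s.k⟩).reverse

namespace Model

variable {C : DualsData} (m : Model C)

/-- The path `P` starting from the word `w` on `n` strands denotes the 2-morphism `α`. -/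
structure Den (α : C.Cell) (n : ℕ) (w : Word) (P : Path) : Prop where
  word : okW n w = true
  path : okP n w P = true
  eq : α = m.ev n w P

abbrev DenM (f : C.Mor) (n : ℕ) (w : Word) : Prop :=
  Diagram.DenM (M := C.toMonTwoCat) m.A m.gm f n w

variable {m}

namespace Den

variable {α β : C.Cell} {f : C.Mor} {n : ℕ} {u v : Word} {P Q : Path}

theorem src (h : m.Den α n u P) : C.src₂ α = m.mor n u := by
  rw [h.eq, (m.ev_src_tgt h.path h.word).1]

theorem tgt (h : m.Den α n u P) : C.tgt₂ α = m.mor n (run u P) := by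
  rw [h.eq, (m.ev_src_tgt h.path h.word).2]

theorem id (h : m.DenM f n u) : m.Den (C.id₂ f) n u [] := ⟨h.word, rfl, by rw [h.eq]; rfl⟩

theorem vcomp (h : m.Den α n u P) (h' : m.Den β n (run u P) Q) :
    m.Den (C.vcomp α β) n u (P ++ Q) := by
  have o : okP n u (P ++ Q) = true := by rw [okP_append, h.path, h'.path]; rfl
  exact ⟨h.word, o, by rw [m.ev_append o h.word, h.eq, h'.eq]⟩

theorem tens (h : m.Den α n u P) (k q : ℕ) :
    m.Den (tC m.A k q α) (k + n + q) (sh k u) (shP 0 k P) := by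
  have := m.ev_lift (n := k + n + q) (p := []) (r := []) (k := k) (q := q) h.word h.path rfl rfl rfl
  simp only [List.nil_append, List.append_nil, List.length_nil] at this
  refine ⟨(okW_sh h.word k q).1, this.1, ?_⟩
  rw [this.2.2, ← h.eq]
  have s := h.src
  have t := wmor_src_tgt m.hg h.word
  have w := C.hcomp_id_right (tC m.A k q α)
  rw [tC_src, s, tM_tgt, t.2, pw_add, pw_add, ← Nat.add_assoc] at w
  have w' := C.hcomp_id_left (tC m.A k q α)
  rw [tC_src, s, tM_src, t.1, pw_add, pw_add, ← Nat.add_assoc] at w'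
  simp only [wk, mor, wmor]
  rw [w, w']

theorem left (h : m.Den α n u P) (k : ℕ) :
    m.Den (C.tOC (pw C.toMonTwoCat m.A k) α) (k + n) (sh k u) (shP 0 k P) := by
  have := h.tens k 0
  rwa [tC, show pw C.toMonTwoCat m.A 0 = C.unit from rfl, C.tCO_unit] at this

theorem right (h : m.Den α n u P) (q : ℕ) :
    m.Den (C.tCO α (pw C.toMonTwoCat m.A q)) (n + q) u P := by
  have := h.tens 0 q
  rwa [tC, show pw C.toMonTwoCat m.A 0 = C.unit from rfl, C.tOC_unit, Nat.zero_add,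
    show sh 0 u = u by simp [sh], show shP 0 0 P = P by simp [shP]] at this

theorem run_wd (h : m.Den α n u P) : wd n (run u P) = wd n u := (okW_run h.path h.word).2

theorem run_ok (h : m.Den α n u P) : okW n (run u P) = true := (okW_run h.path h.word).1

theorem hcomp (h : m.Den α n u P) (h' : m.Den β (wd n u) v Q) :
    m.Den (C.hcomp α β) n (u ++ v) (P ++ shP (run u P).length 0 Q) := by
  have a := m.ev_lift (n := n) (p := []) (r := v) (k := 0) (q := 0) h.word h.path rfl (by simp [wd])
    (by simpa using h'.word)
  have b := h'
  rw [← h.run_wd] at b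
  have c := m.ev_lift (n := n) (p := run u P) (r := []) (k := 0) (q := 0) b.word b.path h.run_ok
    (by simp) rfl
  simp only [List.nil_append, List.append_nil, List.length_nil, tC_zero,
    show ∀ v, sh 0 v = v by simp [sh], show shP 0 0 P = P by simp [shP], Nat.zero_add,
    Nat.add_zero] at a c
  rw [← h.eq] at a
  rw [← b.eq] at c
  have o : okP n (u ++ v) (P ++ shP (run u P).length 0 Q) = true := by
    rw [okP_append, a.1, a.2.1, c.1]; rfl
  have o' : okW n (u ++ v) = true := by rw [okW_append, h.word, h'.word]; rfl
  refine ⟨o', o, ?_⟩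
  rw [m.ev_append o o', a.2.2, a.2.1, c.2.2]
  have s := wmor_src_tgt m.hg h.word
  have s' := wmor_src_tgt m.hg h'.word
  have t := wmor_src_tgt m.hg h.run_ok
  have hc : C.tgt₁ (C.src₂ α) = C.src₁ (C.src₂ β) := by
    rw [h.src, h'.src, s.2, s'.1]
  have e1 : wk C.toMonTwoCat (m.mor n []) α (m.mor (wd n u) v) = C.hcomp α (C.id₂ (C.src₂ β)) := by
    have x := C.hcomp_id_left (C.hcomp α (C.id₂ (m.mor (wd n u) v)))
    rw [C.hcomp_src, h.src, C.id₂_src, C.comp_src, s.1] at x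
    · simp only [wk, mor, wmor] at x ⊢
      rw [x, h'.src]
    · rw [s.2, s'.1]
    · rw [h.src, C.id₂_src, s.2, s'.1]
  have e2 : wk C.toMonTwoCat (m.mor n (run u P)) β (m.mor (wd (wd n (run u P)) v) [])
      = C.hcomp (C.id₂ (C.tgt₂ α)) β := by
    have x := C.hcomp_id_right β
    rw [b.src, (wmor_src_tgt m.hg b.word).2] at x
    simp only [wk, mor, wmor] at x ⊢
    rw [x, h.tgt]
  rw [e1, e2, ← C.exchange, C.vcomp_id_right, C.vcomp_id_left]
  · rw [C.id₂_src]
  · rw [C.id₂_tgt]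
  · rw [C.id₂_src, hc]

theorem atom (x : Name) : m.Den (m.cm x) x.bw x.dom [⟨x, false, 0, 0⟩] := by
  let s : Step := ⟨x, false, 0, 0⟩
  have f := s.fits_mk (p := []) (r := []) (n := x.bw) (q := 0) rfl (by simp [wd, s])
  have e := s.ev_mk (A := m.A) (gm := m.gm) m.cm (p := []) (r := []) (n := x.bw) (q := 0) rfl
    (by simp [wd, s])
  simp only [List.nil_append, List.append_nil, show ∀ v, sh 0 v = v by simp [sh],
    show s.dom = x.dom from rfl, show s.k = 0 from rfl] at f e
  refine ⟨x.ok.1, ?_, ?_⟩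
  · simp only [okP]
    rw [Bool.and_true]
    exact f.1
  · rw [ev, eval, eval]
    change _ = C.vcomp (s.ev _ _ _ _ _) (C.id₂ (wmor _ _ _ (s.app _)))
    have t := (s.ev_src_tgt m.hg f.1 x.ok.1 (m.hcm x)).2
    rw [← t, C.vcomp_id_right, e, tC_zero]
    have w := C.hcomp_id_right (m.cm x)
    have w' := C.hcomp_id_left (m.cm x)
    have g := (m.hcm x).1
    have g' := wmor_src_tgt m.hg x.ok.1
    rw [g, g'.2] at w
    rw [g, g'.1] at w'
    simp only [wk, wmor, Nat.zero_add, Nat.add_zero, show s.cell m.cm = m.cm x from rfl,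
      show s.x = x from rfl]
    rw [w, w']

/-- Two paths denoting the same 2-morphism give an equation. -/
theorem holds (h : m.Den α n u P) (h' : m.Den β n u Q) (e : α = β) (hr : run u P = run u Q) :
    m.Holds ⟨n, u, P, Q⟩ := ⟨h.word, h.path, h'.path, hr, by
  dsimp only
  rw [← h.eq, ← h'.eq, e]⟩

section Dual

variable (hC : DualsLaws C)
include hC

theorem step_star {s : Step} (hu : okW n u = true) (hs : s.fits n u = true) :
    (⟨s.x, !s.star, s.j, s.k⟩ : Step).fits n (s.app u) = true ∧
    (⟨s.x, !s.star, s.j, s.k⟩ : Step).app (s.app u) = u ∧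
    (⟨s.x, !s.star, s.j, s.k⟩ : Step).ev m.A m.gm m.cm n (s.app u)
      = C.dCell (s.ev m.A m.gm m.cm n u) := by
  obtain ⟨p, r, q, h1, h2, hj, hq, hp, hr⟩ := s.fits_iff hs hu
  let t : Step := ⟨s.x, !s.star, s.j, s.k⟩
  have d : t.dom = s.cod := by
    simp only [t, Step.dom, Step.cod]
    cases s.star <;> rfl
  have c : t.cod = s.dom := by
    simp only [t, Step.dom, Step.cod]
    cases s.star <;> rfl
  have k : t.k = s.k := rfl
  have f := t.fits_mk (p := p) (r := r) (n := n) (q := q) hj hq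
  have e := t.ev_mk (A := m.A) (gm := m.gm) m.cm (p := p) (r := r) (n := n) (q := q) hj hq
  rw [d, k, ← h2] at f e
  rw [c] at f
  rw [← h1] at f
  refine ⟨f.1, f.2, ?_⟩
  have e' := s.ev_mk (A := m.A) (gm := m.gm) m.cm (p := p) (r := r) (n := n) (q := q) hj hq
  rw [← h1] at e'
  change t.ev _ _ _ _ _ = _
  have x : t.cell m.cm = C.dCell (s.cell m.cm) := by
    simp only [t, Step.cell]
    cases s.star
    · rfl
    · exact (hC.dCell_invol _).symm
  have cc := s.cell_src_tgt (m.hcm s.x)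
  have F := fits_words m.hg cc.1 s.ok.1 hp hq hr
  rw [e, e', x, wk, wk, hC.dCell_hcomp, hC.dCell_hcomp, hC.dCell_id, hC.dCell_id, tC, tC,
    hC.dCell_tOC, hC.dCell_tCO]
  · rw [show t.x = s.x from rfl, s.ok.2.2]
  · rw [C.id₂_src]; exact F.2
  · rw [C.hcomp_src, C.id₂_src, C.comp_src]
    · exact F.1
    · rw [C.id₂_src]; exact F.2
    · rw [C.id₂_src]; exact F.2

theorem path_star (hu : okW n u = true) (hP : okP n u P = true) :
    okP n (run u P) (revP P) = true ∧ run (run u P) (revP P) = u ∧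
      m.ev n (run u P) (revP P) = C.dCell (m.ev n u P) := by
  induction P generalizing u with
  | nil => exact ⟨rfl, rfl, (hC.dCell_id _).symm⟩
  | cons s P ih =>
    simp only [okP, Bool.and_eq_true] at hP
    obtain ⟨a, b, c⟩ := step_star (m := m) hC hu hP.1
    have o := s.okW_app hP.1 hu
    obtain ⟨i, j, k⟩ := ih o.1 hP.2
    have e : revP (s :: P) = revP P ++ [⟨s.x, !s.star, s.j, s.k⟩] := by simp [revP]
    have ok : okP n (run u (s :: P)) (revP (s :: P)) = true := by
      rw [e, okP_append, run, i, j]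
      simp [okP, a]
    refine ⟨ok, by rw [e, run_append]; simp only [run, j, b], ?_⟩
    have o' := okW_run hP.2 o.1
    have t := s.ev_src_tgt m.hg hP.1 hu (m.hcm s.x)
    have t' := m.ev_src_tgt hP.2 o.1
    rw [e] at ok ⊢
    rw [run] at ok ⊢
    rw [m.ev_append ok o'.1, k, j]
    simp only [ev, eval]
    rw [hC.dCell_vcomp _ _ (t.2.trans t'.1.symm), b, c]
    congr 1
    have := C.vcomp_id_right (C.dCell (s.ev m.A m.gm m.cm n u))
    rw [C.dCell_tgt, t.1] at this
    exact this

theorem dual (h : m.Den α n u P) : m.Den (C.dCell α) n (run u P) (revP P) := by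
  obtain ⟨a, b, c⟩ := path_star (m := m) hC h.word h.path
  exact ⟨h.run_ok, a, by rw [c, h.eq]⟩

/-- A unitary 2-morphism cancels its dual. -/
theorem cancel (h : m.Den α n u P) (hα : C.Unitary α) :
    m.Holds ⟨n, u, P ++ revP P, []⟩ ∧ m.Holds ⟨n, run u P, revP P ++ P, []⟩ := by
  obtain ⟨a, b, c⟩ := path_star (m := m) hC h.word h.path
  have d := h.dual hC
  have d' := d.vcomp (Q := P) (β := α) (by rw [b]; exact h)
  refine ⟨(h.vcomp d).holds (id ⟨h.word, rfl⟩) ?_ ?_, d'.holds (id ⟨h.run_ok, rfl⟩) ?_ ?_⟩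
  · rw [hα.1, h.src]
  · rw [run_append, b]; rfl
  · rw [hα.2, h.tgt]
  · rw [run_append, b]; rfl

end Dual

end Den

/-- The dual of an equation. -/
theorem Holds.star (hC : DualsLaws C) {n : ℕ} {u : Word} {P Q : Path}
    (h : m.Holds ⟨n, u, P, Q⟩) : m.Holds ⟨n, run u P, revP P, revP Q⟩ := by
  have a := Den.path_star (m := m) hC h.word h.left
  have b := Den.path_star (m := m) hC h.word h.right
  have e : run u P = run u Q := h.run_eq
  have e' : m.ev n u P = m.ev n u Q := h.ev_eq
  rw [← e] at b
  refine ⟨(okW_run h.left h.word).1, a.1, b.1, a.2.1.trans b.2.1.symm, ?_⟩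
  change m.ev n _ _ = m.ev n _ _
  rw [a.2.2, b.2.2, e']

end Model

end Diagram

namespace Diagram

/-- Slide the generator `y`, standing `gap` strands to the right of a word `u` on `b` strands,
from before `u` to after it. -/
def slideL (y : Gen) (gap : ℕ) : ℕ → Word → Path
  | _, [] => []
  | b, (g, p) :: u => ⟨.tens g y (b - (p + g.din) + gap), false, 0, p⟩ ::
      shP 1 0 (slideL y gap (b - g.din + g.dout) u)

/-- Slide the generator `x`, standing `gap` strands to the left of a word `u`, from after `u` to
before it. -/
def slideR (x : Gen) (gap : ℕ) : Word → Path
  | [] => []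
  | (g, p) :: u => shP 1 0 (slideR x gap u) ++ [⟨.tens x g (gap + p), false, 0, 0⟩]

theorem shP_nil (j k : ℕ) : shP j k [] = [] := rfl

theorem shP_shP (j k j' k' : ℕ) (P : Path) : shP j k (shP j' k' P) = shP (j + j') (k + k') P := by
  simp [shP, Function.comp_def, Nat.add_assoc]

namespace Model

variable {C : DualsData} {m : Model C}

theorem Den.cast {α β : C.Cell} {n n' : ℕ} {u u' : Word} {P P' : Path} (h : m.Den α n u P)
    (hα : β = α) (hn : n = n') (hu : u = u') (hP : P = P') : m.Den β n' u' P' := by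
  subst hα hn hu hP
  exact h

theorem Den.run_lift {α : C.Cell} {b k q n : ℕ} {p u r : Word} {P : Path} (h : m.Den α b u P)
    (hp : okW n p = true) (hq : wd n p = k + b + q) (hr : okW (k + wd b u + q) r = true) :
    run (p ++ (sh k u ++ r)) (shP p.length k P) = p ++ (sh k (run u P) ++ r) :=
  (m.ev_lift h.word h.path hp hq hr).2.1

variable (m) in
/-- The tensorators of a model are those of the monoidal 2-category. -/
def TensOK : Prop := ∀ x y gap, m.cm (.tens x y gap)
  = C.tensorator (m.gm x) (C.tOM (pw C.toMonTwoCat m.A gap) (m.gm y))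

variable (ht : m.TensOK)
include ht

theorem den_slideL (y : Gen) (gap : ℕ) {b : ℕ} {u : Word} (hu : okW b u = true) :
    m.Den (C.tensorator (m.mor b u) (C.tOM (pw C.toMonTwoCat m.A gap) (m.gm y)))
      (b + gap + y.din) ((y, b + gap) :: u) (slideL y gap b u) ∧
    run ((y, b + gap) :: u) (slideL y gap b u) = u ++ [(y, wd b u + gap)] := by
  have Y := (DenM.gen m.hg y).left m.hg gap
  induction u generalizing b with
  | nil =>
    refine ⟨(Den.id (Y.left m.hg b)).cast ?_ ?_ ?_ rfl, rfl⟩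
    · exact C.tens_id_left _ _
    · omega
    · simp [sh]
  | cons l u ih =>
    obtain ⟨g, p⟩ := l
    simp only [okW, Bool.and_eq_true, Nat.ble_eq] at hu
    obtain ⟨i, j⟩ := ih hu.2
    obtain ⟨q, hq⟩ := Nat.exists_eq_add_of_le hu.1
    have eq : b - (p + g.din) = q := by omega
    have G : m.DenM (tM m.A p q (m.gm g)) b [(g, p)] := by
      have := (DenM.gen m.hg g).tens m.hg p q
      rw [hq]
      simpa [sh, Nat.add_assoc] using this
    have U : m.DenM (m.mor (b - g.din + g.dout) u) (b - g.din + g.dout) u := ⟨hu.2, rfl⟩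
    have a := (Den.atom (m := m) (.tens g y (q + gap))).left p
    have Ys := Y.src m.hg
    have Yt := Y.tgt m.hg
    have A1 : m.Den (C.tensorator (tM m.A p q (m.gm g)) (C.tOM (pw C.toMonTwoCat m.A gap) (m.gm y)))
        (b + gap + y.din) [(y, b + gap), (g, p)] [⟨.tens g y (q + gap), false, 0, p⟩] := by
      refine a.cast ?_ ?_ ?_ rfl
      · rw [ht, tM, C.tens_OM, C.tens_MO_OM, C.tOM_assoc, pw_add]
      · simp only [Name.bw]; omega
      · simp [sh, Name.dom]; omega
    have wy : wd (gap + y.din) (sh gap [(y, 0)]) = gap + y.dout := by simp [wd, sh]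
    have B1 := U.right m.hg (gap + y.dout)
    rw [← wy, ← Yt] at B1
    have w1 : wd (b + gap + y.din) [(y, b + gap), (g, p)]
        = b - g.din + g.dout + (gap + y.dout) := by
      simp only [wd]; omega
    rw [wy] at B1
    have A2 := A1.hcomp (Den.id (by rw [w1]; exact B1))
    have G1 := G.right m.hg (gap + y.din)
    rw [← Ys] at G1
    have w2 : wd (b + (gap + y.din)) [(g, p)] = b - g.din + g.dout + gap + y.din := by
      simp only [wd]; omega
    have A3 := (Den.id G1).hcomp (by rw [w2]; exact i)
    have r1 : ∀ J, run ([(y, b + gap), (g, p)] ++ u)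
        ([⟨.tens g y (q + gap), false, 0, p⟩] ++ shP J 0 [])
        = [(g, p)] ++ (y, b - g.din + g.dout + gap) :: u := by
      intro J
      simp [run, Step.app, Step.cod, Step.dom, sh, Name.cod, Name.dom, shP]
      omega
    have A4 := A2.vcomp (by
      rw [r1 _, Nat.add_assoc b gap y.din]
      exact A3)
    constructor
    · refine A4.cast ?_ rfl rfl ?_
      · rw [show m.mor b ((g, p) :: u) = C.comp (tM m.A p (b - (p + g.din)) (m.gm g))
          (m.mor (b - g.din + g.dout) u) from rfl, eq, C.tens_comp_left]
        rw [G.tgt m.hg, U.src m.hg]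
        rfl
      · simp [slideL, eq, shP, run]
    · have F := (Den.path A4)
      have := m.ev_lift (n := b + gap + y.din) (k := 0) (q := 0) (p := [(g,
        p)]) (r := []) i.word i.path
        (by simp [okW]; omega) (by simp only [wd]; omega) rfl
      simp only [slideL, eq, run, List.cons_append]
      have r2 : (Step.app ((y, b + gap) :: (g, p) :: u) ⟨.tens g y (q + gap), false, 0, p⟩)
          = [(g, p)] ++ (sh 0 ((y, b - g.din + g.dout + gap) :: u) ++ []) := by
        simpa [sh, run, shP] using r1 0
      rw [r2]
      have := this.2.1
      simp only [List.length_singleton] at this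
      rw [this, j]
      simp [sh, wd]

theorem den_slideR (x : Gen) (gap : ℕ) {b : ℕ} {u : Word} (hu : okW b u = true) :
    m.Den (C.tensorator (m.gm x) (C.tOM (pw C.toMonTwoCat m.A gap) (m.mor b u)))
      (x.din + (gap + b)) (sh (x.din + gap) u ++ [(x, 0)]) (slideR x gap u) ∧
    run (sh (x.din + gap) u ++ [(x, 0)]) (slideR x gap u) = (x, 0) :: sh (x.dout + gap) u := by
  have X := DenM.gen m.hg x
  have Xs := X.src m.hg
  have Xt := X.tgt m.hg
  have wx : wd x.din [(x, 0)] = x.dout := by simp [wd]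
  rw [wx] at Xt
  induction u generalizing b with
  | nil =>
    refine ⟨(Den.id (X.right m.hg (gap + b))).cast ?_ rfl rfl rfl, rfl⟩
    rw [show m.mor b [] = C.id₁ (pw C.toMonTwoCat m.A b) from rfl, C.tOM_id, C.tens_id_right,
      pw_add]
  | cons l u ih =>
    obtain ⟨g, p⟩ := l
    simp only [okW, Bool.and_eq_true, Nat.ble_eq] at hu
    obtain ⟨i, j⟩ := ih hu.2
    obtain ⟨q, hq⟩ := Nat.exists_eq_add_of_le hu.1
    have eq : b - (p + g.din) = q := by omega
    have G : m.DenM (tM m.A p q (m.gm g)) b [(g, p)] := by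
      have := (DenM.gen m.hg g).tens m.hg p q
      rw [hq]
      simpa [sh, Nat.add_assoc] using this
    have U : m.DenM (m.mor (b - g.din + g.dout) u) (b - g.din + g.dout) u := ⟨hu.2, rfl⟩
    have Gg := G.left m.hg gap
    have Ug := U.left m.hg gap
    have a := (Den.atom (m := m) (.tens x g (gap + p))).right q
    have A1 : m.Den (C.tensorator (m.gm x) (C.tOM (pw C.toMonTwoCat m.A gap)
          (tM m.A p q (m.gm g))))
        (x.din + (gap + b)) [(g, x.din + gap + p), (x, 0)]
        [⟨.tens x g (gap + p), false, 0, 0⟩] := by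
      refine a.cast ?_ ?_ ?_ rfl
      · rw [ht, tM, C.tOMO_assoc, C.tOMO_assoc, C.tens_MO, C.tOM_assoc, pw_add]
      · simp only [Name.bw]; omega
      · simp [Name.dom]; omega
    have Gx := Gg.left m.hg x.din
    rw [← Xs] at Gx
    have w1 : wd (x.din + (gap + b)) (sh x.din (sh gap [(g, p)]))
        = x.din + (gap + (b - g.din + g.dout)) := by
      simp only [sh, wd, List.map]; omega
    have A2 := (Den.id Gx).hcomp (by rw [w1]; exact i)
    have e1 : sh x.din (sh gap [(g, p)]) = [(g, x.din + gap + p)] := by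
      simp [sh]; omega
    have Ux := Ug.left m.hg x.dout
    rw [← Xt] at Ux
    have w2 : wd (x.din + (gap + b)) [(g, x.din + gap + p), (x, 0)]
        = x.dout + (gap + (b - g.din + g.dout)) := by
      simp only [wd]; omega
    have A3 := A1.hcomp (Den.id (by rw [w2]; exact Ux))
    have r0 := m.ev_lift (n := x.din + (gap + b)) (k := 0) (q := 0)
      (p := sh x.din (sh gap [(g, p)])) (r := []) i.word i.path
      (by simp [sh, okW]; omega) (by rw [w1]; omega) rfl
    have r1 := r0.2.1
    rw [j] at r1
    simp only [List.append_nil, show ∀ v, sh 0 v = v by simp [sh]] at r1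
    have A4 := A2.vcomp (Q := [⟨.tens x g (gap + p), false, 0, 0⟩]) (by
      refine A3.cast rfl rfl ?_ (by simp [shP])
      rw [List.nil_append, run, r1, e1]
      simp [sh, Nat.add_assoc])
    have ee : sh x.din (sh gap [(g, p)]) ++ (sh (x.din + gap) u ++ [(x, 0)])
        = sh (x.din + gap) ((g, p) :: u) ++ [(x, 0)] := by
      simp [sh, Nat.add_assoc]
    constructor
    · refine A4.cast ?_ rfl ee ?_
      · rw [show m.mor b ((g, p) :: u) = C.comp (tM m.A p (b - (p + g.din)) (m.gm g))
          (m.mor (b - g.din + g.dout) u) from rfl, eq, C.tOM_comp, C.tens_comp_right]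
        · rw [Gg.tgt m.hg, Ug.src m.hg]
          congr 1
          simp only [sh, wd, List.map]; omega
        · rw [G.tgt m.hg, U.src m.hg]; rfl
      · simp [slideR, shP, sh, run]
    · rw [slideR, run_append, ← ee]
      rw [e1] at r1 ⊢
      simp only [List.length_singleton] at r1
      rw [r1]
      simp [run, Step.app, Step.cod, Step.dom, sh, Name.cod, Name.dom]
      omega

/-- A 2-morphism commutes with sliding a generator past it on its right. -/
theorem slideL_natural (y : Gen) (gap : ℕ) {b : ℕ} {u : Word} {X : Path} (hu : okW b u = true)
    (hX : okP b u X = true) : m.Holds ⟨b + gap + y.din, (y, b + gap) :: u,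
      shP 1 0 X ++ slideL y gap b (run u X), slideL y gap b u ++ X⟩ := by
  have D : m.Den (m.ev b u X) b u X := ⟨hu, hX, rfl⟩
  have Y := (DenM.gen m.hg y).left m.hg gap
  have Ys := Y.src m.hg
  have Yt := Y.tgt m.hg
  have wy : wd (gap + y.din) (sh gap [(y, 0)]) = gap + y.dout := by simp [wd, sh]
  rw [wy] at Yt
  have Us := DenM.src m.hg (⟨hu, rfl⟩ : m.DenM (m.mor b u) b u)
  have Ut := DenM.tgt m.hg (⟨hu, rfl⟩ : m.DenM (m.mor b u) b u)
  obtain ⟨s, s'⟩ := den_slideL ht y gap hu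
  obtain ⟨t, t'⟩ := den_slideL ht y gap D.run_ok
  have eb : b + (gap + y.din) = b + gap + y.din := by omega
  have Yb := Y.left m.hg b
  rw [eb] at Yb
  have e1 : sh b (sh gap [(y, 0)]) = [(y, b + gap)] := by simp [sh]
  rw [e1] at Yb
  have w1 : wd (b + gap + y.din) [(y, b + gap)] = b + (gap + y.dout) := by simp [wd]; omega
  have L1 := (Den.id Yb).hcomp (by rw [w1]; exact D.right (gap + y.dout))
  have Dr := D.right (gap + y.dout)
  have r1 : run ([(y, b + gap)] ++ u) ([] ++ shP (run [(y, b + gap)] []).length 0 X)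
      = (y, b + gap) :: run u X := by
    have := (m.ev_lift (n := b + gap + y.din) (k := 0) (q := 0) (p := [(y, b + gap)]) (r := [])
      Dr.word Dr.path (by simp [okW]) (by rw [w1]; omega) rfl).2.1
    simpa [sh, run] using this
  have L2 := L1.vcomp (by rw [r1]; exact t)
  have wu : wd (b + gap + y.din) u = wd b u + (gap + y.din) := by
    have := (okW_sh hu 0 (gap + y.din)).2
    rw [Nat.zero_add, Nat.zero_add, eb] at this
    simpa [sh] using this
  have Yu := Y.left m.hg (wd b u)
  have R1 := (D.right (gap + y.din)).hcomp (Den.id (by rw [eb, wu]; exact Yu))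
  have R2 := s.vcomp (by
    rw [s']
    refine R1.cast rfl eb ?_ rfl
    simp [sh])
  have e := C.tens_nat_left (m.ev b u X) (C.tOM (pw C.toMonTwoCat m.A gap) (m.gm y))
  rw [D.src, D.tgt, Us, Ut, Yt, Ys] at e
  have r2 := (D.right (gap + y.din)).run_lift (n := b + gap + y.din) (k := 0) (q := 0) (p := [])
    (r := [(y, wd b u + gap)]) rfl (by simp [wd]; omega) (by
      rw [eb, wu]; exact (by simp [okW]; omega))
  have F := L2.holds R2 e (by
    rw [run_append, r1, t', run_append, List.singleton_append, s', D.run_wd]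
    simpa [sh, shP, run] using r2.symm)
  simpa [shP, run] using F

/-- A 2-morphism commutes with sliding a generator past it on its left. -/
theorem slideR_natural (x : Gen) (gap : ℕ) {b : ℕ} {u : Word} {X : Path} (hu : okW b u = true)
    (hX : okP b u X = true) : m.Holds ⟨x.din + (gap + b), sh (x.din + gap) u ++ [(x, 0)],
      shP 0 (x.din + gap) X ++ slideR x gap (run u X),
      slideR x gap u ++ shP 1 (x.dout + gap) X⟩ := by
  have D : m.Den (m.ev b u X) b u X := ⟨hu, hX, rfl⟩
  have G := DenM.gen m.hg x
  have Gs := G.src m.hg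
  have Gt := G.tgt m.hg
  have wx : wd x.din [(x, 0)] = x.dout := by simp [wd]
  rw [wx] at Gt
  obtain ⟨s, s'⟩ := den_slideR ht x gap hu
  obtain ⟨t, t'⟩ := den_slideR ht x gap D.run_ok
  have E := D.left gap
  have Es := DenM.src m.hg ((⟨hu, rfl⟩ : m.DenM (m.mor b u) b u).left m.hg gap)
  have Et := DenM.tgt m.hg ((⟨hu, rfl⟩ : m.DenM (m.mor b u) b u).left m.hg gap)
  have e := C.tens_nat_right (m.gm x) (C.tOC (pw C.toMonTwoCat m.A gap) (m.ev b u X))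
  rw [C.tOC_src, C.tOC_tgt, D.src, D.tgt, Es, Et, Gs, Gt] at e
  have wE : wd (x.din + (gap + b)) (sh x.din (sh gap u)) = x.din + wd (gap + b) (sh gap u) :=
    (okW_sh E.word x.din 0).2
  have wG : wd (gap + b) (sh gap u) = gap + wd b u := (okW_sh hu gap 0).2
  have L1 := (E.left x.din).hcomp (Den.id (by rw [wE]; exact G.right m.hg (wd (gap + b) (sh gap u))))
  have R1 := (Den.id (G.right m.hg (gap + b))).hcomp (v := sh x.dout (sh gap u))
    (Q := shP 0 x.dout (shP 0 gap X)) (by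
    refine (E.left x.dout).cast rfl ?_ rfl rfl
    simp [wd]; omega)
  have r1 := D.run_lift (n := x.din + (gap + b)) (k := x.din + gap) (q := 0) (p := [])
    (r := [(x, 0)]) rfl (by simp [wd]; omega) (by simp [okW]; omega)
  have r2 := D.run_lift (n := x.din + (gap + b)) (k := x.dout + gap) (q := 0) (p := [(x, 0)])
    (r := []) (by simp [okW]) (by simp [wd]; omega) rfl
  simp only [sh_sh, shP_shP, shP_nil, List.nil_append, List.length_nil, List.append_nil,
    List.length_singleton, List.singleton_append, run, Nat.add_zero, Nat.zero_add] at L1 R1 r1 r2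
  have L2 := L1.vcomp (by
    rw [r1]
    exact t)
  have R2 := s.vcomp (by
    rw [s']
    exact R1)
  exact L2.holds R2 e (by rw [run_append, run_append, r1, t', s', r2])

end Model

end Diagram

namespace DualsData

variable {C : DualsData}

attribute [local simp] TwoCat.id₁_src TwoCat.id₁_tgt TwoCat.id₂_src TwoCat.id₂_tgt TwoCat.comp_src
  TwoCat.comp_tgt TwoCat.vcomp_src TwoCat.vcomp_tgt TwoCat.hcomp_src TwoCat.hcomp_tgt
  DualsData.dMor_src DualsData.dMor_tgt DualsData.dCell_src DualsData.dCell_tgt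
  DualsData.iCell_src DualsData.iCell_tgt DualsData.eCell_src DualsData.eCell_tgt

/-- `α` is a 2-morphism from `f` to `g`, which are 1-morphisms from `X` to `Y`. -/
structure IsCell (C : DualsData) (α : C.Cell) (f g : C.Mor) (X Y : C.Obj) : Prop where
  src : C.src₂ α = f
  tgt : C.tgt₂ α = g
  src_src : C.src₁ f = X
  src_tgt : C.tgt₁ f = Y
  tgt_src : C.src₁ g = X
  tgt_tgt : C.tgt₁ g = Y

theorem IsCell.mk' (α : C.Cell) :
    C.IsCell α (C.src₂ α) (C.tgt₂ α) (C.src₁ (C.src₂ α)) (C.tgt₁ (C.src₂ α)) :=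
  ⟨rfl, rfl, rfl, rfl, (C.cell_src_src α).symm, (C.cell_tgt_tgt α).symm⟩

variable {α β : C.Cell} {f g h k : C.Mor} {X Y Z : C.Obj}

theorem hcomp_left (hα : C.IsCell α f g X Y) (hβ : C.IsCell β h k Y Z) :
    C.vcomp (C.hcomp α (C.id₂ h)) (C.hcomp (C.id₂ g) β) = C.hcomp α β := by
  obtain ⟨rfl, rfl, a3, a4, a5, a6⟩ := hα
  obtain ⟨rfl, rfl, b3, b4, b5, b6⟩ := hβ
  rw [← C.exchange, C.vcomp_id_right, C.vcomp_id_left] <;> simp [*]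

theorem hcomp_right (hα : C.IsCell α f g X Y) (hβ : C.IsCell β h k Y Z) :
    C.vcomp (C.hcomp (C.id₂ f) β) (C.hcomp α (C.id₂ k)) = C.hcomp α β := by
  obtain ⟨rfl, rfl, a3, a4, a5, a6⟩ := hα
  obtain ⟨rfl, rfl, b3, b4, b5, b6⟩ := hβ
  rw [← C.exchange, C.vcomp_id_right, C.vcomp_id_left] <;> simp [*]

theorem vcomp_left (hα : C.IsCell α f g X Y) (hβ : C.IsCell β g h X Y) (hk : C.tgt₁ k = X) :
    C.hcomp (C.id₂ k) (C.vcomp α β) = C.vcomp (C.hcomp (C.id₂ k) α) (C.hcomp (C.id₂ k) β) := by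
  obtain ⟨rfl, rfl, a3, a4, a5, a6⟩ := hα
  obtain ⟨b1, rfl, b3, b4, b5, b6⟩ := hβ
  have e := C.vcomp_id_left (C.id₂ k)
  rw [C.id₂_src] at e
  rw [← C.exchange, e] <;> simp [*]

theorem vcomp_right (hα : C.IsCell α f g X Y) (hβ : C.IsCell β g h X Y) (hk : C.src₁ k = Y) :
    C.hcomp (C.vcomp α β) (C.id₂ k) = C.vcomp (C.hcomp α (C.id₂ k)) (C.hcomp β (C.id₂ k)) := by
  obtain ⟨rfl, rfl, a3, a4, a5, a6⟩ := hα
  obtain ⟨b1, rfl, b3, b4, b5, b6⟩ := hβ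
  have e := C.vcomp_id_left (C.id₂ k)
  rw [C.id₂_src] at e
  rw [← C.exchange, e] <;> simp [*]

theorem IsCell.id (h1 : C.src₁ f = X) (h2 : C.tgt₁ f = Y) : C.IsCell (C.id₂ f) f f X Y := by
  constructor <;> simp [*]

theorem IsCell.vcomp (hα : C.IsCell α f g X Y) (hβ : C.IsCell β g h X Y) :
    C.IsCell (C.vcomp α β) f h X Y := by
  obtain ⟨a1, a2, a3, a4, a5, a6⟩ := hα
  obtain ⟨b1, b2, b3, b4, b5, b6⟩ := hβ
  constructor <;> simp [*]

theorem IsCell.hcomp (hα : C.IsCell α f g X Y) (hβ : C.IsCell β h k Y Z) :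
    C.IsCell (C.hcomp α β) (C.comp f h) (C.comp g k) X Z := by
  obtain ⟨a1, a2, a3, a4, a5, a6⟩ := hα
  obtain ⟨b1, b2, b3, b4, b5, b6⟩ := hβ
  constructor <;> simp [*]

theorem IsCell.unit (h1 : C.src₁ f = X) (h2 : C.tgt₁ f = Y) :
    C.IsCell (C.iCell f) (C.id₁ X) (C.comp f (C.dMor f)) X X := by
  constructor <;> simp [*]

theorem IsCell.counit (h1 : C.src₁ f = X) (h2 : C.tgt₁ f = Y) :
    C.IsCell (C.eCell f) (C.comp (C.dMor f) f) (C.id₁ Y) Y Y := by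
  constructor <;> simp [*]

theorem IsCell.dual (hα : C.IsCell α f g X Y) : C.IsCell (C.dCell α) g f X Y := by
  obtain ⟨a1, a2, a3, a4, a5, a6⟩ := hα
  constructor <;> simp [*]

theorem IsCell.cast {f' g' : C.Mor} (hα : C.IsCell α f g X Y) (hf : f = f') (hg : g = g') :
    C.IsCell α f' g' X Y := by
  subst hf hg
  exact hα

theorem vcomp_assoc' {γ : C.Cell} (hα : C.IsCell α f g X Y) (hβ : C.IsCell β g h X Y)
    (hγ : C.IsCell γ h k X Y) : C.vcomp (C.vcomp α β) γ = C.vcomp α (C.vcomp β γ) :=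
  C.vcomp_assoc _ _ _ (hα.tgt.trans hβ.src.symm) (hβ.tgt.trans hγ.src.symm)

theorem hcomp_assoc' {γ : C.Cell} {l l' : C.Mor} {V : C.Obj} (hα : C.IsCell α f g X Y)
    (hβ : C.IsCell β h k Y Z) (hγ : C.IsCell γ l l' Z V) :
    C.hcomp (C.hcomp α β) γ = C.hcomp α (C.hcomp β γ) := by
  refine C.hcomp_assoc _ _ _ ?_ ?_
  · rw [hα.src, hβ.src, hα.src_tgt, hβ.src_src]
  · rw [hβ.src, hγ.src, hβ.src_tgt, hγ.src_src]

theorem id_hcomp (hα : C.IsCell α f g X Y) : C.hcomp (C.id₂ (C.id₁ X)) α = α := by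
  have := C.hcomp_id_left α
  rwa [hα.src, hα.src_src] at this

theorem hcomp_id (hα : C.IsCell α f g X Y) : C.hcomp α (C.id₂ (C.id₁ Y)) = α := by
  have := C.hcomp_id_right α
  rwa [hα.src, hα.src_tgt] at this

theorem id_vcomp (hα : C.IsCell α f g X Y) : C.vcomp (C.id₂ f) α = α := by
  have := C.vcomp_id_left α
  rwa [hα.src] at this

theorem vcomp_id (hα : C.IsCell α f g X Y) : C.vcomp α (C.id₂ g) = α := by
  have := C.vcomp_id_right α
  rwa [hα.tgt] at this

theorem comp_id (hf : C.tgt₁ f = X) : C.comp f (C.id₁ X) = f := by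
  rw [← hf, C.comp_id_right]

theorem id_comp (hf : C.src₁ f = X) : C.comp (C.id₁ X) f = f := by
  rw [← hf, C.comp_id_left]

theorem IsCell.id_dual (h1 : C.src₁ f = X) (h2 : C.tgt₁ f = Y) :
    C.IsCell (C.id₂ (C.dMor f)) (C.dMor f) (C.dMor f) Y X :=
  .id ((C.dMor_src f).trans h2) ((C.dMor_tgt f).trans h1)

/-- The 2-morphism `i_f ⋅ (α f*)`. -/
def unitMate (C : DualsData) (α : C.Cell) : C.Cell :=
  C.vcomp (C.iCell (C.src₂ α)) (C.hcomp α (C.id₂ (C.dMor (C.src₂ α))))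

/-- The 2-morphism `(g* α) ⋅ e_g`. -/
def counitMate (C : DualsData) (α : C.Cell) : C.Cell :=
  C.vcomp (C.hcomp (C.id₂ (C.dMor (C.tgt₂ α))) α) (C.eCell (C.tgt₂ α))

theorem IsCell.unitMate (hα : C.IsCell α f g X Y) :
    C.IsCell (C.unitMate α) (C.id₁ X) (C.comp g (C.dMor f)) X X := by
  rw [DualsData.unitMate, hα.src]
  exact (IsCell.unit hα.src_src hα.src_tgt).vcomp (hα.hcomp (.id_dual hα.src_src hα.src_tgt))

theorem IsCell.counitMate (hα : C.IsCell α f g X Y) :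
    C.IsCell (C.counitMate α) (C.comp (C.dMor g) f) (C.id₁ Y) Y Y := by
  rw [DualsData.counitMate, hα.tgt]
  exact ((IsCell.id_dual hα.tgt_src hα.tgt_tgt).hcomp hα).vcomp (.counit hα.tgt_src hα.tgt_tgt)

theorem adj_eq_unitMate (hα : C.IsCell α f g X Y) :
    C.adj α = C.vcomp (C.hcomp (C.id₂ (C.dMor g)) (C.unitMate α))
      (C.hcomp (C.eCell g) (C.id₂ (C.dMor f))) := by
  have f' := IsCell.id_dual hα.src_src hα.src_tgt
  have g' := IsCell.id_dual hα.tgt_src hα.tgt_tgt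
  rw [unitMate, adj, hα.src, hα.tgt, vcomp_left (.unit hα.src_src hα.src_tgt) (hα.hcomp f')
    g'.src_tgt, hcomp_assoc' g' hα f']

theorem adj_eq_counitMate (hα : C.IsCell α f g X Y) :
    C.adj α = C.vcomp (C.hcomp (C.id₂ (C.dMor g)) (C.iCell f))
      (C.hcomp (C.counitMate α) (C.id₂ (C.dMor f))) := by
  have f' := IsCell.id_dual hα.src_src hα.src_tgt
  have g' := IsCell.id_dual hα.tgt_src hα.tgt_tgt
  have u := IsCell.unit hα.src_src hα.src_tgt
  have c := IsCell.counit hα.tgt_src hα.tgt_tgt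
  have x := (g'.hcomp hα).hcomp f'
  have e : C.comp (C.comp (C.dMor g) f) (C.dMor f) = C.comp (C.dMor g) (C.comp f (C.dMor f)) :=
    C.comp_assoc _ _ _ (g'.src_tgt.trans hα.src_src.symm) (hα.src_tgt.trans f'.src_src.symm)
  rw [counitMate, adj, hα.src, hα.tgt, vcomp_right (g'.hcomp hα) c f'.src_src,
    vcomp_assoc' (g'.hcomp u) (x.cast e rfl) (c.hcomp f')]

theorem IsCell.adj (hα : C.IsCell α f g X Y) :
    C.IsCell (C.adj α) (C.dMor g) (C.dMor f) Y X := by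
  have f' := IsCell.id_dual hα.src_src hα.src_tgt
  have g' := IsCell.id_dual hα.tgt_src hα.tgt_tgt
  have c := IsCell.counit hα.tgt_src hα.tgt_tgt
  rw [adj_eq_unitMate hα]
  refine IsCell.cast (((g'.hcomp hα.unitMate).cast rfl ?_).vcomp (c.hcomp f')) (comp_id g'.src_tgt)
    (id_comp f'.src_src)
  exact (C.comp_assoc _ _ _ (g'.src_tgt.trans hα.tgt_src.symm)
    (hα.tgt_tgt.trans f'.src_src.symm)).symm

variable (hC : DualsLaws C)
include hC

theorem unitMate_adj (hα : C.IsCell α f g X Y) :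
    C.vcomp (C.iCell g) (C.hcomp (C.id₂ g) (C.adj α)) = C.unitMate α := by
  obtain ⟨-, -, sf, tf, sg, tg⟩ := id hα
  have f' := IsCell.id_dual sf tf
  have g' := IsCell.id_dual sg tg
  have u := IsCell.unit sg tg
  have c := IsCell.counit sg tg
  have gi := IsCell.id sg tg
  have m := hα.unitMate
  have fi := f'.src_src
  have a : C.comp (C.dMor g) (C.comp g (C.dMor f)) = C.comp (C.comp (C.dMor g) g) (C.dMor f) := by
    simp [C.comp_assoc, *]
  have a' : C.comp (C.comp g (C.dMor g)) (C.comp g (C.dMor f))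
      = C.comp g (C.comp (C.comp (C.dMor g) g) (C.dMor f)) := by
    clear a
    simp [C.comp_assoc, *]
  have a'' : C.comp (C.comp g (C.dMor g)) g = C.comp g (C.comp (C.dMor g) g) := by
    clear a a'
    simp [C.comp_assoc, *]
  have t := hC.triangle₁ g
  have uf := u.hcomp (IsCell.id m.tgt_src m.tgt_tgt)
  have cf := gi.hcomp (c.hcomp f')
  have w := (IsCell.id u.tgt_src u.tgt_tgt).hcomp m
  rw [adj_eq_unitMate hα, vcomp_left ((g'.hcomp m).cast (comp_id g'.src_tgt) a) (c.hcomp f') tg,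
    ← hcomp_assoc' gi g' m, C.hcomp_id₂ _ _ (tg.trans g'.src_src.symm),
    ← vcomp_assoc' u (w.cast (comp_id u.tgt_tgt) a') cf]
  have e : C.vcomp (C.iCell g) (C.hcomp (C.id₂ (C.comp g (C.dMor g))) (C.unitMate α))
      = C.vcomp (C.unitMate α) (C.hcomp (C.iCell g) (C.id₂ (C.comp g (C.dMor f)))) := by
    have l := hcomp_left u m
    have r := hcomp_right u m
    rw [hcomp_id u] at l
    rw [id_hcomp m] at r
    rw [l, r]
  rw [e, vcomp_assoc' m (uf.cast (id_comp m.tgt_src) a') cf, ← C.hcomp_id₂ _ _ (tg.trans fi.symm),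
    ← hcomp_assoc' u gi f', ← hcomp_assoc' gi c f',
    ← vcomp_right ((u.hcomp gi).cast (id_comp sg) a'') (gi.hcomp c) fi, t,
    C.hcomp_id₂ _ _ (tg.trans fi.symm), vcomp_id m]

theorem eq_adj (hα : C.IsCell α f g X Y) (hβ : C.IsCell β (C.dMor g) (C.dMor f) Y X)
    (e : C.vcomp (C.iCell g) (C.hcomp (C.id₂ g) β) = C.unitMate α) : β = C.adj α := by
  obtain ⟨-, -, sf, tf, sg, tg⟩ := id hα
  have f' := IsCell.id_dual sf tf
  have g' := IsCell.id_dual sg tg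
  have u := IsCell.unit sg tg
  have c := IsCell.counit sg tg
  have gi := IsCell.id sg tg
  have a : C.comp (C.dMor g) (C.comp g (C.dMor f)) = C.comp (C.comp (C.dMor g) g) (C.dMor f) := by
    simp [C.comp_assoc, *]
  have a' : C.comp (C.dMor g) (C.comp g (C.dMor g)) = C.comp (C.comp (C.dMor g) g) (C.dMor g) := by
    clear a
    simp [C.comp_assoc, *]
  have t := hC.triangle₂ g
  rw [adj_eq_unitMate hα, ← e, vcomp_left u (gi.hcomp hβ) g'.src_tgt,
    vcomp_assoc' ((g'.hcomp u).cast rfl a') ((g'.hcomp (gi.hcomp hβ)).cast a' a) (c.hcomp f'),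
    ← hcomp_assoc' g' gi hβ, C.hcomp_id₂ _ _ (g'.src_tgt.trans sg.symm), hcomp_right c hβ,
    ← hcomp_left c hβ, ← vcomp_assoc' ((g'.hcomp u).cast (comp_id g'.src_tgt) a')
      ((c.hcomp g').cast rfl (id_comp g'.src_src)) ((((IsCell.id (C.id₁_src Y) (C.id₁_tgt Y)).hcomp hβ)).cast (id_comp hβ.src_src) rfl),
    t, id_hcomp hβ, id_vcomp hβ]

theorem counitMate_adj (hα : C.IsCell α f g X Y) :
    C.vcomp (C.hcomp (C.adj α) (C.id₂ f)) (C.eCell f) = C.counitMate α := by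
  obtain ⟨-, -, sf, tf, sg, tg⟩ := id hα
  have f' := IsCell.id_dual sf tf
  have g' := IsCell.id_dual sg tg
  have u := IsCell.unit sf tf
  have c := IsCell.counit sf tf
  have fi := IsCell.id sf tf
  have n := hα.counitMate
  have gi := g'.src_tgt
  have a : C.comp (C.dMor g) (C.comp f (C.dMor f)) = C.comp (C.comp (C.dMor g) f) (C.dMor f) := by
    simp [C.comp_assoc, *]
  have a' : C.comp (C.comp (C.dMor g) (C.comp f (C.dMor f))) f
      = C.comp (C.comp (C.dMor g) f) (C.comp (C.dMor f) f) := by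
    clear a
    simp [C.comp_assoc, *]
  have a'' : C.comp (C.comp f (C.dMor f)) f = C.comp f (C.comp (C.dMor f) f) := by
    clear a a'
    simp [C.comp_assoc, *]
  have a3 : C.comp (C.dMor g) (C.comp (C.comp f (C.dMor f)) f)
      = C.comp (C.comp (C.dMor g) f) (C.comp (C.dMor f) f) := by
    clear a a' a''
    simp [C.comp_assoc, *]
  have t := hC.triangle₁ f
  have ni := IsCell.id n.src_src n.src_tgt
  have e : C.vcomp (C.hcomp (C.counitMate α) (C.id₂ (C.comp (C.dMor f) f))) (C.eCell f)
      = C.vcomp (C.hcomp (C.id₂ (C.comp (C.dMor g) f)) (C.eCell f)) (C.counitMate α) := by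
    have l := hcomp_left n c
    have r := hcomp_right n c
    rw [id_hcomp c] at l
    rw [hcomp_id n] at r
    rw [l, r]
  have y := (n.hcomp f').hcomp fi
  have z := g'.hcomp (fi.hcomp c)
  rw [adj_eq_counitMate hα, vcomp_right ((g'.hcomp u).cast rfl a) (n.hcomp f') sf,
    vcomp_assoc' (((g'.hcomp u).hcomp fi).cast rfl (congrArg (C.comp · f) a))
      (y.cast rfl (by rw [id_comp f'.src_src])) c,
    hcomp_assoc' n f' fi, C.hcomp_id₂ _ _ (f'.src_tgt.trans sf.symm), e,
    ← vcomp_assoc' (((g'.hcomp u).hcomp fi).cast rfl a') (ni.hcomp c)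
      (n.cast (comp_id n.src_tgt).symm rfl),
    ← C.hcomp_id₂ _ _ (gi.trans sf.symm), hcomp_assoc' g' fi c, hcomp_assoc' g' u fi,
    ← vcomp_left (u.hcomp fi) ((fi.hcomp c).cast a''.symm rfl) gi, t,
    C.hcomp_id₂ _ _ (gi.trans sf.symm), id_vcomp n]

theorem adj_adj (hα : C.IsCell α f g X Y) : C.adj (C.adj α) = α := by
  have d := hα.dual
  have e := counitMate_adj hC d
  symm
  refine eq_adj hC hα.adj ?_ ?_
  · rw [hC.dMor_invol, hC.dMor_invol]
    exact hα
  obtain ⟨-, -, sf, tf, sg, tg⟩ := id hα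
  have f' := IsCell.id_dual sf tf
  have g' := IsCell.id_dual sg tg
  have gi := IsCell.id sg tg
  have cf := IsCell.counit sf tf
  have cg := IsCell.counit sg tg
  have := congrArg C.dCell e
  rw [counitMate, d.tgt, hC.dCell_vcomp, hC.dCell_vcomp, hC.dCell_hcomp, hC.dCell_hcomp,
    hC.dCell_id,
    hC.dCell_id, hC.adj_star, hC.dCell_invol, ← hC.iCell_dual, ← hC.iCell_dual] at this
  · rw [unitMate, hα.adj.src, ← this, hC.dMor_invol]
  · rw [C.id₂_src, d.src, f'.src_tgt, sg]
  · rw [C.id₂_src, d.adj.src, d.adj.src_tgt, sg]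
  · rw [(f'.hcomp d).tgt, cf.src]
  · rw [(d.adj.hcomp gi).tgt, cg.src]

theorem adj_vcomp (hα : C.IsCell α f g X Y) (hβ : C.IsCell β g h X Y) :
    C.adj (C.vcomp α β) = C.vcomp (C.adj β) (C.adj α) := by
  symm
  refine eq_adj hC (hα.vcomp hβ) (hβ.adj.vcomp hα.adj) ?_
  obtain ⟨-, -, sf, tf, sg, tg⟩ := id hα
  have sh := hβ.tgt_src
  have th := hβ.tgt_tgt
  have f' := IsCell.id_dual sf tf
  have g' := IsCell.id_dual sg tg
  have hi := IsCell.id sh th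
  have gi := IsCell.id sg tg
  have uh := IsCell.unit sh th
  have ug := IsCell.unit sg tg
  have uf := IsCell.unit sf tf
  have eα := unitMate_adj hC hα
  have eβ := unitMate_adj hC hβ
  rw [unitMate, hα.src] at eα
  rw [unitMate, hβ.src] at eβ
  rw [unitMate, (hα.vcomp hβ).src, vcomp_left hβ.adj hα.adj th,
    ← vcomp_assoc' uh (hi.hcomp hβ.adj) (hi.hcomp hα.adj), eβ,
    vcomp_assoc' ug (hβ.hcomp g') (hi.hcomp hα.adj), hcomp_left hβ hα.adj, ← hcomp_right hβ hα.adj,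
    ← vcomp_assoc' ug (gi.hcomp hα.adj) (hβ.hcomp f'), eα, vcomp_right hα hβ f'.src_src,
    vcomp_assoc' uf (hα.hcomp f') (hβ.hcomp f')]

theorem adj_id (hf : C.src₁ f = X) (hf' : C.tgt₁ f = Y) :
    C.adj (C.id₂ f) = C.id₂ (C.dMor f) := by
  symm
  refine eq_adj hC (.id hf hf') (.id_dual hf hf') ?_
  rw [unitMate, C.id₂_src]

theorem adj_hcomp (hα : C.IsCell α f g X Y) (hβ : C.IsCell β h k Y Z) :
    C.adj (C.hcomp α β) = C.hcomp (C.adj β) (C.adj α) := by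
  symm
  have tf := hα.src_tgt
  have tg := hα.tgt_tgt
  have sh := hβ.src_src
  have sk := hβ.tgt_src
  have d1 := hC.dMor_comp f h (tf.trans sh.symm)
  have d2 := hC.dMor_comp g k (tg.trans sk.symm)
  refine eq_adj hC (hα.hcomp hβ) (by rw [d1, d2]; exact hβ.adj.hcomp hα.adj) ?_
  have sf := hα.src_src
  have sg := hα.tgt_src
  have th := hβ.src_tgt
  have tk := hβ.tgt_tgt
  have fi := IsCell.id sf tf
  have gi := IsCell.id sg tg
  have ki := IsCell.id sk tk
  have f' := IsCell.id_dual sf tf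
  have g' := IsCell.id_dual sg tg
  have h' := IsCell.id_dual sh th
  have k' := IsCell.id_dual sk tk
  have uf := IsCell.unit sf tf
  have ug := IsCell.unit sg tg
  have uh := IsCell.unit sh th
  have uk := IsCell.unit sk tk
  have m := hβ.unitMate
  have a := hα.adj
  have b := hβ.adj
  have eα := unitMate_adj hC hα
  have eβ := unitMate_adj hC hβ
  have mα := hα.unitMate
  rw [unitMate, hα.src] at eα mα
  have c1 {q : C.Mor} (q1 : C.src₁ q = Y) : C.comp (C.comp g (C.id₁ Y)) q = C.comp g q := by
    rw [comp_id tg]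
  have c2 : C.comp (C.comp g (C.comp k (C.dMor k))) (C.dMor g)
      = C.comp (C.comp g k) (C.comp (C.dMor k) (C.dMor g)) := by
    have := g'.src_src; have := k'.src_src; have := k'.src_tgt
    simp [C.comp_assoc, *]
  have step₁ : C.vcomp (C.hcomp (C.hcomp (C.id₂ g) (C.iCell k)) (C.id₂ (C.dMor g)))
      (C.hcomp (C.id₂ (C.comp g k)) (C.hcomp (C.adj β) (C.adj α)))
      = C.hcomp (C.id₂ g) (C.hcomp (C.unitMate β) (C.adj α)) := by
    rw [← eβ, ← C.hcomp_id₂ _ _ (tg.trans sk.symm), hcomp_assoc' gi ki (b.hcomp a),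
      ← hcomp_assoc' ki b a, hcomp_assoc' gi uk g',
      ← vcomp_left ((uk.hcomp g').cast (id_comp g'.src_src) rfl) ((ki.hcomp b).hcomp a) tg]
    congr 1
    have l := hcomp_right uk a
    rw [id_hcomp a] at l
    have e : C.vcomp (C.hcomp (C.iCell k) (C.id₂ (C.dMor g))) (C.hcomp (C.hcomp (C.id₂ k) (C.adj β))
        (C.adj α)) = C.hcomp (C.vcomp (C.iCell k) (C.hcomp (C.id₂ k) (C.adj β)))
          (C.vcomp (C.id₂ (C.dMor g)) (C.adj α)) := by
      rw [C.exchange]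
      · rw [uk.tgt, (ki.hcomp b).src]
      · rw [C.id₂_tgt, a.src]
      · rw [uk.src, uk.src_tgt, C.id₂_src, g'.src_src]
    rw [e, id_vcomp a]
  have step₂ : C.hcomp (C.id₂ g) (C.hcomp (C.unitMate β) (C.adj α))
      = C.vcomp (C.hcomp (C.id₂ g) (C.adj α))
        (C.hcomp (C.id₂ g) (C.hcomp (C.unitMate β) (C.id₂ (C.dMor f)))) := by
    rw [← hcomp_right m a, id_hcomp a,
      vcomp_left a ((m.hcomp f').cast (id_comp f'.src_src) rfl) tg]
  have step₃ : C.vcomp (C.hcomp α (C.id₂ (C.dMor f)))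
        (C.hcomp (C.id₂ g) (C.hcomp (C.unitMate β) (C.id₂ (C.dMor f))))
      = C.hcomp α (C.hcomp (C.unitMate β) (C.id₂ (C.dMor f))) :=
    hcomp_left hα ((m.hcomp f').cast (id_comp f'.src_src) rfl)
  have step₄ : C.vcomp (C.hcomp (C.hcomp (C.id₂ f) (C.iCell h)) (C.id₂ (C.dMor f)))
        (C.hcomp (C.hcomp α β) (C.id₂ (C.comp (C.dMor h) (C.dMor f))))
      = C.hcomp α (C.hcomp (C.unitMate β) (C.id₂ (C.dMor f))) := by
    rw [← C.hcomp_id₂ _ _ (h'.src_tgt.trans f'.src_src.symm), hcomp_assoc' fi uh f',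
      hcomp_assoc' hα hβ (h'.hcomp f'), ← hcomp_assoc' hβ h' f', ← C.exchange, id_vcomp hα,
      ← vcomp_right uh (hβ.hcomp h') f'.src_src, unitMate, hβ.src]
    · rw [C.id₂_tgt, hα.src]
    · rw [(uh.hcomp f').tgt, ((hβ.hcomp h').hcomp f').src]
    · rw [C.id₂_src, (uh.hcomp f').src, (uh.hcomp f').src_src, tf]
  have t : C.IsCell (C.hcomp (C.id₂ g) (C.hcomp (C.unitMate β) (C.id₂ (C.dMor f))))
      (C.comp g (C.dMor f)) (C.comp g (C.comp (C.comp k (C.dMor h)) (C.dMor f))) X X :=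
    (gi.hcomp (m.hcomp f')).cast (by rw [id_comp f'.src_src]) rfl
  rw [unitMate, (hα.hcomp hβ).src, hC.iCell_comp _ _ (tg.trans sk.symm),
    hC.iCell_comp _ _ (tf.trans sh.symm), d1,
    vcomp_assoc' ug (((gi.hcomp uk).hcomp g').cast (c1 g'.src_src) c2)
      ((IsCell.id (gi.hcomp ki).src_src (gi.hcomp ki).src_tgt).hcomp (b.hcomp a)),
    step₁, step₂, ← vcomp_assoc' ug (gi.hcomp a) t, eα, vcomp_assoc' uf (hα.hcomp f') t, step₃,
    ← step₄]
  have c3 : C.comp (C.comp f (C.comp h (C.dMor h))) (C.dMor f)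
      = C.comp (C.comp f h) (C.comp (C.dMor h) (C.dMor f)) := by
    have := f'.src_src; have := h'.src_src; have := h'.src_tgt
    simp [C.comp_assoc, *]
  rw [← C.hcomp_id₂ _ _ (h'.src_tgt.trans f'.src_src.symm),
    vcomp_assoc' uf (((fi.hcomp uh).hcomp f').cast (by rw [comp_id tf]) c3)
    ((hα.hcomp hβ).hcomp (h'.hcomp f'))]

theorem iCell_id (X : C.Obj) : C.iCell (C.id₁ X) = C.id₂ (C.id₁ X) := by
  have s := C.id₁_src X
  have t := C.id₁_tgt X
  have hh : C.comp (C.id₁ X) (C.id₁ X) = C.id₁ X := id_comp s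
  have u := IsCell.unit s t
  have c := IsCell.counit s t
  have i := IsCell.id s t
  rw [hC.dMor_id, hh] at u c
  have e := hC.iCell_comp _ _ (t.trans s.symm)
  have r := hC.triangle₁ (C.id₁ X)
  rw [hh, hC.dMor_id, id_hcomp u, hcomp_id u] at e
  rw [hcomp_id u, id_hcomp c] at r
  have := vcomp_assoc' u u c
  rwa [← e, r, vcomp_id u, eq_comm] at this

theorem adj_iCell (f : C.Mor) : C.adj (C.iCell f) = C.dCell (C.iCell f) := by
  obtain ⟨X, sf⟩ : ∃ X, C.src₁ f = X := ⟨_, rfl⟩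
  obtain ⟨Y, tf⟩ : ∃ Y, C.tgt₁ f = Y := ⟨_, rfl⟩
  have fi := IsCell.id sf tf
  have f' := IsCell.id_dual sf tf
  have u := IsCell.unit sf tf
  have c := IsCell.counit sf tf
  have s := f'.src_src
  have t := f'.src_tgt
  have d : C.dMor (C.comp f (C.dMor f)) = C.comp f (C.dMor f) := by
    rw [hC.dMor_comp _ _ (tf.trans s.symm), hC.dMor_invol]
  symm
  refine eq_adj hC u (u.dual.cast d.symm (hC.dMor_id X).symm) ?_
  have r := congrArg C.dCell (hC.triangle₂ f)
  have a : C.comp (C.comp f (C.dMor f)) (C.comp f (C.dMor f))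
      = C.comp (C.comp f (C.comp (C.dMor f) f)) (C.dMor f) := by
    simp [C.comp_assoc, *]
  have a' : C.comp (C.comp (C.dMor f) f) (C.dMor f) = C.comp (C.dMor f) (C.comp f (C.dMor f)) := by
    simp [C.comp_assoc, *]
  rw [hC.dCell_vcomp, hC.dCell_hcomp, hC.dCell_hcomp, hC.dCell_id] at r
  · rw [unitMate, u.src, iCell_id hC, hC.dMor_id, hcomp_id u, id_vcomp u,
      hC.iCell_comp _ _ (tf.trans s.symm), hC.iCell_dual,
      vcomp_assoc' u (((fi.hcomp c.dual).hcomp f').cast (by rw [comp_id tf]) a.symm)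
        ((IsCell.id u.tgt_src u.tgt_tgt).hcomp u.dual),
      hcomp_assoc' fi c.dual f', ← C.hcomp_id₂ _ _ (tf.trans s.symm), hcomp_assoc' fi f' u.dual,
      ← vcomp_left ((c.dual.hcomp f').cast rfl a') (f'.hcomp u.dual) tf, r,
      C.hcomp_id₂ _ _ (tf.trans s.symm), vcomp_id u]
  · rw [C.id₂_src, t, u.src, u.src_src]
  · rw [c.src, c.src_tgt, C.id₂_src, s]
  · rw [(f'.hcomp u).tgt, (c.hcomp f').src, a']

theorem adj_eCell (f : C.Mor) : C.adj (C.eCell f) = C.dCell (C.eCell f) := by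
  have := adj_iCell hC (C.dMor f)
  rw [hC.iCell_dual, ← hC.adj_star] at this
  have := congrArg C.dCell this
  rwa [hC.dCell_invol, hC.dCell_invol, ← hC.dCell_invol (C.eCell f), hC.dCell_invol] at this

omit hC in
theorem adj_typing (hα : C.IsCell α f g X Y) :
    ∃ p q r, C.IsCell (C.hcomp (C.id₂ (C.dMor g)) (C.iCell f)) (C.dMor g) p Y X ∧
      C.IsCell (C.hcomp (C.hcomp (C.id₂ (C.dMor g)) α) (C.id₂ (C.dMor f))) p q Y X ∧
      C.IsCell (C.hcomp (C.eCell g) (C.id₂ (C.dMor f))) q r Y X := by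
  obtain ⟨-, -, sf, tf, sg, tg⟩ := id hα
  have f' := IsCell.id_dual sf tf
  have g' := IsCell.id_dual sg tg
  have u := IsCell.unit sf tf
  have c := IsCell.counit sg tg
  have e : C.comp (C.dMor g) (C.comp f (C.dMor f)) = C.comp (C.comp (C.dMor g) f) (C.dMor f) :=
    (C.comp_assoc _ _ _ (g'.src_tgt.trans sf.symm) (tf.trans f'.src_src.symm)).symm
  exact ⟨_, _, _, (g'.hcomp u).cast (comp_id g'.src_tgt) e, (g'.hcomp hα).hcomp f', c.hcomp f'⟩

theorem adj_tOC (B : C.Obj) (α : C.Cell) : C.adj (C.tOC B α) = C.tOC B (C.adj α) := by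
  obtain ⟨p, q, r, h1, h2, h3⟩ := adj_typing (IsCell.mk' α)
  have e1 := C.cell_src_src α
  have e2 := C.cell_tgt_tgt α
  rw [adj, adj, C.tOC_src, C.tOC_tgt, hC.iCell_tOM, hC.eCell_tOM, hC.dMor_tOM, hC.dMor_tOM,
    C.tOC_vcomp _ _ _ ((h1.vcomp h2).tgt.trans h3.src.symm),
    C.tOC_vcomp _ _ _ (h1.tgt.trans h2.src.symm), C.tOC_hcomp, C.tOC_hcomp, C.tOC_hcomp,
    C.tOC_hcomp, C.tOC_id, C.tOC_id] <;> simp [*]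

theorem adj_tCO (B : C.Obj) (α : C.Cell) : C.adj (C.tCO α B) = C.tCO (C.adj α) B := by
  obtain ⟨p, q, r, h1, h2, h3⟩ := adj_typing (IsCell.mk' α)
  have e1 := C.cell_src_src α
  have e2 := C.cell_tgt_tgt α
  rw [adj, adj, C.tCO_src, C.tCO_tgt, hC.iCell_tMO, hC.eCell_tMO, hC.dMor_tMO, hC.dMor_tMO,
    C.tCO_vcomp _ _ _ ((h1.vcomp h2).tgt.trans h3.src.symm),
    C.tCO_vcomp _ _ _ (h1.tgt.trans h2.src.symm), C.tCO_hcomp, C.tCO_hcomp, C.tCO_hcomp,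
    C.tCO_hcomp, C.tCO_id, C.tCO_id] <;> simp [*]

end DualsData

namespace Diagram

open Gen Name

/-- A self-dual object with a candidate for a writhing. -/
structure Setup where
  C : BMWDData
  hC : IsBMWD C
  A : C.Obj
  self : C.dObj A = A
  W : C.Cell
  W_src : C.src₂ W = C.iObj A
  W_tgt : C.tgt₂ W = C.comp (C.iObj A) (C.braid A A)

namespace Setup

variable (S : Setup)

abbrev D : DualsData := S.C.toDualsData
abbrev M : MonTwoCat := S.C.toMonTwoCat

theorem eObj_eq : S.C.eObj S.A = S.C.dMor (S.C.iObj S.A) := by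
  have := S.hC.duals.eObj_dual S.A
  rwa [S.self] at this

theorem pw_one : pw S.M S.A 1 = S.A := S.C.tOO_unit_right S.A

theorem pw_two : pw S.M S.A 2 = S.C.tOO S.A S.A := by
  rw [pw, pw_one]

theorem pw_three : pw S.M S.A 3 = S.C.tOO S.A (S.C.tOO S.A S.A) := by
  rw [pw, pw_two]

theorem pw_four : pw S.M S.A 4 = S.C.tOO S.A (S.C.tOO S.A (S.C.tOO S.A S.A)) := by
  rw [pw, pw_three]

/-- The 1-morphisms of the generators. -/
def gm : Gen → S.C.Mor
  | cup => S.C.iObj S.A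
  | cap => S.C.eObj S.A
  | cross => S.C.braid S.A S.A
  | uncross => S.C.dMor (S.C.braid S.A S.A)
  | over₂ => S.C.braid S.A (S.C.tOO S.A S.A)
  | over₃ => S.C.braid S.A (S.C.tOO S.A (S.C.tOO S.A S.A))
  | under₂ => S.C.braid (S.C.tOO S.A S.A) S.A
  | under₃ => S.C.braid (S.C.tOO S.A (S.C.tOO S.A S.A)) S.A

theorem goodGen : GoodGen (M := S.M) S.A S.gm := by
  have a := S.hC.braid_src
  have b := S.hC.braid_tgt
  have s := S.self
  intro g
  cases g <;>
    simp [gm, Gen.din, Gen.dout, pw_two, pw_three, pw_four, a, b, s, S.C.iObj_src,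
      S.C.iObj_tgt, S.C.eObj_src, S.C.eObj_tgt, S.C.dMor_src, S.C.dMor_tgt, S.C.tOO_assoc] <;> rfl

/-- The 2-morphisms of the basic names. -/
def base : Name → S.C.Cell
  | tri => S.C.tri S.A
  | triAdj => S.C.adjC (S.C.tri S.A)
  | unitCup => S.C.iCell (S.C.iObj S.A)
  | counitCup => S.C.eCell (S.C.iObj S.A)
  | unitCross => S.C.iCell (S.C.braid S.A S.A)
  | counitCross => S.C.eCell (S.C.braid S.A S.A)
  | tens x y gap => S.C.tensorator (S.gm x) (S.C.tOM (pw S.M S.A gap) (S.gm y))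
  | hex₁ => S.C.Rt1 S.A S.A S.A
  | hex₂ => S.C.Rt2 S.A S.A S.A
  | natCap => S.C.braidMorR S.A (S.C.eObj S.A)
  | natCup => S.C.braidMorL (S.C.iObj S.A) S.A
  | hex₁l => S.C.Rt1 S.A S.A (S.C.tOO S.A S.A)
  | hex₁r => S.C.Rt1 S.A (S.C.tOO S.A S.A) S.A
  | hex₂l => S.C.Rt2 S.A (S.C.tOO S.A S.A) S.A
  | hex₂r => S.C.Rt2 (S.C.tOO S.A S.A) S.A S.A
  | natCapL => S.C.braidMorR S.A (S.C.tMO (S.C.eObj S.A) S.A)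
  | natCapR => S.C.braidMorR S.A (S.C.tOM S.A (S.C.eObj S.A))
  | natCupL => S.C.braidMorL (S.C.tMO (S.C.iObj S.A) S.A) S.A
  | natCupR => S.C.braidMorL (S.C.tOM S.A (S.C.iObj S.A)) S.A
  | _ => S.W

abbrev DM (f : S.C.Mor) (n : ℕ) (w : Word) : Prop := DenM (M := S.M) S.A S.gm f n w

theorem dm (x : Gen) : S.DM (S.gm x) x.din [(x, 0)] := .gen S.goodGen x

variable {S} in
theorem _root_.Diagram.DenM.one_left {f : S.C.Mor} {n : ℕ} {w : Word} (h : S.DM f n w) :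
    S.DM (S.C.tOM S.A f) (1 + n) (sh 1 w) := by
  have := h.left S.goodGen 1
  rwa [pw_one] at this

variable {S} in
theorem _root_.Diagram.DenM.one_right {f : S.C.Mor} {n : ℕ} {w : Word} (h : S.DM f n w) :
    S.DM (S.C.tMO f S.A) (n + 1) w := by
  have := h.right S.goodGen 1
  rwa [pw_one] at this

variable {S} in
theorem _root_.Diagram.DenM.two_left {f : S.C.Mor} {n : ℕ} {w : Word} (h : S.DM f n w) :
    S.DM (S.C.tOM (S.C.tOO S.A S.A) f) (2 + n) (sh 2 w) := by
  have := h.left S.goodGen 2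
  rwa [pw_two] at this

variable {S} in
theorem _root_.Diagram.DenM.two_right {f : S.C.Mor} {n : ℕ} {w : Word} (h : S.DM f n w) :
    S.DM (S.C.tMO f (S.C.tOO S.A S.A)) (n + 2) w := by
  have := h.right S.goodGen 2
  rwa [pw_two] at this

/-- `x` is one of the basic names. -/
def _root_.Diagram.Name.basic : Name → Bool
  | saddleCap | saddleCup | nu | foldUp | foldUpAdj | foldDown | foldDownAdj
  | corner₁ | corner₂ | corner₃ | corner₄ | bendA | bendB => false
  | _ => true

theorem goodAt_base (x : Name) (hx : x.basic = true) : GoodAt S.A S.gm S.base x := by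
  have g := S.goodGen
  have cup' : S.DM (S.C.iObj S.A) 0 [(cup, 0)] := S.dm cup
  have cap' : S.DM (S.C.eObj S.A) 2 [(cap, 0)] := S.dm cap
  have R : S.DM (S.C.braid S.A S.A) 2 [(cross, 0)] := S.dm cross
  have R' : S.DM (S.C.dMor (S.C.braid S.A S.A)) 2 [(uncross, 0)] := S.dm uncross
  have Q : S.DM _ 3 [(over₂, 0)] := S.dm over₂
  have P : S.DM _ 4 [(over₃, 0)] := S.dm over₃
  have Q' : S.DM _ 3 [(under₂, 0)] := S.dm under₂
  have P' : S.DM _ 4 [(under₃, 0)] := S.dm under₃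
  have I (n : ℕ) := DenM.id (M := S.M) (A := S.A) (gm := S.gm) n
  have I1 : S.DM (S.C.id₁ S.A) 1 [] := by have := I 1; rwa [pw_one] at this
  have I2 : S.DM (S.C.id₁ (S.C.tOO S.A S.A)) 2 [] := by have := I 2; rwa [pw_two] at this
  have d1 : S.C.tgt₁ (S.C.eObj S.A) = S.C.unit := S.C.eObj_tgt _
  have d2 : S.C.src₁ (S.C.eObj S.A) = S.C.tOO S.A S.A := by rw [S.C.eObj_src, S.self]
  have d3 : S.C.src₁ (S.C.iObj S.A) = S.C.unit := S.C.iObj_src _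
  have d4 : S.C.tgt₁ (S.C.iObj S.A) = S.C.tOO S.A S.A := by rw [S.C.iObj_tgt, S.self]
  have d5 := S.hC.braid_unit_left
  have d6 := S.hC.braid_unit_right
  have idl {X : S.C.Obj} {f : S.C.Mor} (h : S.C.src₁ f = X) : S.C.comp (S.C.id₁ X) f = f := by
    rw [← h, S.C.comp_id_left]
  have idr {X : S.C.Obj} {f : S.C.Mor} (h : S.C.tgt₁ f = X) : S.C.comp f (S.C.id₁ X) = f := by
    rw [← h, S.C.comp_id_right]
  have of {x : Name} {f f' : S.C.Mor} (hs : S.C.src₂ (S.base x) = f)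
      (ht : S.C.tgt₂ (S.base x) = f') (df : S.DM f x.bw x.dom) (df' : S.DM f' x.bw x.cod) :
      GoodAt S.A S.gm S.base x := ⟨hs.trans df.eq, ht.trans df'.eq⟩
  have B := S.hC
  cases x <;> try exact absurd hx Bool.false_ne_true
  case tri =>
    exact of (S.C.tri_src _) (S.C.tri_tgt _) (cup'.one_right.comp g cap'.one_left) I1
  case triAdj =>
    have d := ((DualsData.IsCell.mk' (C := S.D) (S.C.tri S.A)).adj)
    rw [show S.D.src₂ (S.C.tri S.A) = _ from S.C.tri_src _,
      show S.D.tgt₂ (S.C.tri S.A) = _ from S.C.tri_tgt _] at d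
    refine of d.src d.tgt ?_ ?_
    · rw [B.duals.dMor_id]
      exact I1
    · rw [B.duals.dMor_comp, B.duals.dMor_tOM, B.duals.dMor_tMO, ← eObj_eq, eObj_eq,
        B.duals.dMor_invol, ← eObj_eq]
      · exact cup'.one_left.comp g cap'.one_right
      · rw [(cup'.one_right.tgt g), cap'.one_left.src g]
        rfl
  case unitCup =>
    refine of (S.C.iCell_src _) (S.C.iCell_tgt _) ?_ ?_
    · rw [d3]; exact I 0
    · rw [← eObj_eq]; exact cup'.comp g cap'
  case counitCup =>
    refine of (S.C.eCell_src _) (S.C.eCell_tgt _) ?_ ?_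
    · rw [← eObj_eq]; exact cap'.comp g cup'
    · rw [d4]; exact I2
  case unitCross =>
    refine of (S.C.iCell_src _) (S.C.iCell_tgt _) ?_ (R.comp g R')
    rw [B.braid_src]; exact I2
  case counitCross =>
    refine of (S.C.eCell_src _) (S.C.eCell_tgt _) (R'.comp g R) ?_
    rw [B.braid_tgt]; exact I2
  case writhe => exact of S.W_src S.W_tgt cup' (cup'.comp g R)
  case tens x y gap =>
    have dx := S.dm x
    have dy := S.dm y
    refine of (S.C.tensorator_src _ _) (S.C.tensorator_tgt _ _) ?_ ?_
    · rw [dx.src g, S.C.tOM_assoc, pw_add, S.C.tOM_tgt, dy.tgt g, pw_add,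
        show wd y.din [(y, 0)] = y.dout by simp [wd]]
      refine (dy.left g (x.din + gap)).comp g ?_
      have := dx.right g (gap + y.dout)
      rwa [show x.din + (gap + y.dout) = wd (x.din + gap + y.din) (sh (x.din + gap) [(y, 0)]) by
        simp [wd, sh]; omega] at this
    · rw [dx.tgt g, S.C.tOM_assoc, pw_add, S.C.tOM_src, dy.src g, pw_add]
      have := dx.right g (gap + y.din)
      rw [← Nat.add_assoc] at this
      refine this.comp g ?_
      have := dy.left g (x.dout + gap)
      have e : wd x.din [(x, 0)] = x.dout := by simp [wd]
      rw [e]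
      rwa [show x.dout + gap + y.din = wd (x.din + gap + y.din) [(x, 0)] by
        simp [wd]; omega] at this
  case hex₁ => exact of (B.Rt1_src ..) (B.Rt1_tgt ..) (R.one_right.comp g R.one_left) Q
  case hex₂ => exact of (B.Rt2_src ..) (B.Rt2_tgt ..) (R.one_left.comp g R.one_right) Q'
  case natCap =>
    refine of (B.braidMorR_src ..) (B.braidMorR_tgt ..) ?_ ?_
    · rw [d1, d6, idr]
      · exact cap'.one_left
      · exact cap'.one_left.tgt g |>.trans S.pw_one
    · rw [d2]; exact Q.comp g cap'.one_right
  case natCup =>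
    refine of (B.braidMorL_src ..) (B.braidMorL_tgt ..) ?_ ?_
    · rw [d4]; exact cup'.one_right.comp g Q'
    · rw [d3, d5, idl]
      · exact cup'.one_left
      · exact cup'.one_left.src g |>.trans S.pw_one
  case hex₁l => exact of (B.Rt1_src ..) (B.Rt1_tgt ..) (R.two_right.comp g Q.one_left) P
  case hex₁r =>
    refine of (B.Rt1_src ..) (B.Rt1_tgt ..) (Q.one_right.comp g R.two_left) ?_
    rw [← S.C.tOO_assoc]; exact P
  case hex₂l => exact of (B.Rt2_src ..) (B.Rt2_tgt ..) (Q'.one_left.comp g R.two_right) P'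
  case hex₂r =>
    refine of (B.Rt2_src ..) (B.Rt2_tgt ..) (R.two_left.comp g Q'.one_right) ?_
    rw [← S.C.tOO_assoc]; exact P'
  case natCapL =>
    refine of (B.braidMorR_src ..) (B.braidMorR_tgt ..) ?_ ?_
    · rw [S.C.tMO_tgt, d1, S.C.tOO_unit_left]; exact cap'.one_right.one_left.comp g R
    · rw [S.C.tMO_src, d2, ← S.C.tOO_assoc]; exact P.comp g cap'.one_right.one_right
  case natCapR =>
    refine of (B.braidMorR_src ..) (B.braidMorR_tgt ..) ?_ ?_
    · rw [S.C.tOM_tgt, d1, S.C.tOO_unit_right]; exact cap'.one_left.one_left.comp g R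
    · rw [S.C.tOM_src, d2]; exact P.comp g cap'.one_left.one_right
  case natCupL =>
    refine of (B.braidMorL_src ..) (B.braidMorL_tgt ..) ?_ ?_
    · rw [S.C.tMO_tgt, d4, ← S.C.tOO_assoc]; exact cup'.one_right.one_right.comp g P'
    · rw [S.C.tMO_src, d3, S.C.tOO_unit_left]; exact R.comp g cup'.one_right.one_left
  case natCupR =>
    refine of (B.braidMorL_src ..) (B.braidMorL_tgt ..) ?_ ?_
    · rw [S.C.tOM_tgt, d4]; exact cup'.one_left.one_right.comp g P'
    · rw [S.C.tOM_src, d3, S.C.tOO_unit_right]; exact R.comp g cup'.one_left.one_left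

end Setup

end Diagram

namespace Diagram

open Gen Name

/-- The step performing `x`. -/
abbrev fw (x : Name) (j k : ℕ) : Step := ⟨x, false, j, k⟩

/-- The step performing the dual of `x`. -/
abbrev bk (x : Name) (j k : ℕ) : Step := ⟨x, true, j, k⟩

/-- The path of `H`. -/
def foldUpP : Path := [fw unitCross 2 0, fw hex₂ 1 0, fw natCup 0 0]

/-- The path of `H̄†*`. -/
def foldDownP : Path := [bk counitCross 0 0, fw hex₁ 1 0, bk natCap 1 0]

/-- The path of `H̄`. -/
def foldUpAdjP : Path :=
  [bk counitCross 2 0, bk counitCup 3 1] ++ shP 2 0 (revP foldDownP) ++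
    [fw counitCross 1 1, bk unitCup 0 0]

/-- The path of `H†*`. -/
def foldDownAdjP : Path :=
  [fw unitCross 0 0, bk counitCup 1 1] ++ shP 2 0 (revP foldUpP) ++
    [bk unitCross 3 1, bk unitCup 2 0]

/-- The second half of the path of `W†*`. -/
def nuP : Path := [fw unitCross 2 0, bk writhe 1 0, fw counitCup 0 0]

/-- The paths of the derived names. -/
def Name.defn : Name → Path
  | saddleCap => [bk counitCup 0 0, fw tri 1 0]
  | saddleCup => [bk counitCup 1 0, bk triAdj 0 0]
  | nu => nuP
  | foldUp => foldUpP
  | foldUpAdj => foldUpAdjP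
  | foldDown => foldDownP
  | foldDownAdj => foldDownAdjP
  | corner₁ => bk tri 0 0 :: shP 1 1 nuP ++ foldUpAdjP
  | corner₂ => bk tri 1 0 :: nuP ++ revP foldDownP
  | corner₃ => fw triAdj 1 0 :: shP 0 1 nuP ++ foldDownAdjP
  | corner₄ => fw triAdj 0 0 :: shP 1 0 nuP ++ revP foldUpP
  | bendA => [bk tri 0 1, bk tri 0 0] ++ shP 1 1 nuP ++ foldUpAdjP ++
      [bk (tens cross cap 0) 1 0, fw tri 0 1]
  | bendB => [fw triAdj 0 1, fw triAdj 2 0] ++ shP 1 1 nuP ++ shP 1 0 foldDownAdjP ++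
      [fw (tens cross cup 0) 0 0, bk triAdj 1 1]
  | _ => []

theorem Name.defn_ok (x : Name) (hx : x.basic = false) :
    okP x.bw x.dom x.defn = true ∧ run x.dom x.defn = x.cod ∧
      ∀ s ∈ x.defn, s.x.basic = true := by
  cases x <;> first | exact absurd hx.symm Bool.false_ne_true | decide

theorem eval_congr {M : DualsData} {A : M.Obj} {gm : Gen → M.Mor} {c c' : Name → M.Cell} {n : ℕ}
    {w : Word} {P : Path} (h : ∀ s ∈ P, c s.x = c' s.x) :
    eval A gm c n w P = eval A gm c' n w P := by
  induction P generalizing w with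
  | nil => rfl
  | cons s P ih =>
    simp only [List.mem_cons, forall_eq_or_imp] at h
    simp only [eval, Step.ev, Step.cell, h.1, ih h.2]

namespace Setup

variable (S : Setup)

/-- The 2-morphisms of all names. -/
def cm (x : Name) : S.C.Cell :=
  if x.basic then S.base x else eval (C := S.D) S.A S.gm S.base x.bw x.dom x.defn

theorem goodAt (x : Name) : GoodAt (C := S.D) S.A S.gm S.cm x := by
  by_cases hx : x.basic = true
  · have := S.goodAt_base x hx
    unfold GoodAt at this ⊢
    rwa [cm, if_pos hx]
  · have d := x.defn_ok (by simpa using hx)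
    have := eval_src_tgt (C := S.D) S.goodGen d.1 x.ok.1 fun s hs => S.goodAt_base s.x (d.2.2 s hs)
    unfold GoodAt
    rw [cm, if_neg hx]
    rwa [d.2.1] at this

/-- The interpretation given by a self-dual object. -/
def m : Model S.D := ⟨S.A, S.gm, S.cm, S.goodGen, S.goodAt⟩

theorem den (x : Name) (hx : x.basic = true) :
    S.m.Den (S.base x) x.bw x.dom [fw x 0 0] := by
  have := Model.Den.atom (m := S.m) x
  rwa [show S.m.cm x = S.base x from if_pos hx] at this

/-- The definition of a derived name. -/
theorem unfold (x : Name) (hx : x.basic = false) :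
    S.m.Holds ⟨x.bw, x.dom, [fw x 0 0], x.defn⟩ := by
  have d := x.defn_ok hx
  refine (Model.Den.atom (m := S.m) x).holds (β := S.m.cm x) ⟨x.ok.1, d.1, ?_⟩ rfl ?_
  · refine (if_neg (by rw [hx]; exact Bool.false_ne_true)).trans ?_
    exact eval_congr fun s hs => (if_pos (d.2.2 s hs)).symm
  · rw [d.2.1]
    simp [run, Step.app, Step.cod, Step.dom, sh]

theorem tensOK : S.m.TensOK := fun x y gap => by
  change S.cm (tens x y gap) = _
  rw [cm, if_pos (by rfl)]
  rfl

end Setup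

end Diagram

namespace Diagram

open Gen Name

/-- The dual of a generator with a named dual. -/
def Gen.dual : Gen → Gen
  | cup => cap
  | cap => cup
  | cross => uncross
  | uncross => cross
  | g => g

/-- The generators with a named dual. -/
def Gen.simple : Gen → Bool
  | cup | cap | cross | uncross => true
  | _ => false

/-- The unit of the adjunction between a generator and its dual. -/
def Gen.unit : Gen → ℕ → Step
  | cap => bk counitCup 0
  | cross => fw unitCross 0
  | uncross => bk counitCross 0
  | _ => fw unitCup 0

/-- The counit of the adjunction between a generator and its dual. -/
def Gen.counit : Gen → ℕ → ℕ → Step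
  | cap => bk unitCup
  | cross => fw counitCross
  | uncross => bk unitCross
  | _ => fw counitCup

/-- The dual of a word. -/
def dualW : Word → Word
  | [] => []
  | l :: w => dualW w ++ [(l.1.dual, l.2)]

/-- The unit of the adjunction between a word and its dual. -/
def unitP : Word → Path
  | [] => []
  | l :: w => l.1.unit l.2 :: shP 1 0 (unitP w)

/-- The counit of the adjunction between a word and its dual. -/
def counitP : Word → Path
  | [] => []
  | l :: w => l.1.counit (dualW w).length l.2 :: counitP w

/-- The path of the adjoint of the 2-morphism of a path. -/
def adjP (u : Word) (P : Path) : Path :=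
  let v := dualW (run u P)
  shP v.length 0 (unitP u) ++ shP v.length 0 P ++ counitP (run u P)

theorem Gen.shP_unit (g : Gen) (k : ℕ) : shP 0 k [g.unit 0] = [g.unit k] := by
  cases g <;> simp [shP, Gen.unit]

theorem Gen.shP_counit (g : Gen) (j k : ℕ) :
    shP (j + 0) (0 + k) [g.counit 0 0] = [g.counit j k] := by
  cases g <;> simp [shP, Gen.counit]

def simpleW (w : Word) : Bool := w.all fun l => l.1.simple

namespace Setup

variable (S : Setup)

theorem dMor_gm {g : Gen} (hg : g.simple = true) : S.C.dMor (S.gm g) = S.gm g.dual := by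
  cases g
  case cup => exact S.eObj_eq.symm
  case cap => exact (congrArg S.C.dMor S.eObj_eq).trans (S.hC.duals.dMor_invol _)
  case cross => rfl
  case uncross => exact S.hC.duals.dMor_invol _
  all_goals exact absurd hg Bool.false_ne_true

theorem iCell_gm {g : Gen} (hg : g.simple = true) :
    S.m.Den (S.C.iCell (S.gm g)) g.din [] [g.unit 0] := by
  cases g
  case cup => exact S.den unitCup rfl
  case cap =>
    have := (S.den counitCup rfl).dual S.hC.duals
    rw [show S.base counitCup = S.C.eCell (S.C.iObj S.A) from rfl, ← S.hC.duals.iCell_dual,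
      ← eObj_eq] at this
    exact this
  case cross => exact S.den unitCross rfl
  case uncross =>
    have := (S.den counitCross rfl).dual S.hC.duals
    rw [show S.base counitCross = S.C.eCell (S.C.braid S.A S.A) from rfl,
      ← S.hC.duals.iCell_dual] at this
    exact this
  all_goals exact absurd hg Bool.false_ne_true

theorem eCell_gm {g : Gen} (hg : g.simple = true) :
    S.m.Den (S.C.eCell (S.gm g)) g.dout [(g.dual, 0), (g, 0)] [g.counit 0 0] := by
  cases g
  case cup => exact S.den counitCup rfl
  case cap =>
    have := (S.den unitCup rfl).dual S.hC.duals
    rw [show S.base unitCup = S.C.iCell (S.C.iObj S.A) from rfl, ← S.hC.duals.eCell_dual,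
      ← eObj_eq] at this
    exact this
  case cross => exact S.den counitCross rfl
  case uncross =>
    have := (S.den unitCross rfl).dual S.hC.duals
    rw [show S.base unitCross = S.C.iCell (S.C.braid S.A S.A) from rfl,
      ← S.hC.duals.eCell_dual] at this
    exact this
  all_goals exact absurd hg Bool.false_ne_true

/-- A 1-morphism together with the words and paths of its adjunction with its dual. -/
structure Mates (f : S.C.Mor) (n n' : ℕ) (w w' : Word) (P Q : Path) : Prop where
  den : S.m.DenM f n w
  wd_eq : wd n w = n'
  dual : S.m.DenM (S.C.dMor f) n' w'
  wd_eq' : wd n' w' = n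
  unit : S.m.Den (S.C.iCell f) n [] P
  run_unit : run [] P = w ++ w'
  counit : S.m.Den (S.C.eCell f) n' (w' ++ w) Q
  run_counit : run (w' ++ w) Q = []

variable {S}

theorem mates_id (n : ℕ) : S.Mates (S.C.id₁ (pw S.M S.A n)) n n [] [] [] [] where
  den := .id n
  wd_eq := rfl
  dual := by rw [S.hC.duals.dMor_id]; exact .id n
  wd_eq' := rfl
  unit := by
    rw [show S.C.iCell _ = _ from DualsData.iCell_id S.hC.duals _]
    exact .id (.id n)
  run_unit := rfl
  counit := by
    rw [← S.hC.duals.dMor_id, S.hC.duals.eCell_dual,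
      show S.C.iCell _ = _ from DualsData.iCell_id S.hC.duals _, S.hC.duals.dCell_id]
    exact .id (.id n)
  run_counit := rfl

theorem mates_gm {g : Gen} (hg : g.simple = true) :
    S.Mates (S.gm g) g.din g.dout [(g, 0)] [(g.dual, 0)] [g.unit 0] [g.counit 0 0] where
  den := .gen S.goodGen g
  wd_eq := by simp [wd]
  dual := by
    rw [dMor_gm S hg]
    have := DenM.gen S.goodGen g.dual
    rwa [show g.dual.din = g.dout by cases g <;> rfl] at this
  wd_eq' := by cases g <;> rfl
  unit := iCell_gm S hg
  run_unit := by cases g <;> first | rfl | exact absurd hg Bool.false_ne_true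
  counit := eCell_gm S hg
  run_counit := by cases g <;> rfl

variable {f g : S.C.Mor} {n n' n'' : ℕ} {w w' v v' : Word} {P Q P' Q' : Path}

theorem Mates.tens (h : S.Mates f n n' w w' P Q) (k q : ℕ) :
    S.Mates (tM (M := S.M) S.A k q f) (k + n + q) (k + n' + q) (sh k w) (sh k w')
      (shP 0 k P) (shP 0 k Q) where
  den := h.den.tens S.goodGen k q
  wd_eq := by rw [(okW_sh h.den.word k q).2, h.wd_eq]
  dual := by
    have := h.dual.tens S.goodGen k q
    rw [tM, S.hC.duals.dMor_tOM, S.hC.duals.dMor_tMO]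
    exact this
  wd_eq' := by rw [(okW_sh h.dual.word k q).2, h.wd_eq']
  unit := by
    have := h.unit.tens k q
    rw [tM, S.hC.duals.iCell_tOM, S.hC.duals.iCell_tMO]
    exact this
  run_unit := by
    have := h.unit.run_lift (p := []) (r := []) (k := k) (q := q) (n := k + n + q) rfl rfl rfl
    simpa [sh, h.run_unit] using this
  counit := by
    have := h.counit.tens k q
    rw [tM, S.hC.duals.eCell_tOM, S.hC.duals.eCell_tMO]
    exact this.cast rfl rfl (by simp [sh]) rfl
  run_counit := by
    have := h.counit.run_lift (p := []) (r := []) (k := k) (q := q) (n := k + n' + q) rfl rfl rfl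
    simpa [sh, h.run_counit] using this

theorem Mates.comp (h : S.Mates f n n' w w' P Q) (h' : S.Mates g n' n'' v v' P' Q') :
    S.Mates (S.C.comp f g) n n'' (w ++ v) (v' ++ w') (P ++ shP w.length 0 P')
      (shP v'.length 0 Q ++ Q') := by
  have e : S.C.tgt₁ f = S.C.src₁ g := by
    rw [h.den.tgt S.goodGen, h'.den.src S.goodGen, h.wd_eq]
  have d := h'.dual.comp S.goodGen (by rw [h'.wd_eq']; exact h.dual)
  have a := ((Model.Den.id h.den).hcomp (by rw [h.wd_eq]; exact h'.unit)).hcomp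
    (β := S.C.id₂ (S.C.dMor f)) (v := w') (Q := []) (by
      rw [List.append_nil, h.wd_eq]; exact .id h.dual)
  have ra := h'.unit.run_lift (p := w) (r := w') (k := 0) (q := 0) (n := n) h.den.word
    (by rw [h.wd_eq]; simp) (by simpa [wd] using h.dual.word)
  have b := ((Model.Den.id h'.dual).hcomp (by rw [h'.wd_eq']; exact h.counit)).hcomp
    (β := S.C.id₂ g) (v := v) (Q := []) (by
      rw [wd_append, wd_append, h'.wd_eq', h.wd_eq', h.wd_eq]; exact .id h'.den)
  have rb := h.counit.run_lift (p := v') (r := v) (k := 0) (q := 0) (n := n'') h'.dual.word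
    (by rw [h'.wd_eq']; simp) (by
      rw [wd_append, h.wd_eq', h.wd_eq]; simpa [wd] using h'.den.word)
  simp only [show ∀ v, sh 0 v = v by simp [sh]] at ra rb
  have a' := h.unit.vcomp (β := S.C.hcomp (S.C.hcomp (S.C.id₂ f) (S.C.iCell g))
      (S.C.id₂ (S.C.dMor f))) (Q := shP w.length 0 P') (a.cast rfl rfl
    (by simp [h.run_unit]) (by simp [run, shP]))
  have b' := (b.cast (u' := (v' ++ w') ++ (w ++ v)) (P' := shP v'.length 0 Q) rfl rfl (by simp)
    (by simp [run, shP])).vcomp (β := S.C.eCell g) (Q := Q') (by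
      refine h'.counit.cast rfl rfl ?_ rfl
      simpa [h.run_counit] using rb.symm)
  refine ⟨h.den.comp S.goodGen (by rw [h.wd_eq]; exact h'.den), ?_, ?_, ?_, ?_, ?_, ?_, ?_⟩
  · rw [wd_append, h.wd_eq, h'.wd_eq]
  · rwa [S.hC.duals.dMor_comp _ _ e]
  · rw [wd_append, h'.wd_eq', h.wd_eq']
  · rwa [S.hC.duals.iCell_comp _ _ e]
  · rw [run_append, h.run_unit]
    simpa [h'.run_unit] using ra
  · rwa [S.hC.duals.eCell_comp _ _ e]
  · rw [run_append, ← h'.run_counit]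
    congr 1
    simpa [h.run_counit] using rb

theorem mates {n : ℕ} {w : Word} (hw : okW n w = true) (hs : simpleW w = true) :
    S.Mates (S.m.mor n w) n (wd n w) w (dualW w) (unitP w) (counitP w) := by
  induction w generalizing n with
  | nil => exact mates_id n
  | cons l w ih =>
    simp only [simpleW, List.all_cons, Bool.and_eq_true] at hs
    simp only [okW, Bool.and_eq_true, Nat.ble_eq] at hw
    have a := (mates_gm (S := S) hs.1).tens l.2 (n - (l.2 + l.1.din))
    have b := ih hw.2 hs.2
    rw [show l.2 + l.1.din + (n - (l.2 + l.1.din)) = n by omega,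
      show l.2 + l.1.dout + (n - (l.2 + l.1.din)) = n - l.1.din + l.1.dout by omega] at a
    have := a.comp b
    rw [show sh l.2 [(l.1, 0)] ++ w = l :: w from rfl,
      show dualW w ++ sh l.2 [(l.1.dual, 0)] = dualW (l :: w) from rfl, shP_shP,
      Gen.shP_unit, Gen.shP_counit] at this
    exact this

/-- The path of an adjoint. -/
theorem _root_.Diagram.Model.Den.adj {α : S.C.Cell} {n : ℕ} {u : Word} {P : Path}
    (h : S.m.Den α n u P) (hu : simpleW u = true) (hv : simpleW (run u P) = true) :
    S.m.Den (S.C.adj α) (wd n u) (dualW (run u P)) (adjP u P) := by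
  have a := mates (S := S) h.word hu
  have b := mates (S := S) h.run_ok hv
  have e := h.run_wd
  rw [e] at b
  unfold DualsData.adj
  rw [h.src, h.tgt]
  set v := run u P with hv
  have i := (Model.Den.id b.dual).hcomp (by rw [b.wd_eq']; exact a.unit)
  have c := ((Model.Den.id b.dual).hcomp (by rw [b.wd_eq']; exact h)).hcomp
    (β := S.C.id₂ (S.C.dMor (S.m.mor n u))) (v := dualW u) (Q := []) (by
      rw [wd_append, b.wd_eq']; exact .id a.dual)
  have k := b.counit.hcomp (β := S.C.id₂ (S.C.dMor (S.m.mor n u))) (v := dualW u) (Q := []) (by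
    rw [wd_append, b.wd_eq', e]; exact .id a.dual)
  have ri := a.unit.run_lift (p := dualW v) (r := []) (k := 0) (q := 0) (n := wd n u)
    b.dual.word (by rw [b.wd_eq']; simp) rfl
  have rc := h.run_lift (p := dualW v) (r := dualW u) (k := 0) (q := 0) (n := wd n u)
    b.dual.word (by rw [b.wd_eq']; simp) (by simpa using a.dual.word)
  simp only [show ∀ v, sh 0 v = v by simp [sh], List.append_nil, a.run_unit] at ri rc
  refine (i.vcomp (c.cast rfl rfl ?_ rfl) |>.vcomp (k.cast rfl rfl ?_ rfl)).cast rfl rfl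
    (List.append_nil _) ?_
  · simp [run, ri]
  · simp only [List.append_nil, List.nil_append, run, shP_nil, run_append, ri, rc]
    simp [← hv]
  · simp [adjP, run, shP_nil, ← hv]

end Setup

end Diagram

namespace Diagram

open Gen Name

namespace Setup

variable {S : Setup}

theorem _root_.Diagram.Model.Den.one_left {α : S.C.Cell} {n : ℕ} {u : Word} {P : Path}
    (h : S.m.Den α n u P) : S.m.Den (S.C.tOC S.A α) (1 + n) (sh 1 u) (shP 0 1 P) := by
  have := h.left 1
  rwa [show pw S.D.toMonTwoCat S.m.A 1 = S.A from S.pw_one] at this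

theorem _root_.Diagram.Model.Den.one_right {α : S.C.Cell} {n : ℕ} {u : Word} {P : Path}
    (h : S.m.Den α n u P) : S.m.Den (S.C.tCO α S.A) (n + 1) u P := by
  have := h.right 1
  rwa [show pw S.D.toMonTwoCat S.m.A 1 = S.A from S.pw_one] at this

theorem _root_.Diagram.Model.Den.two_right {α : S.C.Cell} {n : ℕ} {u : Word} {P : Path}
    (h : S.m.Den α n u P) : S.m.Den (S.C.tCO α (S.C.tOO S.A S.A)) (n + 2) u P := by
  have := h.right 2
  rwa [show pw S.D.toMonTwoCat S.m.A 2 = S.C.tOO S.A S.A from S.pw_two] at this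

variable (S)

theorem den_tens (x y : Gen) : S.m.Den (S.C.tensorator (S.gm x) (S.gm y)) (x.din + y.din)
    [(y, x.din), (x, 0)] [fw (tens x y 0) 0 0] := by
  have := S.den (tens x y 0) rfl
  rwa [show S.base (tens x y 0) = S.C.tensorator (S.gm x) (S.gm y) from
    congrArg _ (S.C.tOM_unit _)] at this

theorem tensInv_eq (f g : S.C.Mor) :
    S.C.tensoratorInv f g = S.C.dCell (S.C.tensorator f g) := by
  obtain ⟨h1, h2, -, h4⟩ := S.C.tensorator_inv f g
  have u := (S.hC.duals.tensorator_unitary f g).1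
  have d := S.C.dCell_src (S.C.tensorator f g)
  have a := S.C.vcomp_assoc _ _ _ h2 d.symm
  rw [h4, u, ← d, S.C.vcomp_id_left, ← h2, S.C.vcomp_id_right] at a
  exact a.symm

theorem den_tensInv (x y : Gen) : S.m.Den (S.C.tensoratorInv (S.gm x) (S.gm y)) (x.din + y.din)
    [(x, 0), (y, x.dout)] [bk (tens x y 0) 0 0] := by
  rw [tensInv_eq]
  exact ((S.den_tens x y).dual S.hC.duals).cast rfl rfl
    (by simp [run, Step.app, Step.cod, Step.dom, Name.dom, Name.cod, sh]) rfl

theorem unitary_adj {α : S.C.Cell} (h : S.D.Unitary α) : S.D.Unitary (S.C.adj α) := by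
  have c := DualsData.IsCell.mk' (C := S.D) α
  have H := S.hC.duals
  have e := congrArg S.C.adj h.1
  have e' := congrArg S.C.adj h.2
  rw [DualsData.adj_vcomp H c c.dual, DualsData.adj_id H rfl rfl] at e
  rw [DualsData.adj_vcomp H c.dual c, DualsData.adj_id H rfl rfl] at e'
  constructor
  · rw [H.adj_star, e', c.adj.src]
  · rw [H.adj_star, e, c.adj.tgt]

/-- The names of unitary 2-morphisms. -/
def _root_.Diagram.Name.unitary : Name → Bool
  | unitCup | counitCup | writhe => false
  | x => x.basic

theorem unitary_base (x : Name) (hx : x.unitary = true) : S.D.Unitary (S.base x) := by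
  have H := S.hC
  cases x <;> first
    | exact absurd hx Bool.false_ne_true
    | exact H.duals.tri_unitary _
    | exact S.unitary_adj (H.duals.tri_unitary _)
    | exact H.duals.tensorator_unitary _ _
    | exact H.iR_unitary _ _
    | exact H.eR_unitary _ _
    | exact H.Rt1_unitary _ _ _
    | exact H.Rt2_unitary _ _ _
    | exact H.braidMorL_unitary _ _
    | exact H.braidMorR_unitary _ _

theorem cancel (x : Name) (hx : x.unitary = true) :
    S.m.Holds ⟨x.bw, x.dom, [fw x 0 0, bk x 0 0], []⟩ := by
  have b : x.basic = true := by cases x <;> first | rfl | exact absurd hx Bool.false_ne_true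
  exact ((S.den x b).cancel S.hC.duals (S.unitary_base x hx)).1

theorem cancel' (x : Name) (hx : x.unitary = true) :
    S.m.Holds ⟨x.bw, x.cod, [bk x 0 0, fw x 0 0], []⟩ := by
  have b : x.basic = true := by cases x <;> first | rfl | exact absurd hx Bool.false_ne_true
  have := ((S.den x b).cancel S.hC.duals (S.unitary_base x hx)).2
  rwa [show run x.dom [fw x 0 0] = x.cod by
    simp [run, Step.app, Step.cod, Step.dom, sh]] at this

theorem dI (x : Gen) : S.m.Den (S.C.id₂ (S.gm x)) x.din [(x, 0)] [] := .id (S.dm x)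

theorem cup_triangle : S.m.Holds ⟨0, [(cup, 0)], [fw unitCup 0 0, fw counitCup 1 0], []⟩ :=
  (((S.den unitCup rfl).hcomp (S.dI cup)).vcomp
    ((S.dI cup).hcomp (S.den counitCup rfl))).holds (S.dI cup) (S.hC.duals.triangle₁ _) rfl

theorem cap_triangle : S.m.Holds ⟨2, [(cap, 0)], [fw unitCup 1 0, fw counitCup 0 0], []⟩ := by
  have e := S.dI cap
  rw [show S.gm cap = S.C.dMor (S.C.iObj S.A) from S.eObj_eq] at e
  exact ((e.hcomp (S.den unitCup rfl)).vcomp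
    ((S.den counitCup rfl).hcomp e)).holds e (S.hC.duals.triangle₂ _) rfl

theorem triAdj_def :
    S.m.Holds ⟨1, [], [fw triAdj 0 0], [fw unitCup 0 0, bk counitCup 1 1, fw tri 0 0]⟩ :=
  (S.den triAdj rfl).holds ((S.den tri rfl).adj rfl rfl) rfl rfl

theorem tri_def : S.m.Holds ⟨1, [(cup, 0), (cap, 1)], [fw tri 0 0],
    [fw triAdj 2 0, fw counitCup 1 1, bk unitCup 0 0]⟩ :=
  (S.den tri rfl).holds ((S.den triAdj rfl).adj rfl rfl)
    (DualsData.adj_adj S.hC.duals (DualsData.IsCell.mk' (C := S.D) _)).symm rfl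

theorem swallowtail : S.m.Holds ⟨0, [(cup, 0)],
    [fw triAdj 1 1, bk (tens cup cup 0) 0 0, fw tri 1 0], []⟩ := by
  have h := S.hC.duals.swallowtail S.A
  rw [S.self] at h
  have a := (S.dI cup).hcomp (S.den triAdj rfl).one_left
  have b := (S.den_tensInv cup cup).hcomp (.id (S.dm cap).one_right.one_left)
  have c := (S.dI cup).hcomp (S.den tri rfl).one_right
  exact ((a.vcomp b).vcomp c).holds (S.dI cup) h rfl

theorem unit_idr {X : S.C.Obj} {f : S.C.Mor} (h : S.C.tgt₁ f = X) :
    S.C.comp f (S.C.id₁ X) = f := by rw [← h, S.C.comp_id_right]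

theorem unit_idl {X : S.C.Obj} {f : S.C.Mor} (h : S.C.src₁ f = X) :
    S.C.comp (S.C.id₁ X) f = f := by rw [← h, S.C.comp_id_left]

theorem saddleCap_natural : S.m.Holds ⟨4, [(cap, 2), (cross, 0)],
    [fw natCapR 0 0, fw saddleCap 1 0], [fw saddleCap 0 1, fw natCapL 0 0]⟩ := by
  have key {β f g X Y} (a : S.C.src₂ β = f) (b : S.C.tgt₂ β = g) (c : S.C.src₁ f = X)
      (d : S.C.tgt₁ f = Y) :
      S.C.vcomp (S.C.braidMorR S.A f) (S.C.hcomp (S.C.id₂ (S.C.braid S.A X)) (S.C.tCO β S.A))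
      = S.C.vcomp (S.C.hcomp (S.C.tOC S.A β) (S.C.id₂ (S.C.braid S.A Y)))
        (S.C.braidMorR S.A g) := by
    subst a b c d
    exact S.hC.cell_dot _ _
  have t := Model.Den.atom (m := S.m) saddleCap
  have f : S.DM _ 3 [(cap, 1)] := (S.dm cap).one_left
  have g : S.DM _ 3 [(cap, 0)] := (S.dm cap).one_right
  exact ((S.den natCapR rfl).vcomp ((S.dI over₃).hcomp t.one_right)).holds
    ((t.one_left.hcomp (S.dI cross)).vcomp (S.den natCapL rfl))
    (key (t.src.trans f.eq.symm) (t.tgt.trans g.eq.symm) ((f.src S.goodGen).trans S.pw_three)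
      ((f.tgt S.goodGen).trans S.pw_one)) rfl

theorem saddleCup_natural : S.m.Holds ⟨2, [(cup, 1), (under₃, 0)],
    [fw natCupR 0 0, fw saddleCup 1 1], [fw saddleCup 0 0, fw natCupL 0 0]⟩ := by
  have key {β f g X Y} (a : S.C.src₂ β = f) (b : S.C.tgt₂ β = g) (c : S.C.src₁ f = X)
      (d : S.C.tgt₁ f = Y) :
      S.C.vcomp (S.C.braidMorL f S.A) (S.C.hcomp (S.C.id₂ (S.C.braid X S.A)) (S.C.tOC S.A β))
      = S.C.vcomp (S.C.hcomp (S.C.tCO β S.A) (S.C.id₂ (S.C.braid Y S.A)))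
        (S.C.braidMorL g S.A) := by
    subst a b c d
    exact S.hC.dot_cell _ _
  have t := Model.Den.atom (m := S.m) saddleCup
  have f : S.DM _ 1 [(cup, 1)] := (S.dm cup).one_left
  have g : S.DM _ 1 [(cup, 0)] := (S.dm cup).one_right
  exact ((S.den natCupR rfl).vcomp ((S.dI cross).hcomp t.one_left)).holds
    ((t.one_right.hcomp (S.dI under₃)).vcomp (S.den natCupL rfl))
    (key (t.src.trans f.eq.symm) (t.tgt.trans g.eq.symm) ((f.src S.goodGen).trans S.pw_one)
      ((f.tgt S.goodGen).trans S.pw_three)) rfl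

theorem cap_src : S.C.src₁ (S.C.eObj S.A) = S.C.tOO S.A S.A := by rw [S.C.eObj_src, S.self]

theorem cup_tgt : S.C.tgt₁ (S.C.iObj S.A) = S.C.tOO S.A S.A := by rw [S.C.iObj_tgt, S.self]

theorem dmId2 : S.DM (S.C.id₁ (S.C.tOO S.A S.A)) 2 [] := by
  have := DenM.id (M := S.M) (A := S.A) (gm := S.gm) 2
  rwa [pw_two] at this

theorem natCapR_eq : S.m.Holds ⟨4, [(cap, 2), (cross, 0)], [fw natCapR 0 0],
    [fw (tens cross cap 0) 0 0, fw natCap 1 1, fw hex₁l 0 0]⟩ := by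
  have h := S.hC.dot_dot_arrow S.A S.A (S.C.eObj S.A)
  rw [S.C.eObj_tgt, S.cap_src, S.hC.Rt1_unit₃ S.A S.A, S.hC.Rt1_src, S.C.tMO_unit,
    S.hC.braid_unit_right, S.C.tOM_id, unit_idr S (S.hC.braid_tgt _ _)] at h
  have a := (Model.Den.id (m := S.m) (S.dm cap).two_left).hcomp (S.dI cross)
  have b := (S.den_tens cross cap).hcomp (.id S.dmId2)
  have c := (Model.Den.id (m := S.m) (S.dm cross).two_right).hcomp (S.den natCap rfl).one_left
  have d := (S.den hex₁l rfl).hcomp (.id (S.dm cap).one_left.one_right)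
  exact (a.vcomp (S.den natCapR rfl)).holds ((b.vcomp c).vcomp d) h rfl

theorem natCapL_eq : S.m.Holds ⟨4, [(cap, 1), (cross, 0)], [fw natCapL 0 0],
    [fw natCap 0 0, bk (tens cap cross 0) 1 0, fw hex₁r 0 0]⟩ := by
  have h := S.hC.dot_arrow_dot1 S.A (S.C.eObj S.A) S.A
  rw [S.C.eObj_tgt, S.cap_src, S.hC.Rt1_unit₂ S.A S.A, S.hC.Rt1_src, S.C.tOM_unit,
    S.hC.braid_unit_right, S.C.tMO_id, unit_idl S (S.hC.braid_src _ _)] at h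
  have a := (Model.Den.id (m := S.m) (S.dm cap).one_right.one_left).hcomp (S.dI cross)
  have b := (S.den natCap rfl).one_right.hcomp (S.dI cross)
  have c := (Model.Den.id (m := S.m) (S.dm over₂).one_right).hcomp (S.den_tensInv cap cross)
  have d := (S.den hex₁r rfl).hcomp (.id (S.dm cap).one_right.one_right)
  exact (a.vcomp (S.den natCapL rfl)).holds ((b.vcomp c).vcomp d) h rfl

theorem natCupR_eq : S.m.Holds ⟨2, [(cup, 1), (under₂, 1), (cross, 0)],
    [fw hex₂l 1 0, fw natCupR 0 0], [fw natCup 0 1, fw (tens cross cup 0) 0 0]⟩ := by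
  have h := S.hC.dot_arrow_dot2 S.A (S.C.iObj S.A) S.A
  rw [S.C.iObj_src, S.cup_tgt, S.hC.Rt2_unit₂ S.A S.A, S.hC.Rt2_src, S.C.tMO_unit,
    S.hC.braid_unit_left, S.C.tOM_id, unit_idl S (S.hC.braid_src _ _)] at h
  have a := (Model.Den.id (m := S.m) (S.dm cup).one_right.one_left).hcomp (S.den hex₂l rfl)
  have b := (S.den natCup rfl).one_left.hcomp (.id (S.dm cross).two_right)
  have c := (Model.Den.id (m := S.m) S.dmId2).hcomp (S.den_tens cross cup)
  have d := (S.dI cross).hcomp (.id (S.dm cup).two_left)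
  exact (a.vcomp (S.den natCupR rfl)).holds ((b.vcomp c).vcomp d) h rfl

theorem natCupL_eq : S.m.Holds ⟨2, [(cup, 0), (cross, 2), (under₂, 0)],
    [fw hex₂r 1 0, fw natCupL 0 0], [bk (tens cup cross 0) 0 0, fw natCup 1 0]⟩ := by
  have h := S.hC.arrow_dots2 (S.C.iObj S.A) S.A S.A
  rw [S.C.iObj_src, S.cup_tgt, S.hC.Rt2_unit₁ S.A S.A, S.hC.Rt2_src, S.C.tOM_unit,
    S.hC.braid_unit_left, S.C.tMO_id, unit_idr S (S.hC.braid_tgt _ _)] at h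
  have a := (Model.Den.id (m := S.m) (S.dm cup).two_right).hcomp (S.den hex₂r rfl)
  have b := (S.den_tensInv cup cross).hcomp (.id (S.dm under₂).one_right)
  have c := (S.dI cross).hcomp (S.den natCup rfl).one_right
  have d := (S.dI cross).hcomp (.id (S.dm cup).one_left.one_right)
  exact (a.vcomp (S.den natCupL rfl)).holds ((b.vcomp c).vcomp d) h rfl

theorem hex₁_assoc : S.m.Holds ⟨4, [(cross, 0), (cross, 1), (cross, 2)],
    [fw hex₁ 1 1, fw hex₁l 0 0], [fw hex₁ 0 0, fw hex₁r 0 0]⟩ := by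
  have a := (Model.Den.id (m := S.m) (S.dm cross).two_right).hcomp (S.den hex₁ rfl).one_left
  have b := (S.den hex₁ rfl).one_right.hcomp (.id (S.dm cross).two_left)
  exact (a.vcomp (S.den hex₁l rfl)).holds (b.vcomp (S.den hex₁r rfl)) (S.hC.dot_three ..) rfl

theorem hex₂_assoc : S.m.Holds ⟨4, [(cross, 2), (cross, 1), (cross, 0)],
    [fw hex₂ 0 1, fw hex₂l 0 0], [fw hex₂ 1 0, fw hex₂r 0 0]⟩ := by
  have a := (S.den hex₂ rfl).one_left.hcomp (.id (S.dm cross).two_right)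
  have b := (Model.Den.id (m := S.m) (S.dm cross).two_left).hcomp (S.den hex₂ rfl).one_right
  exact (a.vcomp (S.den hex₂l rfl)).holds (b.vcomp (S.den hex₂r rfl)) (S.hC.three_dot ..) rfl

end Setup

end Diagram

namespace Diagram

/-- Every relation of the list is satisfied. -/
inductive Model.Known {C : DualsData} (m : Model C) : List Rel → Prop
  | nil : m.Known []
  | cons {r : Rel} {l : List Rel} (h : m.Holds r) (t : m.Known l) : m.Known (r :: l)

theorem Model.Holds.of_moves {C : DualsData} {m : Model C} {rels : List Rel} {r : Rel}
    (k : m.Known rels) (l : List Move) (h : checkMoves rels r l = true) : m.Holds r := by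
  refine m.holds_of_moves (fun s hs => ?_) l h
  clear h
  induction k with
  | nil => simp at hs
  | cons h _ ih =>
    rcases List.mem_cons.1 hs with rfl | hs
    · exact h
    · exact ih hs

end Diagram

namespace Diagram

open Gen Name

namespace Setup

variable (S : Setup)

theorem tri_eq_saddleCap : S.m.Holds ⟨1, [(cup, 0), (cap, 1)],
    [fw tri 0 0],
    [fw saddleCap 1 0, bk unitCup 0 0]⟩ :=
  .of_moves (.cons ((S.cup_triangle).star S.hC.duals) <|
    .cons (S.unfold saddleCap rfl) .nil)
    [.bwd 0 0 0 0, .right 1, .bwd 1 0 1 0] (by decide +kernel)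

theorem triAdj_eq_saddleCup : S.m.Holds ⟨1, [(cup, 1), (cap, 0)],
    [bk triAdj 0 0],
    [fw saddleCup 0 0, bk unitCup 0 0]⟩ :=
  .of_moves (.cons ((S.cap_triangle).star S.hC.duals) <|
    .cons (S.unfold saddleCup rfl) .nil)
    [.bwd 0 0 1 0, .left 1, .bwd 1 0 0 0] (by decide +kernel)

theorem saddleCap_slide : S.m.Holds ⟨4, [(cap, 2), (cross, 0)],
    [fw (tens cross cap 0) 0 0, fw natCap 1 1, bk hex₁ 1 1, fw saddleCap 3 0],
    [fw saddleCap 0 1, fw natCap 0 0, bk hex₁ 0 0, bk (tens cap cross 0) 2 0]⟩ :=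
  .of_moves (.cons (S.cancel hex₁l rfl) <|
    .cons (S.natCapR_eq) <|
    .cons (S.saddleCap_natural) <|
    .cons (S.natCapL_eq) <|
    .cons ((S.hex₁_assoc).star S.hC.duals) <|
    .cons (S.cancel hex₁r rfl) .nil)
    [.bwd 0 2 0 0, .bwd 1 0 0 0, .right 2, .right 1, .fwd 2 0 0 0, .fwd 3 1 0 0, .fwd 4 4 0 0,
      .fwd 5 3 0 0, .left 2] (by decide +kernel)

theorem saddleCup_slide : S.m.Holds ⟨2, [(cross, 0), (cup, 2)],
    [bk (tens cross cup 0) 0 0, bk natCup 0 1, bk hex₂ 1 1, fw saddleCup 0 0],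
    [fw saddleCup 1 1, bk natCup 1 0, bk hex₂ 2 0, fw (tens cup cross 0) 0 0]⟩ :=
  .of_moves (.cons ((S.natCupR_eq).star S.hC.duals) <|
    .cons ((S.hex₂_assoc).star S.hC.duals) <|
    .cons (S.cancel natCupL rfl) <|
    .cons (S.saddleCup_natural) <|
    .cons (S.cancel' natCupR rfl) <|
    .cons ((S.natCupL_eq).star S.hC.duals) .nil)
    [.bwd 0 0 0 0, .fwd 1 1 1 0, .left 2, .left 1, .bwd 2 2 0 0, .bwd 3 1 0 0, .fwd 4 0 0 0,
      .fwd 5 1 0 0, .right 2] (by decide +kernel)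

theorem foldUpAdj_bend : S.m.Holds ⟨2, [(cup, 0), (uncross, 1), (cap, 2)],
    [fw foldUpAdj 0 0, bk (tens cross cap 0) 1 0, fw tri 0 1],
    [bk foldDown 1 1, bk (tens cup cross 0) 0 0, fw tri 1 0]⟩ :=
  .of_moves (.cons (S.unfold foldUpAdj rfl) <|
    .cons (S.unfold saddleCap rfl) <|
    .cons (S.cancel' (tens cap cross 0) rfl) <|
    .cons (S.saddleCap_slide) <|
    .cons (S.cancel' (tens cross cap 0) rfl) <|
    .cons (S.cancel' counitCross rfl) <|
    .cons (S.cancel' (tens cup cross 0) rfl) <|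
    .cons (Model.slideL_natural S.tensOK cross 0 (b := 0) (u := [(cup, 0), (cap, 0)])
        (X := [bk unitCup 0 0]) rfl rfl) <|
    .cons (S.tri_eq_saddleCap) <|
    .cons ((S.unfold foldDown rfl).star S.hC.duals) .nil)
    [.fwd 0 0 0 0, .right 6, .right 5, .right 4, .right 3, .right 2, .right 1, .right 7, .right 6,
      .right 5, .right 4, .right 3, .bwd 1 2 3 1, .bwd 2 4 4 0, .left 5, .left 4, .bwd 3 2 3 0,
      .fwd 4 1 3 0, .right 0, .right 1, .right 2, .right 3, .fwd 5 4 2 0, .left 3, .bwd 6 4 0 0,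
      .bwd 7 5 0 0, .left 2, .left 3, .bwd 8 4 1 0, .bwd 9 0 1 1] (by decide +kernel)

theorem foldDownAdj_bend : S.m.Holds ⟨2, [(cup, 2), (uncross, 1), (cap, 0)],
    [fw foldDownAdj 1 0, fw (tens cross cup 0) 0 0, bk triAdj 1 1],
    [bk foldUp 0 1, fw (tens cap cross 0) 1 0, bk triAdj 0 0]⟩ :=
  .of_moves (.cons (S.unfold foldDownAdj rfl) <|
    .cons (S.unfold saddleCup rfl) <|
    .cons (S.cancel (tens cup cross 0) rfl) <|
    .cons (S.saddleCup_slide) <|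
    .cons (S.cancel (tens cross cup 0) rfl) <|
    .cons (S.cancel unitCross rfl) <|
    .cons (Model.slideL_natural S.tensOK cross 0 (b := 0) (u := [(cup, 0), (cap, 0)])
        (X := [bk unitCup 0 0]) rfl rfl) <|
    .cons (S.cancel' (tens cup cross 0) rfl) <|
    .cons (S.triAdj_eq_saddleCup) <|
    .cons ((S.unfold foldUp rfl).star S.hC.duals) .nil)
    [.fwd 0 0 1 0, .left 6, .left 5, .left 4, .left 3, .left 2, .left 1, .left 7, .left 6, .left 5,
      .left 4, .left 3, .bwd 1 2 1 1, .bwd 2 4 0 0, .right 5, .right 4, .bwd 3 2 0 0, .fwd 4 1 0 0,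
      .left 0, .left 1, .left 2, .left 3, .fwd 5 4 3 0, .fwd 6 5 0 0, .right 3, .fwd 7 4 0 0,
      .right 2, .right 3, .bwd 8 4 0 0, .bwd 9 0 0 1] (by decide +kernel)

theorem corner₁_eq : S.m.Holds ⟨1, [(cup, 1)],
    [fw corner₁ 0 0],
    [bk tri 0 0, fw nu 1 1, fw foldUpAdj 0 0]⟩ :=
  .of_moves (.cons (S.unfold corner₁ rfl) <|
    .cons (S.unfold nu rfl) <|
    .cons (S.unfold foldUpAdj rfl) .nil)
    [.fwd 0 0 0 0, .bwd 1 1 1 1, .bwd 2 2 0 0] (by decide +kernel)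

theorem corner₂_eq : S.m.Holds ⟨3, [(cap, 0)],
    [fw corner₂ 0 0],
    [bk tri 1 0, fw nu 0 0, bk foldDown 0 0]⟩ :=
  .of_moves (.cons (S.unfold corner₂ rfl) <|
    .cons (S.unfold nu rfl) <|
    .cons ((S.unfold foldDown rfl).star S.hC.duals) .nil)
    [.fwd 0 0 0 0, .bwd 1 1 0 0, .bwd 2 2 0 0] (by decide +kernel)

theorem corner₃_eq : S.m.Holds ⟨3, [(cap, 1)],
    [fw corner₃ 0 0],
    [fw triAdj 1 0, fw nu 0 1, fw foldDownAdj 0 0]⟩ :=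
  .of_moves (.cons (S.unfold corner₃ rfl) <|
    .cons (S.unfold nu rfl) <|
    .cons (S.unfold foldDownAdj rfl) .nil)
    [.fwd 0 0 0 0, .bwd 1 1 0 1, .bwd 2 2 0 0] (by decide +kernel)

theorem corner₄_eq : S.m.Holds ⟨1, [(cup, 0)],
    [fw corner₄ 0 0],
    [fw triAdj 0 0, fw nu 1 0, bk foldUp 0 0]⟩ :=
  .of_moves (.cons (S.unfold corner₄ rfl) <|
    .cons (S.unfold nu rfl) <|
    .cons ((S.unfold foldUp rfl).star S.hC.duals) .nil)
    [.fwd 0 0 0 0, .bwd 1 1 1 0, .bwd 2 2 0 0] (by decide +kernel)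

theorem bendA_eq_corner₁ : S.m.Holds ⟨2, [],
    [fw bendA 0 0],
    [bk tri 0 1, fw corner₁ 0 0, bk (tens cross cap 0) 1 0, fw tri 0 1]⟩ :=
  .of_moves (.cons (S.unfold bendA rfl) <|
    .cons (S.unfold corner₁ rfl) .nil)
    [.fwd 0 0 0 0, .bwd 1 1 0 0] (by decide +kernel)

theorem bendB_eq_corner₃ : S.m.Holds ⟨2, [],
    [fw bendB 0 0],
    [fw triAdj 0 1, fw corner₃ 1 0, fw (tens cross cup 0) 0 0, bk triAdj 1 1]⟩ :=
  .of_moves (.cons (S.unfold bendB rfl) <|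
    .cons (S.unfold corner₃ rfl) .nil)
    [.fwd 0 0 0 0, .bwd 1 1 1 0] (by decide +kernel)

theorem bendA_eq_corner₂ : S.m.Holds ⟨2, [],
    [fw bendA 0 0],
    [bk tri 0 0, fw corner₂ 1 1, bk (tens cup cross 0) 0 0, fw tri 1 0]⟩ :=
  .of_moves (.cons (S.bendA_eq_corner₁) <|
    .cons (S.corner₁_eq) <|
    .cons (S.foldUpAdj_bend) <|
    .cons (S.corner₂_eq) .nil)
    [.fwd 0 0 0 0, .fwd 1 1 0 0, .fwd 2 3 0 0, .left 0, .bwd 3 1 1 1] (by decide +kernel)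

theorem bendB_eq_corner₄ : S.m.Holds ⟨2, [],
    [fw bendB 0 0],
    [fw triAdj 0 0, fw corner₄ 0 1, fw (tens cap cross 0) 1 0, bk triAdj 0 0]⟩ :=
  .of_moves (.cons (S.bendB_eq_corner₃) <|
    .cons (S.corner₃_eq) <|
    .cons (S.foldDownAdj_bend) <|
    .cons (S.corner₄_eq) .nil)
    [.fwd 0 0 0 0, .fwd 1 1 1 0, .fwd 2 3 0 0, .right 0, .bwd 3 1 0 1] (by decide +kernel)

theorem cap_swallowtail : S.m.Holds ⟨2, [(cap, 0)],
    [bk tri 0 1, fw (tens cap cap 0) 1 0, bk triAdj 0 0],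
    []⟩ :=
  .of_moves (.cons ((S.tri_def).star S.hC.duals) <|
    .cons ((S.triAdj_def).star S.hC.duals) <|
    .cons (S.cap_triangle) <|
    .cons (Model.slideR_natural S.tensOK cup 0 (b := 2) (u := [])
        (X := [bk counitCup 0 0]) rfl rfl) <|
    .cons ((S.swallowtail).star S.hC.duals) <|
    .cons (Model.slideL_natural S.tensOK cap 0 (b := 0) (u := [(cup, 0), (cap, 0)])
        (X := [bk unitCup 0 0]) rfl rfl) <|
    .cons ((S.cap_triangle).star S.hC.duals) .nil)
    [.fwd 0 0 0 1, .fwd 1 4 0 0, .left 3, .left 2, .left 1, .left 0, .left 4, .left 3, .left 2,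
      .fwd 2 1 1 1, .bwd 3 1 0 0, .left 0, .right 3, .fwd 4 1 1 0, .bwd 5 1 0 0,
      .fwd 6 0 0 0] (by decide +kernel)

theorem tri_cup : S.m.Holds ⟨0, [(cup, 0), (cup, 0), (cap, 1)],
    [fw tri 1 0],
    [fw (tens cup cup 0) 0 0, bk triAdj 1 1]⟩ :=
  .of_moves (.cons (S.cancel (tens cup cup 0) rfl) <|
    .cons (S.cancel' triAdj rfl) <|
    .cons (S.swallowtail) .nil)
    [.bwd 0 0 0 0, .bwd 1 1 1 1, .fwd 2 2 0 0] (by decide +kernel)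

theorem tri_cap : S.m.Holds ⟨2, [(cup, 1), (cap, 2), (cap, 0)],
    [fw tri 0 1],
    [fw (tens cap cap 0) 1 0, bk triAdj 0 0]⟩ :=
  .of_moves (.cons (S.cap_swallowtail) <|
    .cons (S.cancel tri rfl) .nil)
    [.bwd 0 0 2 0, .left 2, .left 1, .left 0, .fwd 1 0 0 1] (by decide +kernel)

theorem triAdj_cup : S.m.Holds ⟨0, [(cup, 0)],
    [fw triAdj 1 1],
    [bk tri 1 0, fw (tens cup cup 0) 0 0]⟩ :=
  .of_moves (.cons ((S.swallowtail).star S.hC.duals) <|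
    .cons (S.cancel' triAdj rfl) .nil)
    [.bwd 0 0 0 0, .fwd 1 2 1 1] (by decide +kernel)

theorem triAdj_cap : S.m.Holds ⟨2, [(cap, 0)],
    [fw triAdj 0 0],
    [bk tri 0 1, fw (tens cap cap 0) 1 0]⟩ :=
  .of_moves (.cons (S.cap_swallowtail) <|
    .cons (S.cancel' triAdj rfl) .nil)
    [.bwd 0 0 0 0, .fwd 1 2 0 0] (by decide +kernel)

theorem cup_bendA : S.m.Holds ⟨1, [(cup, 1)],
    [fw bendA 1 0],
    [fw corner₁ 0 0]⟩ :=
  .of_moves (.cons (S.bendA_eq_corner₁) <|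
    .cons ((S.tri_cup).star S.hC.duals) <|
    .cons (S.tri_cup) <|
    .cons (S.cancel (tens cross cup 1) rfl) <|
    .cons (Model.slideL_natural S.tensOK cup 0 (b := 1) (u := [(cup, 1)])
        (X := [fw corner₁ 0 0]) rfl rfl) <|
    .cons (S.cancel' (tens cup cup 0) rfl) <|
    .cons (Model.slideR_natural S.tensOK cross 0 (b := 1) (u := [(cup, 1), (cap, 0)])
        (X := [bk triAdj 0 0]) rfl rfl) <|
    .cons (S.cancel' (tens cross cap 0) rfl) <|
    .cons (S.cancel' (tens cross cup 1) rfl) <|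
    .cons (S.cancel triAdj rfl) .nil)
    [.fwd 0 0 1 0, .fwd 1 0 0 1, .fwd 2 4 0 1, .left 3, .bwd 3 4 1 0, .fwd 4 2 0 0, .fwd 5 1 0 1,
      .fwd 6 4 1 0, .fwd 7 3 2 0, .fwd 8 2 1 0, .left 0, .fwd 9 1 2 2] (by decide +kernel)

theorem cap_bendA : S.m.Holds ⟨3, [(cap, 0)],
    [fw bendA 0 1],
    [fw corner₂ 0 0]⟩ :=
  .of_moves (.cons (S.bendA_eq_corner₂) <|
    .cons ((S.tri_cap).star S.hC.duals) <|
    .cons (S.tri_cap) <|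
    .cons (S.cancel (tens cap cross 1) rfl) <|
    .cons (Model.slideR_natural S.tensOK cap 0 (b := 3) (u := [(cap, 0)])
        (X := [fw corner₂ 0 0]) rfl rfl) <|
    .cons (S.cancel' (tens cap cap 0) rfl) <|
    .cons (Model.slideL_natural S.tensOK cross 0 (b := 1) (u := [(cup, 1), (cap, 0)])
        (X := [bk triAdj 0 0]) rfl rfl) <|
    .cons (S.cancel' (tens cup cross 0) rfl) <|
    .cons (S.cancel' (tens cap cross 1) rfl) <|
    .cons (S.cancel triAdj rfl) .nil)
    [.fwd 0 0 0 1, .fwd 1 0 0 0, .fwd 2 4 1 0, .right 3, .bwd 3 4 1 0, .fwd 4 2 1 0, .fwd 5 1 1 0,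
      .fwd 6 4 0 0, .fwd 7 3 0 1, .fwd 8 2 1 0, .right 0, .fwd 9 1 0 0] (by decide +kernel)

theorem cap_bendB : S.m.Holds ⟨3, [(cap, 1)],
    [fw bendB 0 0],
    [fw corner₃ 0 0]⟩ :=
  .of_moves (.cons (S.bendB_eq_corner₃) <|
    .cons (S.triAdj_cap) <|
    .cons ((S.triAdj_cap).star S.hC.duals) <|
    .cons (Model.slideL_natural S.tensOK cap 0 (b := 3) (u := [(cap, 1)])
        (X := [fw corner₃ 0 0]) rfl rfl) <|
    .cons (S.cancel (tens cap cap 0) rfl) <|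
    .cons (Model.slideR_natural S.tensOK cross 0 (b := 1) (u := [(cup, 0), (cap, 1)])
        (X := [fw tri 0 0]) rfl rfl) <|
    .cons (S.cancel' tri rfl) .nil)
    [.fwd 0 0 0 0, .fwd 1 0 0 1, .fwd 2 4 1 1, .bwd 3 1 1 0, .left 3, .fwd 4 4 2 1, .bwd 5 2 0 0,
      .right 0, .fwd 6 1 0 2] (by decide +kernel)

theorem cup_bendB : S.m.Holds ⟨1, [(cup, 0)],
    [fw bendB 1 1],
    [fw corner₄ 0 0]⟩ :=
  .of_moves (.cons (S.bendB_eq_corner₄) <|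
    .cons (S.triAdj_cup) <|
    .cons ((S.triAdj_cup).star S.hC.duals) <|
    .cons (Model.slideR_natural S.tensOK cup 0 (b := 1) (u := [(cup, 0)])
        (X := [fw corner₄ 0 0]) rfl rfl) <|
    .cons (S.cancel (tens cup cup 0) rfl) <|
    .cons (Model.slideL_natural S.tensOK cross 0 (b := 1) (u := [(cup, 0), (cap, 1)])
        (X := [fw tri 0 0]) rfl rfl) <|
    .cons (S.cancel' tri rfl) .nil)
    [.fwd 0 0 1 1, .fwd 1 0 0 0, .fwd 2 4 0 0, .bwd 3 1 0 0, .right 3, .fwd 4 4 0 0, .bwd 5 2 1 0,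
      .left 0, .fwd 6 1 2 0] (by decide +kernel)

theorem writheAdj_eq : S.m.Holds ⟨0, [(cup, 0)],
    [fw unitCross 1 0, bk writhe 0 0],
    [fw unitCup 0 0, fw nu 1 0]⟩ :=
  .of_moves (.cons (S.cup_triangle) <|
    .cons (S.unfold nu rfl) .nil)
    [.bwd 0 2 0 0, .left 1, .left 0, .bwd 1 1 1 0] (by decide +kernel)

theorem bendA_left : S.m.Holds ⟨1, [],
    [bk tri 0 0, fw unitCup 2 1, fw nu 1 1, fw foldUpAdj 0 0],
    [fw unitCup 0 1, fw bendA 1 0]⟩ :=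
  .of_moves (.cons (S.corner₁_eq) <|
    .cons (S.cup_bendA) .nil)
    [.right 0, .bwd 0 1 0 0, .bwd 1 1 0 0] (by decide +kernel)

theorem bendB_left : S.m.Holds ⟨1, [],
    [fw triAdj 0 0, fw unitCross 1 1, bk writhe 0 1, fw foldDownAdj 1 0],
    [fw unitCup 0 1, fw bendB 1 0]⟩ :=
  .of_moves (.cons (S.writheAdj_eq) <|
    .cons (S.corner₃_eq) <|
    .cons (S.cap_bendB) .nil)
    [.fwd 0 1 0 1, .left 0, .bwd 1 1 1 0, .bwd 2 1 1 0] (by decide +kernel)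

theorem bendA_right : S.m.Holds ⟨1, [],
    [bk tri 0 0, fw unitCross 1 0, bk writhe 0 0, bk foldDown 1 0],
    [fw unitCup 0 0, fw bendA 1 1]⟩ :=
  .of_moves (.cons (S.writheAdj_eq) <|
    .cons (S.corner₂_eq) <|
    .cons (S.cap_bendA) .nil)
    [.fwd 0 1 0 0, .left 0, .bwd 1 1 1 0, .bwd 2 1 1 0] (by decide +kernel)

theorem bendB_right : S.m.Holds ⟨1, [],
    [fw triAdj 0 0, fw unitCup 2 0, fw nu 1 0, bk foldUp 0 0],
    [fw unitCup 0 0, fw bendB 1 1]⟩ :=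
  .of_moves (.cons (S.corner₄_eq) <|
    .cons (S.cup_bendB) .nil)
    [.right 0, .bwd 0 1 0 0, .bwd 1 1 0 0] (by decide +kernel)

theorem bend_of_left
    (h : S.m.Holds ⟨1, [], [bk tri 0 0, fw unitCup 2 1, fw nu 1 1, fw foldUpAdj 0 0],
      [fw triAdj 0 0, fw unitCross 1 1, bk writhe 0 1, fw foldDownAdj 1 0]⟩) : S.m.Holds ⟨2, [],
    [fw bendA 0 0],
    [fw bendB 0 0]⟩ :=
  .of_moves (.cons (S.cancel triAdj rfl) <|
    .cons (Model.slideL_natural S.tensOK cup 0 (b := 2) (u := [])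
        (X := [fw bendA 0 0]) rfl rfl) <|
    .cons (S.cap_triangle) <|
    .cons (S.bendA_left) <|
    .cons (h) <|
    .cons (S.bendB_left) <|
    .cons (Model.slideL_natural S.tensOK cup 0 (b := 2) (u := [])
        (X := [fw bendB 0 0]) rfl rfl) .nil)
    [.bwd 0 0 0 1, .left 1, .bwd 1 1 0 0, .bwd 2 1 1 1, .right 2, .bwd 3 1 2 0, .fwd 4 1 2 0,
      .fwd 5 1 2 0, .left 2, .fwd 2 1 1 1, .fwd 6 1 0 0, .left 0, .fwd 0 1 1 1] (by decide +kernel)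

theorem foldDown_cancel : S.m.Holds ⟨3, [(cross, 1), (cap, 0)],
    [fw foldDown 0 0, bk foldDown 0 0],
    []⟩ :=
  .of_moves (.cons (S.unfold foldDown rfl) <|
    .cons ((S.unfold foldDown rfl).star S.hC.duals) <|
    .cons (S.cancel' natCap rfl) <|
    .cons (S.cancel hex₁ rfl) <|
    .cons (S.cancel' counitCross rfl) .nil)
    [.fwd 0 0 0 0, .fwd 1 3 0 0, .fwd 2 2 1 0, .fwd 3 1 1 0, .fwd 4 0 0 0] (by decide +kernel)

theorem foldDown_cancel_symm : S.m.Holds ⟨3, [(uncross, 0), (cap, 1)],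
    [bk foldDown 0 0, fw foldDown 0 0],
    []⟩ :=
  .of_moves (.cons (S.unfold foldDown rfl) <|
    .cons ((S.unfold foldDown rfl).star S.hC.duals) <|
    .cons (S.cancel counitCross rfl) <|
    .cons (S.cancel' hex₁ rfl) <|
    .cons (S.cancel natCap rfl) .nil)
    [.fwd 0 1 0 0, .fwd 1 0 0 0, .fwd 2 2 0 0, .fwd 3 1 1 0, .fwd 4 0 1 0] (by decide +kernel)

theorem bend_of_right
    (h : S.m.Holds ⟨1, [], [fw triAdj 0 0, fw unitCup 2 0, fw nu 1 0, bk foldUp 0 0,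
      fw foldDown 1 0],
      [bk tri 0 0, fw unitCross 1 0, bk writhe 0 0]⟩) : S.m.Holds ⟨2, [],
    [fw bendA 0 0],
    [fw bendB 0 0]⟩ :=
  .of_moves (.cons (S.cancel' tri rfl) <|
    .cons (S.cancel (tens cup cross 0) rfl) <|
    .cons (Model.slideR_natural S.tensOK cup 0 (b := 2) (u := [])
        (X := [fw bendA 0 0]) rfl rfl) <|
    .cons (S.cap_triangle) <|
    .cons (S.bendA_right) <|
    .cons (h) <|
    .cons (S.foldDown_cancel) <|
    .cons (S.bendB_right) <|
    .cons (Model.slideR_natural S.tensOK cup 0 (b := 2) (u := [])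
        (X := [fw bendB 0 0]) rfl rfl) .nil)
    [.bwd 0 0 0 0, .left 1, .bwd 1 2 0 0, .fwd 2 1 0 0, .bwd 3 1 1 1, .right 2, .bwd 4 1 2 1,
      .bwd 5 1 2 1, .fwd 6 5 3 1, .fwd 7 1 2 1, .left 2, .fwd 3 1 1 1, .bwd 8 1 0 0, .fwd 1 2 0 0,
      .left 0, .fwd 0 1 1 0] (by decide +kernel)

theorem left_of_bend
    (h : S.m.Holds ⟨2, [], [fw bendA 0 0],
      [fw bendB 0 0]⟩) : S.m.Holds ⟨1, [],
    [bk tri 0 0, fw unitCup 2 1, fw nu 1 1, fw foldUpAdj 0 0],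
    [fw triAdj 0 0, fw unitCross 1 1, bk writhe 0 1, fw foldDownAdj 1 0]⟩ :=
  .of_moves (.cons (S.bendA_left) <|
    .cons (h) <|
    .cons (S.bendB_left) .nil)
    [.fwd 0 0 0 0, .fwd 1 1 1 0, .bwd 2 0 0 0] (by decide +kernel)

theorem right_of_bend
    (h : S.m.Holds ⟨2, [], [fw bendA 0 0],
      [fw bendB 0 0]⟩) : S.m.Holds ⟨1, [],
    [fw triAdj 0 0, fw unitCup 2 0, fw nu 1 0, bk foldUp 0 0, fw foldDown 1 0],
    [bk tri 0 0, fw unitCross 1 0, bk writhe 0 0]⟩ :=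
  .of_moves (.cons (S.bendB_right) <|
    .cons (h) <|
    .cons (S.bendA_right) <|
    .cons (S.foldDown_cancel_symm) .nil)
    [.fwd 0 0 0 0, .bwd 1 1 1 1, .bwd 2 0 0 0, .fwd 3 3 1 0] (by decide +kernel)

theorem cup_writheAdj : S.m.Holds ⟨0, [(cup, 0)],
    [bk tri 1 0, fw unitCross 2 0, bk writhe 1 0, fw (tens cup cup 0) 0 0,
      fw (tens uncross cup 0) 1 0, bk triAdj 2 1],
    [fw unitCross 1 0, bk writhe 0 0]⟩ :=
  .of_moves (.cons (Model.slideL_natural S.tensOK cup 0 (b := 0) (u := [(cup, 0)])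
        (X := [fw unitCross 1 0, bk writhe 0 0]) rfl rfl) <|
    .cons ((S.swallowtail).star S.hC.duals) .nil)
    [.fwd 0 1 0 0, .right 3, .right 2, .fwd 1 0 0 0] (by decide +kernel)

theorem wbar_of_right
    (h : S.m.Holds ⟨1, [], [fw triAdj 0 0, fw unitCup 2 0, fw nu 1 0, bk foldUp 0 0,
      fw foldDown 1 0],
      [bk tri 0 0, fw unitCross 1 0, bk writhe 0 0]⟩) : S.m.Holds ⟨0, [(cup, 0)],
    [fw triAdj 1 0, fw unitCup 3 0, fw nu 2 0, bk foldUp 1 0, fw foldDown 2 0,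
      fw (tens cup cup 0) 0 0, fw (tens uncross cup 0) 1 0, bk triAdj 2 1],
    [fw unitCross 1 0, bk writhe 0 0]⟩ :=
  .of_moves (.cons (h) <|
    .cons (S.cup_writheAdj) .nil)
    [.fwd 0 0 1 0, .fwd 1 0 0 0] (by decide +kernel)

theorem cup_right_of_wbar
    (h : S.m.Holds ⟨0, [(cup, 0)], [fw triAdj 1 0, fw unitCup 3 0, fw nu 2 0, bk foldUp 1 0,
      fw foldDown 2 0, fw (tens cup cup 0) 0 0, fw (tens uncross cup 0) 1 0, bk triAdj 2 1],
      [fw unitCross 1 0, bk writhe 0 0]⟩) : S.m.Holds ⟨0, [(cup, 0)],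
    [fw triAdj 1 0, fw unitCup 3 0, fw nu 2 0, bk foldUp 1 0, fw foldDown 2 0],
    [bk tri 1 0, fw unitCross 2 0, bk writhe 1 0]⟩ :=
  .of_moves (.cons (S.cancel (tens cup cup 0) rfl) <|
    .cons (S.cancel (tens uncross cup 0) rfl) <|
    .cons (S.cancel' triAdj rfl) <|
    .cons (h) <|
    .cons (S.cup_writheAdj) .nil)
    [.bwd 0 4 0 0, .right 5, .bwd 1 6 1 0, .bwd 2 7 2 1, .right 4, .fwd 3 0 0 0, .bwd 4 0 0 0,
      .fwd 2 5 2 1, .fwd 1 4 1 0, .fwd 0 3 0 0] (by decide +kernel)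

theorem right_of_cup_right
    (h : S.m.Holds ⟨0, [(cup, 0)], [fw triAdj 1 0, fw unitCup 3 0, fw nu 2 0, bk foldUp 1 0,
      fw foldDown 2 0],
      [bk tri 1 0, fw unitCross 2 0, bk writhe 1 0]⟩) : S.m.Holds ⟨1, [],
    [fw triAdj 0 0, fw unitCup 2 0, fw nu 1 0, bk foldUp 0 0, fw foldDown 1 0],
    [bk tri 0 0, fw unitCross 1 0, bk writhe 0 0]⟩ :=
  .of_moves (.cons (S.cancel' tri rfl) <|
    .cons (S.cancel (tens cup cap 1) rfl) <|
    .cons (S.cancel (tens uncross cap 1) rfl) <|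
    .cons (S.cancel (tens cap cap 0) rfl) <|
    .cons (Model.slideL_natural S.tensOK cap 0 (b := 1) (u := [])
        (X := [fw triAdj 0 0, fw unitCup 2 0, fw nu 1 0, bk foldUp 0 0,
          fw foldDown 1 0]) rfl rfl) <|
    .cons (h) <|
    .cons (Model.slideL_natural S.tensOK cap 0 (b := 1) (u := [])
        (X := [bk tri 0 0, fw unitCross 1 0, bk writhe 0 0]) rfl rfl) .nil)
    [.bwd 0 0 0 0, .right 1, .right 2, .right 3, .right 4, .bwd 1 5 1 0, .right 7, .right 6,
      .bwd 2 7 2 0, .bwd 3 8 3 1, .right 5, .fwd 4 1 1 0, .fwd 5 1 0 0, .bwd 6 1 1 0, .fwd 3 6 3 1,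
      .fwd 2 5 2 0, .fwd 1 4 1 0, .right 0, .right 1, .right 2, .fwd 0 3 0 0] (by decide +kernel)

end Setup

end Diagram

namespace Diagram

open Gen Name DualsData

namespace Model

variable {C : DualsData} {m : Model C} {α β : C.Cell} {n : ℕ} {u v : Word} {P Q : Path}

theorem Den.of_holds (h : m.Den α n u P) (e : m.Holds ⟨n, u, P, Q⟩) : m.Den α n u Q :=
  ⟨h.word, e.right, h.eq.trans e.ev_eq⟩

theorem Den.eq_of_holds (h : m.Den α n u P) (h' : m.Den β n u Q) (e : m.Holds ⟨n, u, P, Q⟩) :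
    α = β :=
  h.eq.trans (e.ev_eq.trans h'.eq.symm)

theorem Den.isCell (h : m.Den α n u P) : C.IsCell α (m.mor n u) (m.mor n (run u P))
    (pw C.toMonTwoCat m.A n) (pw C.toMonTwoCat m.A (wd n u)) := by
  have s := wmor_src_tgt m.hg h.word
  have t := wmor_src_tgt m.hg h.run_ok
  rw [h.run_wd] at t
  exact ⟨h.src, h.tgt, s.1, s.2, t.1, t.2⟩

/-- The 2-morphism `β` is `α†*`, and `α` is interpreted by a path. -/
structure Flips (m : Model C) (α β : C.Cell) (n : ℕ) (u : Word) (P : Path) : Prop where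
  den : m.Den α n u P
  eq : C.dCell (C.adj α) = β

namespace Flips

variable {α' β' : C.Cell} {f : C.Mor} (hC : DualsLaws C)
include hC

theorem id (h : m.DenM f n u) : m.Flips (C.id₂ f) (C.id₂ (C.dMor f)) n u [] :=
  ⟨.id h, by rw [adj_id hC rfl rfl, hC.dCell_id]⟩

theorem vcomp (h : m.Flips α α' n u P) (h' : m.Flips β β' n (run u P) Q) :
    m.Flips (C.vcomp α β) (C.vcomp α' β') n u (P ++ Q) := by
  refine ⟨h.den.vcomp h'.den, ?_⟩
  have a := h.den.isCell
  have b := h'.den.isCell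
  rw [h.den.run_wd] at b
  rw [adj_vcomp hC a b, hC.dCell_vcomp _ _ (b.adj.tgt.trans a.adj.src.symm), h.eq, h'.eq]

theorem hcomp (h : m.Flips α α' n u P) (h' : m.Flips β β' (wd n u) v Q) :
    m.Flips (C.hcomp α β) (C.hcomp β' α') n (u ++ v) (P ++ shP (run u P).length 0 Q) := by
  refine ⟨h.den.hcomp h'.den, ?_⟩
  have a := h.den.isCell
  have b := h'.den.isCell
  have d := b.adj
  have e := a.adj
  rw [adj_hcomp hC a b, hC.dCell_hcomp, h.eq, h'.eq]
  rw [d.src, e.src, d.src_tgt, e.src_src]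

end Flips

end Model

namespace Setup

variable {S : Setup} {α β : S.C.Cell} {n : ℕ} {u : Word} {P : Path}

theorem _root_.Diagram.Model.Flips.one_left (h : S.m.Flips α β n u P) :
    S.m.Flips (S.C.tOC S.A α) (S.C.tOC S.A β) (1 + n) (sh 1 u) (shP 0 1 P) :=
  ⟨h.den.one_left, by rw [adj_tOC S.hC.duals, S.hC.duals.dCell_tOC, h.eq]⟩

theorem _root_.Diagram.Model.Flips.one_right (h : S.m.Flips α β n u P) :
    S.m.Flips (S.C.tCO α S.A) (S.C.tCO β S.A) (n + 1) u P :=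
  ⟨h.den.one_right, by rw [adj_tCO S.hC.duals, S.hC.duals.dCell_tCO, h.eq]⟩

/-- The operation `α ↦ α†*` is involutive. -/
theorem flip_flip (α : S.C.Cell) : S.C.dCell (S.C.adj (S.C.dCell (S.C.adj α))) = α := by
  rw [S.hC.duals.adj_star, S.hC.duals.dCell_invol, adj_adj S.hC.duals (IsCell.mk' α)]

variable (S)

/-- The 2-morphism `H̄†*`. -/
def kappa : S.C.Cell :=
  S.C.vcomp (S.C.vcomp
    (S.C.hcomp (S.C.hcomp (S.C.tCO (S.C.dCell (S.C.eCell (S.C.braid S.A S.A))) S.A)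
        (S.C.id₂ (S.C.tOM S.A (S.C.braid S.A S.A))))
      (S.C.id₂ (S.C.tMO (S.C.eObj S.A) S.A)))
    (S.C.hcomp (S.C.hcomp (S.C.id₂ (S.C.tMO (S.C.dMor (S.C.braid S.A S.A)) S.A))
        (S.C.Rt1 S.A S.A S.A))
      (S.C.id₂ (S.C.tMO (S.C.eObj S.A) S.A))))
    (S.C.hcomp (S.C.id₂ (S.C.tMO (S.C.dMor (S.C.braid S.A S.A)) S.A))
      (S.C.dCell (S.C.braidMorR S.A (S.C.eObj S.A))))

theorem flips_kappa : S.m.Flips S.kappa (S.C.HbarCell S.A S.A) 3 [(cross, 1), (cap, 0)]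
    foldDownP := by
  have hC := S.hC.duals
  have a : S.m.Flips (S.C.dCell (S.C.eCell (S.C.braid S.A S.A)))
      (S.C.iCell (S.C.dMor (S.C.braid S.A S.A))) 2 [] [bk counitCross 0 0] :=
    ⟨((S.den counitCross rfl).dual hC).cast rfl rfl rfl rfl, by
      rw [← hC.adj_star, hC.dCell_invol, adj_eCell hC, hC.iCell_dual]⟩
  have b : S.m.Flips (S.C.Rt1 S.A S.A S.A) _ 3 [(cross, 0), (cross, 1)] [fw hex₁ 0 0] :=
    ⟨S.den hex₁ rfl, rfl⟩
  have c : S.m.Flips (S.C.dCell (S.C.braidMorR S.A (S.C.eObj S.A)))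
      (S.C.adj (S.C.braidMorR S.A (S.C.eObj S.A))) 3 [(over₂, 0), (cap, 0)] [bk natCap 0 0] :=
    ⟨((S.den natCap rfl).dual hC).cast rfl rfl rfl rfl, by
      rw [← hC.adj_star, hC.dCell_invol]⟩
  have r : S.m.Flips _ _ 3 [(cross, 1)] [] := .id hC (S.dm cross).one_left
  have s : S.m.Flips _ _ 3 [(uncross, 0)] [] := .id hC (S.dm uncross).one_right
  have e : S.m.Flips _ _ 3 [(cap, 0)] [] := .id hC (S.dm cap).one_right
  have x := Model.Flips.hcomp hC (.hcomp hC a.one_right r) e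
  have y := Model.Flips.hcomp hC (.hcomp hC s b) e
  have t := Model.Flips.vcomp hC (.vcomp hC x y) (.hcomp hC s c)
  refine ⟨t.den, t.eq.trans ?_⟩
  simp only [BMWDData.HbarCell, BMWDData.adjC, S.self, gm, hC.dMor_tOM, hC.dMor_tMO,
    hC.dMor_invol, S.eObj_eq]

theorem flip_Hbar : S.C.dCell (S.C.adjC (S.C.HbarCell S.A S.A)) = S.kappa := by
  rw [← S.flips_kappa.eq]
  exact flip_flip _

theorem den_flip_Hbar : S.m.Den (S.C.dCell (S.C.adjC (S.C.HbarCell S.A S.A))) 3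
    [(cross, 1), (cap, 0)] [fw foldDown 0 0] := by
  rw [flip_Hbar]
  exact S.flips_kappa.den.of_holds (S.unfold foldDown rfl).symm

theorem den_Hbar : S.m.Den (S.C.HbarCell S.A S.A) 1 [(cup, 0), (uncross, 1)]
    [fw foldUpAdj 0 0] := by
  have hC := S.hC.duals
  rw [← S.flips_kappa.eq, hC.adj_star]
  have := ((S.flips_kappa.den.dual hC).adj rfl rfl).cast (P' := foldUpAdjP) rfl rfl rfl rfl
  exact this.of_holds (S.unfold foldUpAdj rfl).symm

theorem den_H_path : S.m.Den (S.C.Hcell S.A S.A) 1 [(cup, 0), (cross, 1)] foldUpP := by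
  have i : S.m.Den _ 1 [(cup, 0)] [] := .id (S.dm cup).one_right
  have r : S.m.Den _ 3 [(cross, 1)] [] := .id (S.dm cross).one_left
  have s : S.m.Den _ 3 [(uncross, 0)] [] := .id (S.dm uncross).one_right
  simp only [BMWDData.Hcell, S.self]
  exact ((i.hcomp (r.hcomp (S.den unitCross rfl).one_right)).vcomp
    (i.hcomp ((S.den hex₂ rfl).hcomp s))).vcomp ((S.den natCup rfl).hcomp s)

theorem den_H : S.m.Den (S.C.Hcell S.A S.A) 1 [(cup, 0), (cross, 1)] [fw foldUp 0 0] :=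
  S.den_H_path.of_holds (S.unfold foldUp rfl).symm

theorem den_flip_H : S.m.Den (S.C.dCell (S.C.adj (S.C.Hcell S.A S.A))) 3
    [(uncross, 1), (cap, 0)] [fw foldDownAdj 0 0] := by
  have hC := S.hC.duals
  have := ((S.den_H_path.adj rfl rfl).dual hC).cast (P' := foldDownAdjP) rfl rfl rfl rfl
  exact this.of_holds (S.unfold foldDownAdj rfl).symm


theorem den_flip_W : S.m.Den (S.C.dCell (S.C.adj S.W)) 2 [(cap, 0)]
    [fw unitCup 1 0, fw nu 0 0] := by
  have hC := S.hC.duals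
  have := (((S.den writhe rfl).dual hC).adj rfl rfl).cast (hC.adj_star _) rfl rfl rfl
  refine this.of_holds ?_
  exact .of_moves (.cons (S.unfold nu rfl) .nil) [.bwd 0 1 0 0] (by decide +kernel)


theorem writheEq_iff : S.C.WritheEq S.A S.W ↔ S.m.Holds ⟨1, [],
    [bk tri 0 0, fw unitCup 2 1, fw nu 1 1, fw foldUpAdj 0 0],
    [fw triAdj 0 0, fw unitCross 1 1, bk writhe 0 1, fw foldDownAdj 1 0]⟩ := by
  have hC := S.hC.duals
  have t : S.m.Flips (S.C.adjC (S.C.tri S.A)) (S.C.dCell (S.C.tri S.A)) 1 [] [fw triAdj 0 0] :=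
    ⟨S.den triAdj rfl, by rw [BMWDData.adjC, adj_adj hC (IsCell.mk' _)]⟩
  have t' : S.m.Flips (S.C.dCell (S.C.tri S.A)) (S.C.adj (S.C.tri S.A)) 1 [] [bk tri 0 0] :=
    ⟨((S.den tri rfl).dual hC).cast rfl rfl rfl rfl, by rw [← hC.adj_star, hC.dCell_invol]⟩
  have w : S.m.Flips S.W _ 0 [(cup, 0)] [fw writhe 0 0] := ⟨S.den writhe rfl, rfl⟩
  have w' : S.m.Flips (S.C.adj S.W) (S.C.dCell S.W) 2 [(uncross, 0), (cap, 0)] _ :=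
    ⟨((S.den writhe rfl).adj rfl rfl).cast rfl rfl rfl rfl, by rw [adj_adj hC (IsCell.mk' _)]⟩
  have r : S.m.Flips (S.C.iCell (S.C.braid S.A S.A)) (S.C.iCell (S.C.braid S.A S.A)) 2 []
      [fw unitCross 0 0] :=
    ⟨S.den unitCross rfl, by rw [adj_iCell hC, hC.dCell_invol]⟩
  have k : S.m.Flips _ (S.C.HbarCell S.A S.A) 3 [(cross, 1), (cap, 0)] _ :=
    ⟨S.den_flip_Hbar, flip_flip _⟩
  have h : S.m.Flips (S.C.Hcell S.A S.A) _ 1 [(cup, 0), (cross, 1)] _ := ⟨S.den_H, rfl⟩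
  have i₁ : S.m.Flips _ _ 1 [(cup, 0)] [] := .id hC (S.dm cup).one_right
  have i₂ : S.m.Flips _ _ 1 [(cup, 1)] [] := .id hC (S.dm cup).one_left
  have e₁ : S.m.Flips _ _ 3 [(cap, 0)] [] := .id hC (S.dm cap).one_right
  have e₂ : S.m.Flips _ _ 3 [(cap, 1)] [] := .id hC (S.dm cap).one_left
  have e : S.m.Flips _ _ 2 [(cap, 0)] [] := .id hC (S.dm cap)
  have c : S.m.Flips _ _ 2 [(cross, 0)] [] := .id hC (S.dm cross)
  have a₁ := Model.Flips.hcomp hC w.one_left e₁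
  have a₂ := Model.Flips.hcomp hC i₂ k
  have a := Model.Flips.vcomp hC (.vcomp hC t a₁) a₂
  have b₁ := Model.Flips.hcomp hC i₁ (Model.Flips.hcomp hC r e).one_left
  have b₂ := Model.Flips.hcomp hC i₁ (Model.Flips.hcomp hC c w').one_left
  have b₃ := Model.Flips.hcomp hC h e₂
  have b := Model.Flips.vcomp hC (.vcomp hC (.vcomp hC t' b₁) b₂) b₃
  have aeq := a.eq
  have beq := b.eq
  have he : S.C.dMor (S.C.eObj S.A) = S.C.iObj S.A := by rw [S.eObj_eq, hC.dMor_invol]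
  simp only [gm, hC.dMor_tOM, hC.dMor_tMO, he, ← S.eObj_eq] at aeq beq
  have j₁ : S.m.Den _ 1 [(cup, 0)] [] := .id (S.dm cup).one_right
  have j₂ : S.m.Den _ 1 [(cup, 1)] [] := .id (S.dm cup).one_left
  have f₁ : S.m.Den _ 3 [(cap, 0)] [] := .id (S.dm cap).one_right
  have f₂ : S.m.Den _ 3 [(cap, 1)] [] := .id (S.dm cap).one_left
  have l : S.m.Den _ 1 [] [bk tri 0 0, fw unitCup 2 1, fw nu 1 1, fw foldUpAdj 0 0] :=
    (t'.den.vcomp (j₁.hcomp S.den_flip_W.one_left)).vcomp (S.den_Hbar.hcomp f₂)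
  have w₂ : S.m.Den (S.C.dCell S.W) 0 [(cup, 0), (cross, 0)] [bk writhe 0 0] :=
    ((S.den writhe rfl).dual hC).cast rfl rfl rfl rfl
  have q₁ := ((S.dI cup).hcomp r.den).one_left.hcomp f₁
  have q₂ := (w₂.hcomp (S.dI uncross)).one_left.hcomp f₁
  have q : S.m.Den _ 1 []
      [fw triAdj 0 0, fw unitCross 1 1, bk writhe 0 1, fw foldDownAdj 1 0] :=
    ((t.den.vcomp q₁).vcomp q₂).vcomp (j₂.hcomp S.den_flip_H)
  have l' := l.cast aeq rfl rfl rfl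
  have q' := q.cast beq rfl rfl rfl
  constructor
  · intro h
    exact l'.holds q' (congrArg (fun x => S.C.dCell (S.C.adj x)) h) rfl
  · intro h
    have := congrArg (fun x => S.C.dCell (S.C.adj x)) (l'.eq_of_holds q' h)
    exact (flip_flip _).symm.trans (this.trans (flip_flip _))

theorem dObj_unit : S.C.dObj S.C.unit = S.C.unit := by
  have hC := S.hC.duals
  have := hC.dObj_tOO (S.C.dObj S.C.unit) S.C.unit
  rwa [S.C.tOO_unit_right, hC.dObj_invol, S.C.tOO_unit_right, eq_comm] at this

theorem eObj_unit : S.C.eObj S.C.unit = S.C.id₁ S.C.unit := by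
  have hC := S.hC.duals
  have u := S.dObj_unit
  have t := congrArg S.C.src₂ hC.tri_unit
  rw [S.C.tri_src, S.C.id₂_src, S.C.tMO_unit, S.C.tOM_unit] at t
  have h := hC.eObj_tensor S.C.unit S.C.unit
  rw [S.C.tOO_unit_left, u, S.C.tOM_unit, S.C.tMO_unit] at h
  have es : S.C.src₁ (S.C.eObj S.C.unit) = S.C.unit := by
    rw [S.C.eObj_src, u, S.C.tOO_unit_left]
  have a := S.C.comp_assoc (S.C.iObj S.C.unit) (S.C.eObj S.C.unit) (S.C.eObj S.C.unit)
    (by rw [S.C.iObj_tgt, u, S.C.tOO_unit_left, es]) (by rw [S.C.eObj_tgt, es])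
  rwa [← h, t, S.unit_idl es] at a

theorem iObj_two : S.C.iObj (S.C.tOO S.A S.A) =
    S.C.comp (S.C.iObj S.A) (S.C.tOM S.A (S.C.tMO (S.C.iObj S.A) S.A)) := by
  rw [S.hC.duals.iObj_tensor, S.self]

theorem dObj_two : S.C.dObj (S.C.tOO S.A S.A) = S.C.tOO S.A S.A := by
  rw [S.hC.duals.dObj_tOO, S.self]

theorem den_hat : S.m.Den (S.C.hatCell (S.C.dCell (S.C.adjC S.W))) 0
    [(cup, 0), (cup, 1), (cap, 0)] [fw unitCup 3 0, fw nu 2 0] := by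
  have h := S.den_flip_W
  have e := (S.dm cap)
  have s : S.C.src₂ (S.C.dCell (S.C.adjC S.W)) = S.C.eObj S.A := h.src.trans e.eq.symm
  unfold BMWDData.hatCell
  rw [s, S.C.eObj_tgt, S.cap_src, S.dObj_unit, S.dObj_two, S.eObj_unit, S.C.tOM_unit,
    S.C.tOC_unit, S.C.tMO_id, S.C.tOO_unit_left, S.iObj_two]
  have i : S.m.DenM (S.C.comp (S.C.iObj S.A) (S.C.tOM S.A (S.C.tMO (S.C.iObj S.A) S.A))) 0
      [(cup, 0), (cup, 1)] := (S.dm cup).comp S.goodGen (S.dm cup).one_right.one_left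
  exact (Model.Den.id i).hcomp (h.two_right.hcomp (Model.Den.id S.dmId2))

theorem den_tens_comp : S.m.Den
    (S.C.tensorator (S.C.comp (S.C.iObj S.A) (S.C.dMor (S.C.braid S.A S.A))) (S.C.iObj S.A)) 0
    [(cup, 0), (cup, 0), (uncross, 0)]
    [fw (tens cup cup 0) 0 0, fw (tens uncross cup 0) 1 0] := by
  have t : S.C.tgt₁ (S.C.iObj S.A) = S.C.src₁ (S.C.dMor (S.C.braid S.A S.A)) := by
    rw [S.C.dMor_src, S.hC.braid_tgt, S.cup_tgt]
  rw [S.C.tens_comp_left _ _ _ t, S.cup_tgt, S.C.iObj_src, S.C.tMO_unit]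
  have s : S.m.Den _ 4 [(uncross, 0)] [] := .id (S.dm uncross).two_right
  exact ((S.den_tens cup cup).hcomp s).vcomp ((S.dI cup).hcomp (S.den_tens uncross cup))

theorem den_wbar : S.m.Den (S.C.Wbar S.A S.W) 0 [(cup, 0)]
    (shP 1 0 [fw triAdj 0 0, fw unitCup 2 0, fw nu 1 0, bk foldUp 0 0, fw foldDown 1 0] ++
      [fw (tens cup cup 0) 0 0, fw (tens uncross cup 0) 1 0, bk triAdj 2 1]) := by
  have hC := S.hC.duals
  have i := S.dI cup
  have a := i.hcomp (S.den triAdj rfl).one_right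
  have h : S.m.Den _ 1 [(cup, 1), (uncross, 0)] [bk foldUp 0 0] :=
    (S.den_H.dual hC).cast rfl rfl rfl rfl
  have e : S.m.Den _ 4 [(cap, 0)] [] := .id (S.dm cap).one_right.one_right
  have j : S.m.Den _ 2 [(cup, 0)] [] := .id (S.dm cup).one_right.one_right
  have b := i.hcomp (h.one_right.hcomp e)
  have c := i.hcomp (j.hcomp S.den_flip_Hbar.one_right)
  have f : S.m.Den _ 4 [(cap, 1)] [] := .id (S.dm cap).one_left.one_right
  have g : S.m.DenM (S.C.comp (S.C.iObj S.A) (S.C.dMor (S.C.braid S.A S.A))) 0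
      [(cup, 0), (uncross, 0)] := (S.dm cup).comp S.goodGen (S.dm uncross)
  have t : S.m.Den _ 1 [(cup, 1), (cap, 0)] [bk triAdj 0 0] :=
    ((S.den triAdj rfl).dual hC).cast rfl rfl rfl rfl
  have k := (Model.Den.id g).hcomp t.one_left
  exact (a.vcomp S.den_hat).vcomp (((b.vcomp c).vcomp (S.den_tens_comp.hcomp f)).vcomp k)

theorem wbar_iff : S.C.Wbar S.A S.W =
      S.C.vcomp (S.C.hcomp (S.C.id₂ (S.C.iObj S.A)) (S.C.iCell (S.C.braid S.A S.A)))
        (S.C.hcomp (S.C.dCell S.W) (S.C.id₂ (S.C.dMor (S.C.braid S.A S.A)))) ↔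
    S.m.Holds ⟨0, [(cup, 0)],
      shP 1 0 [fw triAdj 0 0, fw unitCup 2 0, fw nu 1 0, bk foldUp 0 0, fw foldDown 1 0] ++
        [fw (tens cup cup 0) 0 0, fw (tens uncross cup 0) 1 0, bk triAdj 2 1],
      [fw unitCross 1 0, bk writhe 0 0]⟩ := by
  have w : S.m.Den (S.C.dCell S.W) 0 [(cup, 0), (cross, 0)] [bk writhe 0 0] :=
    ((S.den writhe rfl).dual S.hC.duals).cast rfl rfl rfl rfl
  have u : S.m.Den _ 0 [(cup, 0)] [fw unitCross 1 0, bk writhe 0 0] :=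
    ((S.dI cup).hcomp (S.den unitCross rfl)).vcomp (w.hcomp (S.dI uncross))
  exact ⟨fun h => S.den_wbar.holds u h rfl, fun h => S.den_wbar.eq_of_holds u h⟩

theorem writheEq_iff_wbar : S.C.WritheEq S.A S.W ↔ S.C.Wbar S.A S.W =
    S.C.vcomp (S.C.hcomp (S.C.id₂ (S.C.iObj S.A)) (S.C.iCell (S.C.braid S.A S.A)))
      (S.C.hcomp (S.C.dCell S.W) (S.C.id₂ (S.C.dMor (S.C.braid S.A S.A)))) :=
  S.writheEq_iff.trans <| Iff.trans
    ⟨fun h => S.wbar_of_right (S.right_of_bend (S.bend_of_left h)), fun h =>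
      S.left_of_bend (S.bend_of_right (S.right_of_cup_right (S.cup_right_of_wbar h)))⟩
    S.wbar_iff.symm

end Setup

end Diagram

/-- **Lemma 9 of HDA IV.**  Let `A` be a self-dual object in a braided monoidal
2-category with duals.  A unitary 2-morphism `W_A : i_A ⇒ i_A R_{A,A}` is a
writhing for `A` (i.e. satisfies the writhing coherence law) if and only if it
satisfies the equation `W̄_A = (i_A i_{R_{A,A}}) ⋅ (W*_A R*_{A,A})`. -/
theorem writhing_iff_wbar
    (C : BMWDData) (hC : IsBMWD C)
    (A : C.Obj) (hself : C.dObj A = A)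
    (W : C.Cell)
    (hsrc : C.src₂ W = C.iObj A)
    (htgt : C.tgt₂ W = C.comp (C.iObj A) (C.braid A A))
    (hunitary : DualsData.Unitary C.toDualsData W) :
    C.WritheEq A W ↔
      C.Wbar A W
        = C.vcomp (C.hcomp (C.id₂ (C.iObj A)) (C.iCell (C.braid A A)))
            (C.hcomp (C.dCell W) (C.id₂ (C.dMor (C.braid A A)))) :=
  Diagram.Setup.writheEq_iff_wbar ⟨C, hC, A, hself, W, hsrc, htgt⟩
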